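/- arXiv:1202.5077 — 4 statements merged into one kernel-verified Lean document; each statement's English description precedes it below -/
import Mathlib

section
/- Let V be a finite-dimensional complex vector space, N a nilpotent endomorphism of V, and k an integer. Then there exists a unique increasing filtration W : ℤ → (subspaces of V), with W_i = 0 for i sufficiently small and W_i = V for i sufficiently large, such that N(W_i) ⊆ W_{i−2} for every i and such that for every i ≥ 0 the map induced by N^i from Gr_{k+i}^W = W_{k+i}/W_{k+i−1} to Gr_{k−i}^W = W_{k−i}/W_{k−i−1} is a linear isomorphism. -/
open Submodule

/-- The graded piece `Gr_i^W = W_i / W_{i-1}` of a filtration `W : ℤ → Submodule ℂ V`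
(the quotient of `W i` by `W (i-1)`, viewed inside `W i`). -/
abbrev GrW {V : Type*} [AddCommGroup V] [Module ℂ V] (W : ℤ → Submodule ℂ V) (i : ℤ) :=
  W i ⧸ (Submodule.comap (W i).subtype (W (i - 1)))

/-- The map `Gr_i^W → Gr_j^W` induced on graded pieces by an endomorphism `f`
mapping `W i` into `W j` and `W (i-1)` into `W (j-1)`. -/
def grInduced {V : Type*} [AddCommGroup V] [Module ℂ V] (W : ℤ → Submodule ℂ V)
    (f : Module.End ℂ V) (i j : ℤ) (hf : ∀ x ∈ W i, f x ∈ W j)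
    (hf' : ∀ x ∈ W (i - 1), f x ∈ W (j - 1)) : GrW W i →ₗ[ℂ] GrW W j :=
  Submodule.mapQ _ _ (f.restrict hf) (fun x hx => hf' x.1 hx)

/-- If `N` maps each `W i` into `W (i-2)`, then `N^m` maps `W i` into `W (i-2m)`. -/
theorem pow_mem_filtration {V : Type*} [AddCommGroup V] [Module ℂ V]
    (N : Module.End ℂ V) (W : ℤ → Submodule ℂ V)
    (step : ∀ j : ℤ, ∀ x ∈ W j, N x ∈ W (j - 2)) :
    ∀ (m : ℕ) (j : ℤ), ∀ x ∈ W j, (N ^ m) x ∈ W (j - 2 * m) := by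
  intro m
  induction m with
  | zero => intro j x hx; simpa using hx
  | succ m ih =>
    intro j x hx
    have h1 : (N ^ (m + 1)) x = N ((N ^ m) x) := by
      rw [pow_succ']; rfl
    rw [h1]
    have h2 := step (j - 2 * m) _ (ih j x hx)
    have h3 : j - 2 * (m : ℤ) - 2 = j - 2 * ((m : ℕ) + 1 : ℕ) := by push_cast; ring
    rwa [h3] at h2

/-- `W : ℤ → Submodule ℂ V` is the monodromy filtration of the nilpotent endomorphism `N`
centered at `k`: it is increasing, separated, exhaustive, satisfies `N (W i) ⊆ W (i-2)`,
and for every `i ≥ 0` the map induced by `N^i` from `Gr_{k+i}^W` to `Gr_{k-i}^W`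
is a linear isomorphism. -/
structure IsMonodromyFiltration {V : Type*} [AddCommGroup V] [Module ℂ V]
    (N : Module.End ℂ V) (k : ℤ) (W : ℤ → Submodule ℂ V) : Prop where
  mono : Monotone W
  separated : ∃ a : ℤ, ∀ i ≤ a, W i = ⊥
  exhaustive : ∃ b : ℤ, ∀ i : ℤ, b ≤ i → W i = ⊤
  step : ∀ j : ℤ, ∀ x ∈ W j, N x ∈ W (j - 2)
  iso : ∀ i : ℕ, Function.Bijective
    (grInduced W (N ^ i) (k + i) (k - i)
      (fun x hx => by
        have h := pow_mem_filtration N W step i (k + i) x hx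
        rwa [show k + (i : ℤ) - 2 * i = k - i by ring] at h)
      (fun x hx => by
        have h := pow_mem_filtration N W step i (k + i - 1) x hx
        rwa [show k + (i : ℤ) - 1 - 2 * i = k - i - 1 by ring] at h))


theorem grInduced_bijective_iff {V : Type*} [AddCommGroup V] [Module ℂ V]
    (W : ℤ → Submodule ℂ V)
    (f : Module.End ℂ V) (i j : ℤ) (hf : ∀ x ∈ W i, f x ∈ W j)
    (hf' : ∀ x ∈ W (i - 1), f x ∈ W (j - 1)) :
    Function.Bijective (grInduced W f i j hf hf') ↔
      (∀ x ∈ W i, f x ∈ W (j - 1) → x ∈ W (i - 1)) ∧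
      (∀ y ∈ W j, ∃ x ∈ W i, f x - y ∈ W (j - 1)) := by
  have key : ∀ x : W i, grInduced W f i j hf hf' (Submodule.Quotient.mk x) =
      Submodule.Quotient.mk ⟨f x.1, hf x.1 x.2⟩ := fun x => rfl
  constructor
  · rintro ⟨h1, h2⟩
    refine ⟨fun x hx hfx => ?_, fun y hy => ?_⟩
    · have h0 : grInduced W f i j hf hf' (Submodule.Quotient.mk ⟨x, hx⟩) = 0 := by
        rw [key, Submodule.Quotient.mk_eq_zero]
        exact hfx
      have := (injective_iff_map_eq_zero _).1 h1 _ h0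
      rw [Submodule.Quotient.mk_eq_zero] at this
      exact this
    · obtain ⟨q, hq⟩ := h2 (Submodule.Quotient.mk ⟨y, hy⟩)
      obtain ⟨x, rfl⟩ := Submodule.Quotient.mk_surjective _ q
      rw [key, Submodule.Quotient.eq] at hq
      exact ⟨x.1, x.2, hq⟩
  · rintro ⟨h1, h2⟩
    constructor
    · rw [injective_iff_map_eq_zero]
      intro q hq
      obtain ⟨x, rfl⟩ := Submodule.Quotient.mk_surjective _ q
      rw [key, Submodule.Quotient.mk_eq_zero] at hq
      rw [Submodule.Quotient.mk_eq_zero]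
      exact h1 x.1 x.2 hq
    · intro q
      obtain ⟨y, rfl⟩ := Submodule.Quotient.mk_surjective _ q
      obtain ⟨x, hx, hxy⟩ := h2 y.1 y.2
      refine ⟨Submodule.Quotient.mk ⟨x, hx⟩, ?_⟩
      rw [key, Submodule.Quotient.eq]
      exact hxy

/-- The explicit filtration: `F_l` is the sum of `ker N^a ∩ im N^b` for `a - b ≤ l - k + 1`. -/
def monoFil {V : Type*} [AddCommGroup V] [Module ℂ V] (N : Module.End ℂ V) (k l : ℤ) :
    Submodule ℂ V :=
  Submodule.span ℂ {x | ∃ (a b : ℕ) (v : V), (a : ℤ) - b ≤ l - k + 1 ∧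
    (N ^ (a + b)) v = 0 ∧ x = (N ^ b) v}

section
variable {V : Type*} [AddCommGroup V] [Module ℂ V] {N : Module.End ℂ V} {k : ℤ}

theorem monoFil_mem {l : ℤ} (a b : ℕ) (v : V) (h : (a : ℤ) - b ≤ l - k + 1)
    (hv : (N ^ (a + b)) v = 0) : (N ^ b) v ∈ monoFil N k l :=
  Submodule.subset_span ⟨a, b, v, h, hv, rfl⟩

theorem monoFil_ker {l : ℤ} (a : ℕ) (v : V) (h : (a : ℤ) ≤ l - k + 1)
    (hv : (N ^ a) v = 0) : v ∈ monoFil N k l := by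
  have := monoFil_mem (N := N) (k := k) (l := l) a 0 v (by simpa using h) (by simpa using hv)
  simpa using this

theorem monoFil_mono : Monotone (monoFil N k) := by
  intro l m hlm
  apply Submodule.span_mono
  rintro x ⟨a, b, v, h, hv, rfl⟩
  exact ⟨a, b, v, by omega, hv, rfl⟩

theorem monoFil_step (j : ℤ) : ∀ x ∈ monoFil N k j, N x ∈ monoFil N k (j - 2) := by
  suffices monoFil N k j ≤ (monoFil N k (j - 2)).comap N from fun x hx => this hx
  apply Submodule.span_le.2
  rintro x ⟨a, b, v, h, hv, rfl⟩
  change N ((N ^ b) v) ∈ monoFil N k (j - 2)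
  have e : N ((N ^ b) v) = (N ^ (b + 1)) v := by rw [pow_succ']; rfl
  rw [e]
  rcases a with _ | a
  · rw [zero_add] at hv
    rw [← e, hv, map_zero]
    exact zero_mem _
  · apply monoFil_mem a
    · push_cast at h ⊢; omega
    · rw [← hv]; congr 2; omega

theorem monoFil_surj (i : ℕ) : ∀ y ∈ monoFil N k (k - i), ∃ x ∈ monoFil N k (k + i),
    (N ^ i) x = y := by
  suffices monoFil N k (k - i) ≤ (monoFil N k (k + i)).map (N ^ i) from fun x hx => this hx
  apply Submodule.span_le.2
  rintro x ⟨a, b, v, h, hv, rfl⟩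
  by_cases hb : i ≤ b
  · refine ⟨(N ^ (b - i)) v, ?_, ?_⟩
    · apply monoFil_mem (a + i)
      · push_cast [hb]; omega
      · rw [← hv]; congr 2; omega
    · rw [← Module.End.mul_apply, ← pow_add]; congr 2; omega
  · have : a = 0 := by omega
    subst this
    rw [zero_add] at hv
    rw [hv]
    exact zero_mem _

theorem monoFil_top (n : ℕ) (hn : N ^ n = 0) (i : ℤ) (hi : k + n ≤ i) : monoFil N k i = ⊤ := by
  rw [eq_top_iff]
  intro x _
  exact monoFil_ker n x (by omega) (by rw [hn]; rfl)

theorem monoFil_bot (n : ℕ) (hn : N ^ n = 0) (i : ℤ) (hi : i ≤ k - n - 1) :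
    monoFil N k i = ⊥ := by
  rw [eq_bot_iff]
  apply Submodule.span_le.2
  rintro x ⟨a, b, v, h, hv, rfl⟩
  have hb : n ≤ b := by omega
  rw [pow_eq_zero_of_le hb hn]
  simp

theorem monoFil_isMonodromy (hN : IsNilpotent N) : IsMonodromyFiltration N k (monoFil N k) := by
  obtain ⟨n, hn⟩ := hN
  refine ⟨monoFil_mono, ⟨_, monoFil_bot n hn⟩, ⟨_, monoFil_top n hn⟩, monoFil_step, fun i => ?_⟩
  rw [grInduced_bijective_iff]
  constructor
  · intro x hx hNx
    obtain ⟨y, hy, hyx⟩ := monoFil_surj (N := N) (k := k) (i + 1) ((N ^ i) x) (by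
      convert hNx using 2; push_cast; ring)
    have h1 : N y ∈ monoFil N k (k + i - 1) := by
      convert monoFil_step _ _ hy using 2; push_cast; ring
    have h2 : x - N y ∈ monoFil N k (k + i - 1) := by
      apply monoFil_ker i _ (by omega)
      rw [map_sub, ← hyx, pow_succ]
      simp
    simpa using add_mem h2 h1
  · intro y hy
    obtain ⟨x, hx, rfl⟩ := monoFil_surj i y hy
    exact ⟨x, hx, by simp⟩

theorem mono_ker {W : ℤ → Submodule ℂ V} (h : IsMonodromyFiltration N k W) (a : ℕ) (x : V)
    (hx : (N ^ a) x = 0) : x ∈ W (k + a - 1) := by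
  obtain ⟨b, hb⟩ := h.exhaustive
  have main : ∀ m : ℕ, x ∈ W (k + a + m - 1) → x ∈ W (k + a - 1) := by
    intro m
    induction m with
    | zero => intro hm; simpa using hm
    | succ m ih =>
      intro hm
      apply ih
      have := ((grInduced_bijective_iff _ _ _ _ _ _).1 (h.iso (a + m))).1 x (by
        convert hm using 2; push_cast; ring) (by
        rw [add_comm, pow_add, Module.End.mul_apply, hx, map_zero]; exact zero_mem _)
      convert this using 2; push_cast; ring
  apply main (b - k - a + 1).toNat
  rw [hb _ (by omega)]
  trivial

theorem mono_surj {W : ℤ → Submodule ℂ V} (h : IsMonodromyFiltration N k W) (b : ℕ) (y : V)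
    (hy : y ∈ W (k - b)) : ∃ x ∈ W (k + b), (N ^ b) x = y := by
  obtain ⟨a, ha⟩ := h.separated
  have main : ∀ m : ℕ, W (k - b) ≤ (W (k + b)).map (N ^ b) ⊔ W (k - b - m) := by
    intro m
    induction m with
    | zero => simp
    | succ m ih =>
      refine ih.trans (sup_le le_sup_left ?_)
      intro z hz
      obtain ⟨x, hx, hxz⟩ := ((grInduced_bijective_iff _ _ _ _ _ _).1 (h.iso (b + m))).2 z (by
        convert hz using 2; push_cast; ring)
      have e : z = (N ^ b) ((N ^ m) x) + -((N ^ (b + m)) x - z) := by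
        rw [pow_add, Module.End.mul_apply]; abel
      rw [e]
      apply Submodule.add_mem_sup
      · refine ⟨_, ?_, rfl⟩
        exact h.mono (by push_cast; omega) (pow_mem_filtration N W h.step m _ x hx)
      · apply neg_mem
        convert hxz using 2; push_cast; ring
  have := main (k - b - a).toNat hy
  rw [ha (k - b - (k - b - a).toNat) (by omega), sup_bot_eq] at this
  exact this

theorem mono_eq (hN : IsNilpotent N) {W : ℤ → Submodule ℂ V}
    (h : IsMonodromyFiltration N k W) : W = monoFil N k := by
  obtain ⟨n, hn⟩ := hN
  funext l
  apply le_antisymm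
  · have main : ∀ m : ℕ, ∀ i : ℕ, n ≤ i + m → W (k + i) ≤ monoFil N k (k + i) := by
      intro m
      induction m with
      | zero =>
        intro i hi
        rw [monoFil_top n hn (k + i) (by omega)]
        exact le_top
      | succ m ih =>
        intro i hi x hx
        have h0 : (N ^ (i + 1)) x ∈ W (k - (i + 2 : ℕ)) := by
          convert pow_mem_filtration N W h.step (i + 1) _ x hx using 2; push_cast; ring
        obtain ⟨y, hy, hyx⟩ := mono_surj h (i + 2) _ h0
        have h1 : N y ∈ monoFil N k (k + i) := by
          convert monoFil_step _ _ (ih (i + 2) (by omega) hy) using 2; push_cast; ring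
        have h2 : x - N y ∈ monoFil N k (k + i) := by
          apply monoFil_ker (i + 1) _ (by push_cast; omega)
          rw [map_sub, ← hyx, pow_succ N (i + 1)]
          simp
        simpa using add_mem h2 h1
    rcases le_total k l with hl | hl
    · obtain ⟨i, rfl⟩ : ∃ i : ℕ, l = k + i := ⟨(l - k).toNat, by omega⟩
      exact main n i (by omega)
    · obtain ⟨i, rfl⟩ : ∃ i : ℕ, l = k - i := ⟨(k - l).toNat, by omega⟩
      intro y hy
      obtain ⟨x, hx, rfl⟩ := mono_surj h i y hy
      convert pow_mem_filtration N _ monoFil_step i _ x (main n i (by omega) hx) using 2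
      ring
  · apply Submodule.span_le.2
    rintro x ⟨a, b, v, hab, hv, rfl⟩
    have := pow_mem_filtration N W h.step b _ v (mono_ker h (a + b) v hv)
    exact h.mono (by push_cast; omega) this

end

/-- For a nilpotent endomorphism `N` of a finite-dimensional complex vector space and
any `k : ℤ`, there exists a unique monodromy filtration of `N` centered at `k`. -/
theorem existsUnique_monodromyFiltration {V : Type*} [AddCommGroup V] [Module ℂ V]
    [FiniteDimensional ℂ V] (N : Module.End ℂ V) (hN : IsNilpotent N) (k : ℤ) :
    ∃! W : ℤ → Submodule ℂ V, IsMonodromyFiltration N k W := by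
  exact ⟨monoFil N k, monoFil_isMonodromy hN, fun W hW => mono_eq hN hW⟩
end

section
/- Let V be a finite-dimensional complex vector space, N a nilpotent endomorphism of V, k an integer, and W the monodromy filtration of N centered at k. For i ≥ 0 define the primitive part PGr_{k+i}^W as the kernel of the induced map N^{i+1} : Gr_{k+i}^W → Gr_{k−i−2}^W, and set PGr_{k+i}^W = 0 for i < 0. Then for every integer m, the graded piece Gr_m^W is the internal direct sum over i ≥ 0 of the images of PGr_{m+2i}^W under the induced maps N^i : Gr_{m+2i}^W → Gr_m^W. -/
open Submodule

/-- The primitive part `PGr_j^W` (for `j = k + i`, `i ≥ 0`): the kernel of the map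
induced by `N^{i+1}` from `Gr_{k+i}^W` to `Gr_{k-i-2}^W`; it is `0` for `j < k`. -/
noncomputable def PGr {V : Type*} [AddCommGroup V] [Module ℂ V]
    (N : Module.End ℂ V) (k : ℤ) (W : ℤ → Submodule ℂ V)
    (step : ∀ j : ℤ, ∀ x ∈ W j, N x ∈ W (j - 2)) (j : ℤ) : Submodule ℂ (GrW W j) :=
  if h : 0 ≤ j - k then
    LinearMap.ker (grInduced W (N ^ ((j - k).toNat + 1)) j (2 * k - j - 2)
      (fun x hx => by
        have hp := pow_mem_filtration N W step ((j - k).toNat + 1) j x hx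
        have he : j - 2 * (((j - k).toNat + 1 : ℕ) : ℤ) = 2 * k - j - 2 := by
          push_cast [Int.toNat_of_nonneg h]; ring
        rwa [he] at hp)
      (fun x hx => by
        have hp := pow_mem_filtration N W step ((j - k).toNat + 1) (j - 1) x hx
        have he : j - 1 - 2 * (((j - k).toNat + 1 : ℕ) : ℤ) = 2 * k - j - 2 - 1 := by
          push_cast [Int.toNat_of_nonneg h]; ring
        rwa [he] at hp))
  else ⊥

section Helpers
variable {V : Type*} [AddCommGroup V] [Module ℂ V] {N : Module.End ℂ V} {k : ℤ}
  {W : ℤ → Submodule ℂ V}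

theorem pow_mem_of_eq (step : ∀ j : ℤ, ∀ x ∈ W j, N x ∈ W (j - 2)) {j l : ℤ} (a : ℕ)
    (h : j - 2 * a = l) {x : V} (hx : x ∈ W j) : (N ^ a) x ∈ W l :=
  h ▸ pow_mem_filtration N W step a j x hx

theorem gr_mk_eq_zero {i : ℤ} (x : W i) :
    (Submodule.Quotient.mk x : GrW W i) = 0 ↔ (x : V) ∈ W (i - 1) := by
  rw [Submodule.Quotient.mk_eq_zero]; rfl

theorem grInduced_mk {f : Module.End ℂ V} {i j : ℤ} (hf : ∀ x ∈ W i, f x ∈ W j)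
    (hf' : ∀ x ∈ W (i - 1), f x ∈ W (j - 1)) (x : W i) :
    grInduced W f i j hf hf' (Submodule.Quotient.mk x)
      = Submodule.Quotient.mk ⟨f x, hf x x.2⟩ := rfl

theorem mono_inj (hW : IsMonodromyFiltration N k W) {j l : ℤ} (a : ℕ) (ha : j - k = a)
    (hl : l = j - 2 * a - 1) {x : V} (hx : x ∈ W j) (h : (N ^ a) x ∈ W l) :
    x ∈ W (j - 1) := by
  obtain rfl : j = k + a := by omega
  have := (hW.iso a).1
  rw [injective_iff_map_eq_zero] at this
  have h2 := this (Submodule.Quotient.mk ⟨x, hx⟩)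
  rw [grInduced_mk, gr_mk_eq_zero, gr_mk_eq_zero] at h2
  apply h2
  convert h using 2
  omega

theorem mono_surj_s6 (hW : IsMonodromyFiltration N k W) {j l : ℤ} (a : ℕ) (ha : j = k - a)
    (hl : l = k + a) {y : V} (hy : y ∈ W j) :
    ∃ x ∈ W l, y - (N ^ a) x ∈ W (j - 1) := by
  subst ha hl
  obtain ⟨q, hq⟩ := (hW.iso a).2 (Submodule.Quotient.mk ⟨y, hy⟩)
  obtain ⟨x, rfl⟩ := Submodule.Quotient.mk_surjective _ q
  refine ⟨x, x.2, ?_⟩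
  rw [grInduced_mk, eq_comm, ← sub_eq_zero, ← Submodule.Quotient.mk_sub, gr_mk_eq_zero] at hq
  exact hq

/-- Representatives of primitive classes. -/
noncomputable def PrimRep (N : Module.End ℂ V) (k : ℤ) (W : ℤ → Submodule ℂ V) (j : ℤ) :
    Submodule ℂ V :=
  if k ≤ j then W j ⊓ Submodule.comap (N ^ ((j - k).toNat + 1)) (W (2 * k - j - 2 - 1)) else ⊥

theorem mk_mem_PGr (step : ∀ j : ℤ, ∀ x ∈ W j, N x ∈ W (j - 2)) {j : ℤ} (x : W j) :
    (Submodule.Quotient.mk x : GrW W j) ∈ PGr N k W step j ↔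
      (k ≤ j ∧ (N ^ ((j - k).toNat + 1)) (x : V) ∈ W (2 * k - j - 2 - 1)) ∨
      (j < k ∧ (x : V) ∈ W (j - 1)) := by
  unfold PGr
  by_cases h : 0 ≤ j - k
  · have h1 : k ≤ j := by omega
    have h2 : ¬ j < k := by omega
    rw [dif_pos h, LinearMap.mem_ker, grInduced_mk, gr_mk_eq_zero]
    simp [h1, h2]
  · have h1 : ¬ k ≤ j := by omega
    have h2 : j < k := by omega
    rw [dif_neg h, Submodule.mem_bot, gr_mk_eq_zero]
    simp [h1, h2]

/-- The span of the lower step and the images of primitive representatives. -/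
noncomputable def PrimSpan (N : Module.End ℂ V) (k : ℤ) (W : ℤ → Submodule ℂ V) (m : ℤ) :
    Submodule ℂ V :=
  W (m - 1) ⊔ ⨆ i : ℕ, Submodule.map (N ^ i) (PrimRep N k W (m + 2 * i))

theorem map_PrimSpan (step : ∀ j : ℤ, ∀ x ∈ W j, N x ∈ W (j - 2)) {m : ℤ} {x : V}
    (hx : x ∈ PrimSpan N k W (m + 2)) : N x ∈ PrimSpan N k W m := by
  suffices h : PrimSpan N k W (m + 2) ≤ Submodule.comap N (PrimSpan N k W m) from h hx
  refine sup_le ?_ (iSup_le fun i => ?_)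
  · intro y hy
    refine Submodule.mem_sup_left ?_
    have := step _ y hy
    rwa [show m + 2 - 1 - 2 = m - 1 by ring] at this
  · rintro _ ⟨y, hy, rfl⟩
    refine Submodule.mem_sup_right (Submodule.mem_iSup_of_mem (i + 1) ⟨y, ?_, ?_⟩)
    · have e : m + 2 * ((i + 1 : ℕ) : ℤ) = m + 2 + 2 * i := by push_cast; ring
      rw [e]; exact hy
    · rw [pow_succ']; rfl

theorem le_PrimSpan (hW : IsMonodromyFiltration N k W) (m : ℤ) : W m ≤ PrimSpan N k W m := by
  obtain ⟨b, hb⟩ := hW.exhaustive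
  suffices H : ∀ n : ℕ, ∀ m : ℤ, b + 1 - n ≤ m → W m ≤ PrimSpan N k W m from
    H (b + 1 - m).toNat m (by omega)
  intro n
  induction n with
  | zero =>
    intro m hm
    refine le_trans ?_ le_sup_left
    rw [hb (m - 1) (by push_cast at hm; omega)]
    exact le_top
  | succ n ih =>
    intro m hm x hx
    have IH := ih (m + 2) (by push_cast at hm; omega)
    by_cases hmk : m < k
    · obtain ⟨a, ha⟩ : ∃ a : ℕ, k - m = a + 1 := ⟨(k - m - 1).toNat, by omega⟩
      obtain ⟨y, hy, hxy⟩ := mono_surj_s6 hW (j := m) (l := k + (a + 1 : ℕ)) (a + 1)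
        (by push_cast; omega) rfl hx
      have h1 : (N ^ a) y ∈ W (m + 2) := pow_mem_of_eq hW.step a (by push_cast; omega) hy
      have h2 := map_PrimSpan hW.step (IH h1)
      have h3 : N ((N ^ a) y) = (N ^ (a + 1)) y := by rw [pow_succ']; rfl
      rw [h3] at h2
      have := add_mem (show x - (N ^ (a + 1)) y ∈ PrimSpan N k W m from
        Submodule.mem_sup_left hxy) h2
      simpa using this
    · obtain ⟨a, ha⟩ : ∃ a : ℕ, m - k = a := ⟨(m - k).toNat, by omega⟩
      have h1 : (N ^ (a + 1)) x ∈ W (2 * k - m - 2) :=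
        pow_mem_of_eq hW.step _ (by push_cast; omega) hx
      obtain ⟨y, hy, hxy⟩ := mono_surj_s6 hW (l := m + 2) (a + 2)
        (by push_cast; omega) (by push_cast; omega) h1
      have h2 := map_PrimSpan hW.step (IH hy)
      have hNy : N y ∈ W m := by
        have := hW.step _ _ hy
        rwa [show m + 2 - 2 = m by ring] at this
      have h3 : x - N y ∈ PrimSpan N k W m := by
        refine Submodule.mem_sup_right (Submodule.mem_iSup_of_mem 0 ⟨x - N y, ?_, by simp⟩)
        have e : m + 2 * ((0 : ℕ) : ℤ) = m := by simp
        rw [e]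
        unfold PrimRep
        rw [if_pos (by omega)]
        refine ⟨sub_mem hx hNy, ?_⟩
        have e2 : (m - k).toNat = a := by omega
        have e3 : (N ^ (a + 1)) (N y) = (N ^ (a + 2)) y := by rw [pow_succ N (a + 1)]; rfl
        show (N ^ ((m - k).toNat + 1)) (x - N y) ∈ W (2 * k - m - 2 - 1)
        rw [e2, map_sub, e3]
        exact hxy
      simpa using add_mem h3 h2

/-- A term of the decomposition is represented by `N ^ i p`; it vanishes if `m + i < k`. -/
theorem term_rep (hW : IsMonodromyFiltration N k W) (m : ℤ) (i : ℕ) (p : V)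
    (hp : p ∈ W (m + 2 * i)) (h : (k ≤ m + 2 * i ∧
      (N ^ ((m + 2 * i - k).toNat + 1)) p ∈ W (2 * k - (m + 2 * i) - 2 - 1)) ∨
      (m + 2 * i < k ∧ p ∈ W (m + 2 * i - 1))) :
    ∀ (r : ℕ), m + i - k < r → (N ^ r) ((N ^ i) p) ∈ W (m - 2 * r - 1) := by
  intro r hr
  have e : (N ^ r) ((N ^ i) p) = (N ^ (r + i)) p := by rw [pow_add]; rfl
  rw [e]
  rcases h with ⟨h1, h2⟩ | ⟨h1, h2⟩
  · obtain ⟨c, hc⟩ : ∃ c : ℕ, r + i = c + ((m + 2 * i - k).toNat + 1) :=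
      ⟨r + i - ((m + 2 * i - k).toNat + 1), by omega⟩
    rw [hc, pow_add]
    exact pow_mem_of_eq hW.step c (by omega) h2
  · exact pow_mem_of_eq hW.step _ (by push_cast; omega) h2


theorem internal_inj_aux {M : Type*} [AddCommGroup M] [Module ℂ M] (F : ℕ → Submodule ℂ M)
    (h : ∀ (i : ℕ) (y : M), y ∈ F i → y ≠ 0 →
      ∃ S : Submodule ℂ M, y ∉ S ∧ ∀ j < i, F j ≤ S) :
    Function.Injective (DirectSum.coeAddMonoidHom F) := by
  classical
  rw [injective_iff_map_eq_zero]
  intro f hf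
  by_contra hne
  have hs : f.support.Nonempty := by
    rwa [Finset.nonempty_iff_ne_empty, Ne, DFinsupp.support_eq_empty]
  have him := f.support.max'_mem hs
  have hle : ∀ j ∈ f.support, j ≤ f.support.max' hs := fun j hj => f.support.le_max' j hj
  generalize f.support.max' hs = i at him hle
  have hif : f i ≠ 0 := DFinsupp.mem_support_iff.1 him
  rw [DirectSum.coeAddMonoidHom_eq_dfinsuppSum, DFinsupp.sum,
    ← Finset.add_sum_erase _ _ him] at hf
  obtain ⟨S, hS, hj⟩ := h i (f i : M) (f i).2 (fun h0 => hif (Subtype.ext h0))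
  apply hS
  rw [eq_neg_of_add_eq_zero_left hf]
  refine neg_mem (sum_mem fun j hjm => ?_)
  exact hj j (lt_of_le_of_ne (hle j (Finset.mem_of_mem_erase hjm))
    (Finset.ne_of_mem_erase hjm)) (f j).2

end Helpers

/-- Primitive decomposition: if `W` is the monodromy filtration of a nilpotent `N`
centered at `k`, then for every `m : ℤ` the graded piece `Gr_m^W` is the internal
direct sum, over `i ≥ 0`, of the images of the primitive parts `PGr_{m+2i}^W`
under the maps `N^i : Gr_{m+2i}^W → Gr_m^W` induced by `N^i`. -/
theorem primitive_decomposition {V : Type*} [AddCommGroup V] [Module ℂ V]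
    [FiniteDimensional ℂ V] (N : Module.End ℂ V) (hN : IsNilpotent N) (k : ℤ)
    (W : ℤ → Submodule ℂ V) (hW : IsMonodromyFiltration N k W) (m : ℤ) :
    DirectSum.IsInternal (fun i : ℕ =>
      Submodule.map
        (grInduced W (N ^ i) (m + 2 * i) m
          (fun x hx => by
            have hp := pow_mem_filtration N W hW.step i (m + 2 * i) x hx
            rwa [show m + 2 * (i : ℤ) - 2 * i = m by ring] at hp)
          (fun x hx => by
            have hp := pow_mem_filtration N W hW.step i (m + 2 * i - 1) x hx
            rwa [show m + 2 * (i : ℤ) - 1 - 2 * i = m - 1 by ring] at hp))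
        (PGr N k W hW.step (m + 2 * i))) := by
  classical
  refine ⟨?_, ?_⟩
  · apply internal_inj_aux
    rintro i y ⟨q, hq, hqe⟩ hy0
    obtain ⟨p, rfl⟩ := Submodule.Quotient.mk_surjective _ q
    rw [SetLike.mem_coe, mk_mem_PGr] at hq
    have T := term_rep hW m i p p.2 hq
    rw [grInduced_mk] at hqe
    subst hqe
    rw [Ne, gr_mk_eq_zero] at hy0
    by_cases hmi : m + i < k
    · have := T 0 (by push_cast; omega)
      exact absurd (by simpa using this) hy0
    obtain ⟨r, hr⟩ : ∃ r : ℕ, m + i - k = r := ⟨(m + i - k).toNat, by omega⟩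
    refine ⟨LinearMap.ker (grInduced W (N ^ r) m (m - 2 * r)
      (fun x hx => pow_mem_of_eq hW.step r rfl hx)
      (fun x hx => pow_mem_of_eq hW.step r (by ring) hx)), ?_, ?_⟩
    · intro h0
      rw [LinearMap.mem_ker, grInduced_mk, gr_mk_eq_zero] at h0
      have e : (N ^ r) ((N ^ i) (p : V)) = (N ^ (r + i)) (p : V) := by rw [pow_add]; rfl
      change (N ^ r) ((N ^ i) (p : V)) ∈ W (m - 2 * r - 1) at h0
      rw [e] at h0
      have hp := mono_inj hW (r + i) (by push_cast; omega) (by push_cast; omega) p.2 h0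
      exact hy0 (pow_mem_of_eq hW.step i (by ring) hp)
    · rintro j hji _ ⟨qj, hqj, rfl⟩
      obtain ⟨pj, rfl⟩ := Submodule.Quotient.mk_surjective _ qj
      rw [SetLike.mem_coe, mk_mem_PGr] at hqj
      rw [LinearMap.mem_ker, grInduced_mk, grInduced_mk, gr_mk_eq_zero]
      exact term_rep hW m j pj pj.2 hqj r (by omega)
  · intro q
    obtain ⟨x, rfl⟩ := Submodule.Quotient.mk_surjective _ q
    set F := (fun i : ℕ =>
      Submodule.map
        (grInduced W (N ^ i) (m + 2 * i) m
          (fun x hx => by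
            have hp := pow_mem_filtration N W hW.step i (m + 2 * i) x hx
            rwa [show m + 2 * (i : ℤ) - 2 * i = m by ring] at hp)
          (fun x hx => by
            have hp := pow_mem_filtration N W hW.step i (m + 2 * i - 1) x hx
            rwa [show m + 2 * (i : ℤ) - 1 - 2 * i = m - 1 by ring] at hp))
        (PGr N k W hW.step (m + 2 * i))) with hF
    have key : PrimSpan N k W m ≤ Submodule.map (W m).subtype
        (Submodule.comap (Submodule.mkQ _) (⨆ i, F i)) := by
      refine sup_le ?_ (iSup_le fun i => ?_)
      · intro y hy
        refine ⟨⟨y, hW.mono (by omega) hy⟩, ?_, rfl⟩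
        have : (Submodule.Quotient.mk ⟨y, hW.mono (by omega) hy⟩ : GrW W m) = 0 := by
          rw [gr_mk_eq_zero]; exact hy
        show (Submodule.Quotient.mk ⟨y, hW.mono (by omega) hy⟩ : GrW W m) ∈ ⨆ i, F i
        rw [this]; exact zero_mem _
      · rintro _ ⟨y, hy, rfl⟩
        by_cases hk : k ≤ m + 2 * i
        · unfold PrimRep at hy
          rw [if_pos hk] at hy
          refine ⟨⟨(N ^ i) y, pow_mem_of_eq hW.step i (by ring) hy.1⟩, ?_, rfl⟩
          refine Submodule.mem_iSup_of_mem (p := F) i ?_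
          refine ⟨Submodule.Quotient.mk ⟨y, hy.1⟩, ?_, rfl⟩
          rw [SetLike.mem_coe, mk_mem_PGr]
          exact Or.inl ⟨hk, hy.2⟩
        · unfold PrimRep at hy
          rw [if_neg hk] at hy
          have : y = 0 := hy
          rw [this, map_zero]
          exact zero_mem _
    obtain ⟨xx, hxr, hxx⟩ := key (le_PrimSpan hW m x.2)
    have : xx = x := Subtype.ext hxx
    subst this
    have h2 : (Submodule.Quotient.mk xx : GrW W m) ∈ ⨆ i, F i := hxr
    rw [Submodule.iSup_eq_range_dfinsupp_lsum] at h2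
    obtain ⟨g, hg⟩ := h2
    refine ⟨g, ?_⟩
    rw [← hg]
    rfl
end

section
/- Let n ≥ 1 and let f : ℂⁿ → ℂ be the evaluation map of a multivariate polynomial with complex coefficients. Then there exists a finite subset B ⊆ ℂ that is admissible for f, i.e. such that for every y ∈ ℂ \ B there exist an open neighborhood V of y with V ⊆ ℂ \ B and a homeomorphism φ : f⁻¹(V) → V × f⁻¹(y) whose first component equals f (so that f is a locally trivial fibration over ℂ \ B). -/
/-- A finite subset `B ⊆ ℂ` is admissible for `f : ℂⁿ → ℂ` if over each point
`y ∉ B` there are an open neighborhood `V ⊆ ℂ \ B` of `y` and a homeomorphism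
`f⁻¹(V) ≃ₜ V × f⁻¹(y)` whose first component equals `f` (so `f` is a locally
trivial fibration over `ℂ \ B`). -/
def Admissible {n : ℕ} (f : (Fin n → ℂ) → ℂ) (B : Set ℂ) : Prop :=
  B.Finite ∧ ∀ y : ℂ, y ∉ B →
    ∃ V : Set ℂ, IsOpen V ∧ y ∈ V ∧ V ⊆ Bᶜ ∧
      ∃ φ : (f ⁻¹' V) ≃ₜ (V × (f ⁻¹' {y})), ∀ x : f ⁻¹' V, ((φ x).1 : ℂ) = f x.1

open Polynomial in
lemma coeff_weighted_bound {ι : Type*} (s : Finset ι) (u : ι → ℂ) (r : ℝ) (hr : 0 ≤ r) (N : ℕ) :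
    ∑ n ∈ Finset.range N, ‖(∏ i ∈ s, (X - C (u i))).coeff n‖ * r ^ n ≤ ∏ i ∈ s, (r + ‖u i‖) := by
  classical
  induction s using Finset.induction_on generalizing N with
  | empty =>
    simp only [Finset.prod_empty, coeff_one]
    rcases N with _ | N
    · simp
    · rw [Finset.sum_range_succ']
      simp
  | insert a s ha ih =>
    rw [Finset.prod_insert ha, Finset.prod_insert ha]
    set p := ∏ i ∈ s, (X - C (u i)) with hp
    have h0 : ∀ N, 0 ≤ ∑ n ∈ Finset.range N, ‖p.coeff n‖ * r ^ n := fun N =>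
      Finset.sum_nonneg fun n _ => by positivity
    rcases N with _ | N
    · simp only [Finset.range_zero, Finset.sum_empty]
      exact mul_nonneg (by positivity) (Finset.prod_nonneg fun i _ => by positivity)
    · have h1 : ∑ n ∈ Finset.range (N+1), ‖((X - C (u a)) * p).coeff n‖ * r ^ n
          ≤ r * ∑ n ∈ Finset.range N, ‖p.coeff n‖ * r ^ n
            + ‖u a‖ * ∑ n ∈ Finset.range (N+1), ‖p.coeff n‖ * r ^ n := by
        rw [Finset.sum_range_succ', Finset.sum_range_succ' _ N]
        have : ∀ n ∈ Finset.range N, ‖((X - C (u a)) * p).coeff (n+1)‖ * r ^ (n+1)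
            ≤ r * (‖p.coeff n‖ * r ^ n) + ‖u a‖ * (‖p.coeff (n+1)‖ * r ^ (n+1)) := by
          intro n _
          rw [coeff_X_sub_C_mul]
          have := norm_sub_le (p.coeff n) (u a * p.coeff (n+1))
          rw [norm_mul, mul_comm ‖u a‖] at this
          calc _ ≤ (‖p.coeff n‖ + ‖p.coeff (n+1)‖ * ‖u a‖) * r ^ (n+1) := by gcongr
            _ = _ := by ring
        have h2 := Finset.sum_le_sum this
        rw [Finset.sum_add_distrib, ← Finset.mul_sum, ← Finset.mul_sum] at h2
        have h3 : ‖((X - C (u a)) * p).coeff 0‖ = ‖u a‖ * ‖p.coeff 0‖ := by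
          simp [sub_mul]
        rw [h3]
        linarith
      have h2 := ih N
      have h3 := ih (N+1)
      calc _ ≤ _ := h1
        _ ≤ r * ∏ i ∈ s, (r + ‖u i‖) + ‖u a‖ * ∏ i ∈ s, (r + ‖u i‖) := by gcongr
        _ = _ := by ring

open Polynomial in
lemma root_close {ι : Type*} [Fintype ι] (u v : ι → ℂ) (κ : ℝ) (hκ : 0 < κ)
    (h : ∀ n, ‖(∏ i, (X - C (v i))).coeff n - (∏ i, (X - C (u i))).coeff n‖
      ≤ κ ^ (Fintype.card ι) * ‖(∏ i, (X - C (u i))).coeff n‖) (i₀ : ι) :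
    ∃ j, ‖v i₀ - u j‖ ≤ κ * (‖v i₀‖ + ‖u j‖) := by
  classical
  by_contra! hcon
  set P := ∏ i, (X - C (u i)) with hP
  set P' := ∏ i, (X - C (v i)) with hP'
  have hv : P'.eval (v i₀) = 0 := by
    rw [hP', eval_prod]
    exact Finset.prod_eq_zero (Finset.mem_univ i₀) (by simp)
  set N := max P.natDegree P'.natDegree + 1 with hN
  have e1 : P.eval (v i₀) = ∑ n ∈ Finset.range N, P.coeff n * (v i₀)^n :=
    eval_eq_sum_range' (by omega) _
  have e2 : P'.eval (v i₀) = ∑ n ∈ Finset.range N, P'.coeff n * (v i₀)^n :=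
    eval_eq_sum_range' (by omega) _
  have h1 : ‖P.eval (v i₀)‖ ≤ κ ^ (Fintype.card ι) * ∏ i, (‖v i₀‖ + ‖u i‖) := by
    have : P.eval (v i₀) = - ∑ n ∈ Finset.range N, (P'.coeff n - P.coeff n) * (v i₀)^n := by
      simp only [sub_mul, Finset.sum_sub_distrib]
      rw [← e1, ← e2, hv]; ring
    rw [this, norm_neg]
    refine (norm_sum_le _ _).trans ?_
    have h2 := coeff_weighted_bound Finset.univ u ‖v i₀‖ (norm_nonneg _) N
    calc _ ≤ ∑ n ∈ Finset.range N, κ ^ (Fintype.card ι) * (‖P.coeff n‖ * ‖v i₀‖ ^ n) := by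
          refine Finset.sum_le_sum fun n _ => ?_
          rw [norm_mul, norm_pow, ← mul_assoc]
          gcongr
          exact h n
      _ ≤ _ := by
          rw [← Finset.mul_sum]
          gcongr
  have h2 : κ ^ (Fintype.card ι) * ∏ i, (‖v i₀‖ + ‖u i‖) < ‖P.eval (v i₀)‖ := by
    have : κ ^ (Fintype.card ι) * ∏ i, (‖v i₀‖ + ‖u i‖) = ∏ i, (κ * (‖v i₀‖ + ‖u i‖)) := by
      rw [Finset.prod_mul_distrib]; simp
    rw [this, hP, eval_prod, norm_prod]
    refine Finset.prod_lt_prod_of_nonempty ?_ ?_ ⟨i₀, Finset.mem_univ _⟩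
    · intro i _
      refine mul_pos hκ ?_
      by_contra hc
      have a1 := norm_nonneg (v i₀)
      have a2 := norm_nonneg (u i)
      have a3 : ‖v i₀‖ = 0 := by linarith
      have a4 : ‖u i‖ = 0 := by linarith
      have := hcon i
      rw [norm_eq_zero] at a3 a4
      simp [a3, a4] at this
    · intro i _
      simpa using hcon i
  linarith

open Polynomial in
lemma zero_count_eq {ι : Type*} [Fintype ι] (u v : ι → ℂ)
    (h : ∀ n, (∏ i, (X - C (v i))).coeff n = 0 ↔ (∏ i, (X - C (u i))).coeff n = 0) :
    (Finset.univ.filter fun i => v i = 0).card = (Finset.univ.filter fun i => u i = 0).card := by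
  classical
  have key : ∀ w : ι → ℂ, (Finset.univ.filter fun i => w i = 0).card
      = (∏ i, (X - C (w i))).natTrailingDegree := by
    intro w
    rw [← rootMultiplicity_eq_natTrailingDegree', ← count_roots]
    have : (∏ i, (X - C (w i))).roots = Finset.univ.val.map w := by
      have := roots_multiset_prod_X_sub_C (Finset.univ.val.map w)
      rw [Multiset.map_map] at this
      exact this
    rw [this, Multiset.count_map]
    simp only [eq_comm]
    rfl
  rw [key, key, natTrailingDegree, natTrailingDegree, trailingDegree, trailingDegree]
  congr 2
  ext n
  simp [h n]

/-- pigeonhole choice of a radius missing all the discs -/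
lemma exists_radius {ι : Type*} [Fintype ι] (w' : ι → ℂ) (w : ℂ) (hw : w ≠ 0) (ε δ : ℝ)
    (hε : 0 < ε) (hε1 : ε ≤ 1) (hδ : 0 ≤ δ) (hδ2 : δ ≤ 1/2)
    (hδε : 8 * δ * (Fintype.card ι + 1) < ε) :
    ∃ ρ : ℝ, 0 < ρ ∧ ρ ≤ ε ∧ ∀ u : ℂ, (∃ j, ‖u - w' j‖ ≤ δ * ‖w' j‖) → ‖u - w‖ ≠ ρ * ‖w‖ := by
  classical
  by_contra! hcon
  set N := Fintype.card ι with hN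
  have hNp : (0:ℝ) < N + 1 := by positivity
  have hw0 : 0 < ‖w‖ := norm_pos_iff.2 hw
  have key : ∀ k : Fin (N+1), ∃ u : ℂ, ∃ j, ‖u - w' j‖ ≤ δ * ‖w' j‖ ∧
      ‖u - w‖ = (ε * ((k:ℝ) + 1) / (N+1)) * ‖w‖ := by
    intro k
    have hk : ((k:ℕ):ℝ) + 1 ≤ N + 1 := by
      have := k.2
      have : (k:ℕ) ≤ N := by omega
      have : ((k:ℕ):ℝ) ≤ N := by exact_mod_cast this
      linarith
    obtain ⟨u, ⟨j, hj⟩, hu⟩ := hcon (ε * ((k:ℝ) + 1) / (N+1)) (by positivity) (by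
      rw [div_le_iff₀ hNp]
      gcongr)
    exact ⟨u, j, hj, hu⟩
  choose u j hj hu using key
  obtain ⟨k, l, hkl, hjl⟩ := Fintype.exists_ne_map_eq_of_card_lt j (by simp [← hN])
  wlog hlt : l < k generalizing k l
  · exact this l k hkl.symm hjl.symm (lt_of_le_of_ne (not_lt.1 hlt) hkl)
  have hk : ((k:ℕ):ℝ) + 1 ≤ N + 1 := by
      have := k.2
      have : (k:ℕ) ≤ N := by omega
      have : ((k:ℕ):ℝ) ≤ N := by exact_mod_cast this
      linarith
  have hlt' : ((l:ℕ):ℝ) + 1 ≤ k := by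
    have : (l:ℕ) + 1 ≤ k := hlt
    exact_mod_cast this
  have h1 := hj k
  have h2 := hj l
  rw [← hjl] at h2
  set W := w' (j k)
  have hb : ‖u k - w‖ ≤ ‖w‖ := by
    rw [hu k]
    have : ε * ((k:ℝ) + 1) / (N+1) ≤ 1 := by
      rw [div_le_iff₀ hNp]; nlinarith
    nlinarith
  have hW : ‖W‖ ≤ 4 * ‖w‖ := by
    have a1 : ‖W‖ ≤ ‖u k‖ + ‖u k - W‖ := by
      have := norm_sub_le (u k) (u k - W); simpa using this
    have a2 : ‖u k‖ ≤ ‖w‖ + ‖u k - w‖ := by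
      have := norm_add_le w (u k - w); simpa using this
    have : δ * ‖W‖ ≤ 1/2 * ‖W‖ := by gcongr
    linarith
  have h3 : ‖u k - w‖ - ‖u l - w‖ ≤ ‖u k - u l‖ := by
    have := norm_sub_norm_le (u k - w) (u l - w); simpa using this
  have h4 : ‖u k - u l‖ ≤ ‖u k - W‖ + ‖u l - W‖ := by
    have := norm_sub_le (u k - W) (u l - W); simpa using this
  rw [hu k, hu l] at h3
  have h5 : ε / (N+1) * ‖w‖ ≤ ε * ((k:ℝ) + 1) / (N+1) * ‖w‖ - ε * ((l:ℝ) + 1) / (N+1) * ‖w‖ := by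
    rw [← sub_mul, ← sub_div]
    gcongr
    nlinarith
  have h6 : ε / (N+1) * ‖w‖ ≤ 8 * δ * ‖w‖ := by
    have : δ * ‖W‖ ≤ δ * (4 * ‖w‖) := by gcongr
    linarith
  have h7 : ε / (N+1) ≤ 8 * δ := le_of_mul_le_mul_right h6 hw0
  rw [div_le_iff₀ hNp] at h7
  linarith

open Filter Topology

lemma isClosed_proj {Y A : Type*} [PseudoMetricSpace Y] [NormedAddCommGroup A] [ProperSpace A]
    (K : Set (Y × A)) (hK : IsClosed K) (C : Y → ℝ) (hC : Continuous C)
    (hb : ∀ p ∈ K, ‖p.2‖ ≤ C p.1) : IsClosed (Prod.fst '' K) := by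
  refine IsSeqClosed.isClosed ?_
  intro x y hx hxy
  choose p hp hpx using hx
  have hCx : Tendsto (fun n => C (x n)) atTop (𝓝 (C y)) := (hC.tendsto y).comp hxy
  obtain ⟨R, hR⟩ := hCx.bddAbove_range
  have hbd : ∀ n, (p n).2 ∈ Metric.closedBall (0 : A) R := by
    intro n
    rw [mem_closedBall_zero_iff]
    refine (hb _ (hp n)).trans ?_
    rw [hpx n]
    exact hR ⟨n, rfl⟩
  obtain ⟨a, _, φ, hφ, hlim⟩ := (isCompact_closedBall (0 : A) R).tendsto_subseq hbd
  refine ⟨(y, a), ?_, rfl⟩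
  refine hK.mem_of_tendsto (f := fun n => p (φ n)) (b := atTop) ?_ (Eventually.of_forall fun n => hp _)
  have h1 : Tendsto (fun n => (p (φ n)).1) atTop (𝓝 y) := by
    have := hxy.comp hφ.tendsto_atTop
    refine this.congr fun n => ?_
    simp [hpx]
  exact h1.prodMk_nhds hlim

lemma continuous_of_proj {Y A Z : Type*} [PseudoMetricSpace Y] [NormedAddCommGroup A] [ProperSpace A]
    [TopologicalSpace Z]
    (K : Set (Y × A)) (hK : IsClosed K) (C : Y → ℝ) (hC : Continuous C)
    (hb : ∀ p ∈ K, ‖p.2‖ ≤ C p.1) (φ : Y × A → Z) (hφ : Continuous φ) (G : Y → Z)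
    (hG : ∀ p ∈ K, φ p = G p.1) (hs : ∀ y, ∃ a, (y, a) ∈ K) : Continuous G := by
  rw [continuous_iff_isClosed]
  intro D hD
  have : G ⁻¹' D = Prod.fst '' (K ∩ φ ⁻¹' D) := by
    ext y
    constructor
    · intro hy
      obtain ⟨a, ha⟩ := hs y
      exact ⟨(y, a), ⟨ha, by simpa [hG _ ha] using hy⟩, rfl⟩
    · rintro ⟨p, ⟨hp, hpD⟩, rfl⟩
      simpa [hG _ hp] using hpD
  rw [this]
  exact isClosed_proj _ (hK.inter (hD.preimage hφ)) C hC fun p hp => hb p hp.1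

lemma exists_perm_of_prod_eq {ι : Type*} [Fintype ι] (f g : ι → ℂ)
    (h : ∀ z, ∏ i, (z - f i) = ∏ i, (z - g i)) : ∃ σ : Equiv.Perm ι, ∀ i, g (σ i) = f i := by
  classical
  have hp : (∏ i, (Polynomial.X - Polynomial.C (f i))) =
      ∏ i, (Polynomial.X - Polynomial.C (g i)) := by
    refine Polynomial.funext fun z => ?_
    simpa [Polynomial.eval_prod] using h z
  have key : ∀ w : ι → ℂ, (∏ i, (Polynomial.X - Polynomial.C (w i))).roots
      = Finset.univ.val.map w := by
    intro w
    have := Polynomial.roots_multiset_prod_X_sub_C (Finset.univ.val.map w)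
    rw [Multiset.map_map] at this
    exact this
  have hm : Finset.univ.val.map f = Finset.univ.val.map g := by
    rw [← key, ← key, hp]
  have hc : ∀ a : ℂ, Fintype.card {i // f i = a} = Fintype.card {i // g i = a} := by
    intro a
    have := congrArg (Multiset.count a) hm
    rw [Multiset.count_map, Multiset.count_map] at this
    rw [Fintype.card_subtype, Fintype.card_subtype]
    simp only [eq_comm (a := a)] at this
    exact this
  refine ⟨Equiv.ofFiberEquiv (f := f) (g := g) fun a => Fintype.equivOfCardEq (hc a), fun i => ?_⟩
  exact Equiv.ofFiberEquiv_map _ _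

/-- index set of the roots -/
abbrev Idx {M : Type} (d : M → ℕ) : Type := Σ m, Fin (d m)

/-- `α` is a labelling of the roots of the family of polynomial functions `F m y`. -/
def IsLab {M : Type} {d : M → ℕ} {Y : Type*} (F : M → Y → ℂ → ℂ)
    (c : M → Y → ℂ) (y : Y) (α : (Idx d) → ℂ) : Prop :=
  ∀ m z, F m y z = c m y * ∏ j, (z - α ⟨m, j⟩)

lemma isLab_perm {M : Type} {d : M → ℕ} {Y : Type*} (F : M → Y → ℂ → ℂ)
    (c : M → Y → ℂ) (y : Y) (hc : ∀ m, c m y ≠ 0) (α β : (Idx d) → ℂ)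
    (hα : IsLab F c y α) (hβ : IsLab F c y β) :
    ∃ σ : Equiv.Perm (Idx d), (∀ i, α (σ i) = β i) ∧
      ∀ y' γ, IsLab F c y' γ → IsLab F c y' (γ ∘ σ) := by
  have : ∀ m, ∃ s : Equiv.Perm (Fin (d m)), ∀ j, α ⟨m, s j⟩ = β ⟨m, j⟩ := by
    intro m
    refine exists_perm_of_prod_eq (fun j => β ⟨m, j⟩) (fun j => α ⟨m, j⟩) fun z => ?_
    have := (hα m z).symm.trans (hβ m z)
    exact (mul_left_cancel₀ (hc m) this).symm
  choose s hs using this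
  refine ⟨Equiv.sigmaCongrRight s, fun i => hs i.1 i.2, ?_⟩
  intro y' γ hγ m z
  rw [hγ m z]
  congr 1
  exact (Equiv.prod_comp (s m) (fun j => z - γ ⟨m, j⟩)).symm

lemma isClosed_isLab {M : Type} {d : M → ℕ} {Y : Type*} [TopologicalSpace Y] (F : M → Y → ℂ → ℂ)
    (c : M → Y → ℂ) (hF : ∀ m z, Continuous fun y => F m y z) (hc : ∀ m, Continuous (c m)) :
    IsClosed {p : Y × ((Idx d) → ℂ) | IsLab F c p.1 p.2} := by
  simp only [IsLab, Set.ofPred_forall]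
  refine isClosed_iInter fun m => isClosed_iInter fun z => isClosed_eq ?_ ?_
  · exact (hF m z).comp continuous_fst
  · refine ((hc m).comp continuous_fst).mul ?_
    fun_prop

theorem exists_matched {M : Type} [Fintype M] {d : M → ℕ} {T : Type*} [PseudoMetricSpace T]
    [PreconnectedSpace T]
    (F : M → T → ℂ → ℂ) (c : M → T → ℂ) (hF : ∀ m z, Continuous fun y => F m y z)
    (hc : ∀ m, Continuous (c m)) (hc0 : ∀ m t, c m t ≠ 0)
    (hlab : ∀ t, ∃ α : (Idx d) → ℂ, IsLab F c t α)
    (C : T → ℝ) (hC : Continuous C)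
    (hb : ∀ t (α : (Idx d) → ℂ), IsLab F c t α → ‖α‖ ≤ C t)
    (ε δ : ℝ) (hε : 0 < ε) (hε1 : ε < 1) (hδ : 0 ≤ δ) (hδ2 : δ ≤ 1/2)
    (hδε : 8 * δ * (Fintype.card ((Idx d) × (Idx d)) + 1) < ε)
    (t₀ : T) (α : (Idx d) → ℂ) (hα : IsLab F c t₀ α)
    (hclose : ∀ t (β : (Idx d) → ℂ), IsLab F c t β → ∀ i j, ∃ k l,
      ‖(β i - β j) - (α k - α l)‖ ≤ δ * ‖α k - α l‖)
    (hcard : ∀ t (β : (Idx d) → ℂ), IsLab F c t β →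
      (Finset.univ.filter fun p : (Idx d) × (Idx d) => β p.1 - β p.2 = 0).card
      = (Finset.univ.filter fun p : (Idx d) × (Idx d) => α p.1 - α p.2 = 0).card)
    (t : T) :
    ∃ β : (Idx d) → ℂ, IsLab F c t β ∧
      ∀ i j, ‖(β i - β j) - (α i - α j)‖ ≤ ε * ‖α i - α j‖ := by
  classical
  have hρ : ∀ i j : (Idx d), ∃ ρ : ℝ, 0 < ρ ∧ ρ ≤ ε ∧ (α i - α j ≠ 0 → ∀ u : ℂ,
      (∃ p : (Idx d) × (Idx d), ‖u - (α p.1 - α p.2)‖ ≤ δ * ‖α p.1 - α p.2‖) →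
        ‖u - (α i - α j)‖ ≠ ρ * ‖α i - α j‖) := by
    intro i j
    by_cases h : α i - α j = 0
    · exact ⟨ε, hε, le_rfl, fun h' => absurd h h'⟩
    · obtain ⟨ρ, h1, h2, h3⟩ := exists_radius (fun p : (Idx d) × (Idx d) => α p.1 - α p.2) (α i - α j) h ε δ hε
        hε1.le hδ hδ2 hδε
      exact ⟨ρ, h1, h2, fun _ => h3⟩
  choose ρ hρ0 hρε hρm using hρ
  -- the closed set
  let A : Set T := {t | ∃ β : (Idx d) → ℂ, IsLab F c t β ∧
      ∀ i j, ‖(β i - β j) - (α i - α j)‖ ≤ ρ i j * ‖α i - α j‖}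
  let O : Set ((Idx d) → ℂ) := {β | ∀ i j, α i - α j ≠ 0 →
      ‖(β i - β j) - (α i - α j)‖ < ρ i j * ‖α i - α j‖}
  have hO : IsOpen O := by
    simp only [O, Set.ofPred_forall]
    refine isOpen_iInter_of_finite fun i => isOpen_iInter_of_finite fun j =>
      isOpen_iInter_of_finite fun _ => isOpen_lt (by fun_prop) (by fun_prop)
  have hAclosed : IsClosed A := by
    have : A = Prod.fst '' ({p : T × ((Idx d) → ℂ) | IsLab F c p.1 p.2} ∩
        {p | ∀ i j, ‖(p.2 i - p.2 j) - (α i - α j)‖ ≤ ρ i j * ‖α i - α j‖}) := by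
      ext t
      constructor
      · rintro ⟨β, h1, h2⟩
        exact ⟨(t, β), ⟨h1, h2⟩, rfl⟩
      · rintro ⟨⟨t, β⟩, ⟨h1, h2⟩, rfl⟩
        exact ⟨β, h1, h2⟩
    rw [this]
    refine isClosed_proj _ ((isClosed_isLab F c hF hc).inter ?_) C hC fun p hp => hb _ _ hp.1
    simp only [Set.ofPred_forall]
    exact isClosed_iInter fun i => isClosed_iInter fun j => isClosed_le (by fun_prop) (by fun_prop)
  have hAO : A = {t | ∃ β : (Idx d) → ℂ, IsLab F c t β ∧ β ∈ O} := by
    ext t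
    constructor
    · rintro ⟨β, h1, h2⟩
      refine ⟨β, h1, fun i j hij => lt_of_le_of_ne (h2 i j) ?_⟩
      obtain ⟨k, l, hkl⟩ := hclose t β h1 i j
      exact hρm i j hij _ ⟨(k, l), hkl⟩
    · rintro ⟨β, h1, h2⟩
      refine ⟨β, h1, fun i j => ?_⟩
      by_cases hij : α i - α j = 0
      · have hsub : (Finset.univ.filter fun p : (Idx d) × (Idx d) => β p.1 - β p.2 = 0) ⊆
            (Finset.univ.filter fun p : (Idx d) × (Idx d) => α p.1 - α p.2 = 0) := by
          intro p hp
          simp only [Finset.mem_filter, Finset.mem_univ, true_and] at hp ⊢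
          by_contra hne
          have := h2 p.1 p.2 hne
          rw [hp, zero_sub, norm_neg] at this
          have h3 : 0 < ‖α p.1 - α p.2‖ := norm_pos_iff.2 hne
          have h4 := hρε p.1 p.2
          nlinarith
        have heq := Finset.eq_of_subset_of_card_le hsub (hcard t β h1).ge
        have : (i, j) ∈ (Finset.univ.filter fun p : (Idx d) × (Idx d) => α p.1 - α p.2 = 0) := by
          simpa using hij
        rw [← heq] at this
        have hβ : β i - β j = 0 := by simpa using this
        simp [hβ, hij]
      · exact (h2 i j hij).le
  have hAopen : IsOpen A := by
    rw [← isClosed_compl_iff]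
    have : Aᶜ = Prod.fst '' ({p : T × ((Idx d) → ℂ) | IsLab F c p.1 p.2} ∩
        {p | ∀ σ : Equiv.Perm (Idx d), (∀ y' γ, IsLab F c y' γ → IsLab F c y' (γ ∘ σ)) → p.2 ∘ σ ∈ Oᶜ}) := by
      rw [hAO]
      ext t
      constructor
      · intro ht
        obtain ⟨β, hβ⟩ := hlab t
        refine ⟨(t, β), ⟨hβ, fun σ hσ hmem => ht ⟨_, hσ t β hβ, hmem⟩⟩, rfl⟩
      · rintro ⟨⟨t, β⟩, ⟨h1, h2⟩, rfl⟩ ⟨γ, hγ, hγO⟩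
        obtain ⟨σ, hσ, hσ'⟩ := isLab_perm F c t (fun m => hc0 m t) β γ h1 hγ
        refine h2 σ hσ' ?_
        have : β ∘ σ = γ := funext hσ
        simpa [this] using hγO
    rw [this]
    refine isClosed_proj _ ((isClosed_isLab F c hF hc).inter ?_) C hC fun p hp => hb _ _ hp.1
    simp only [Set.ofPred_forall]
    refine isClosed_iInter fun σ => isClosed_iInter fun _ => ?_
    refine hO.isClosed_compl.preimage (f := fun p : T × ((Idx d) → ℂ) => p.2 ∘ σ) ?_
    exact continuous_pi fun i => (continuous_apply (σ i)).comp continuous_snd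
  have hAuniv : A = Set.univ := IsClopen.eq_univ ⟨hAclosed, hAopen⟩
    ⟨t₀, α, hα, fun i j => by
      rw [sub_self, norm_zero]; exact mul_nonneg (hρ0 i j).le (norm_nonneg _)⟩
  have : t ∈ A := hAuniv ▸ Set.mem_univ t
  obtain ⟨β, h1, h2⟩ := this
  exact ⟨β, h1, fun i j => (h2 i j).trans (by gcongr; exact hρε i j)⟩

/-- uniqueness of the matching -/
lemma matched_unique {ι : Type*} [Fintype ι] [DecidableEq ι] (α β : ι → ℂ) (π : Equiv.Perm ι) (ε : ℝ)
    (hε : 0 ≤ ε) (hε2 : ε ≤ 1/2)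
    (hεN : (1 + 4 * ε) ^ (Fintype.card (Equiv.Perm ι)) < 2)
    (h1 : ∀ i j, ‖(β i - β j) - (α i - α j)‖ ≤ ε * ‖α i - α j‖)
    (h2 : ∀ i j, ‖(β (π i) - β (π j)) - (α i - α j)‖ ≤ ε * ‖α i - α j‖) (i : ι) :
    β (π i) = β i := by
  set N := Fintype.card (Equiv.Perm ι) with hN
  let v : ℕ → ℂ := fun k => β ((π ^ (k+1)) i) - β ((π ^ k) i)
  have hstep : ∀ i j, ‖(β (π i) - β (π j)) - (β i - β j)‖ ≤ 4 * ε * ‖β i - β j‖ := by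
    intro i j
    have a1 := h1 i j
    have a2 := h2 i j
    have a3 : ‖(β (π i) - β (π j)) - (β i - β j)‖ ≤ 2 * (ε * ‖α i - α j‖) := by
      have := norm_sub_le ((β (π i) - β (π j)) - (α i - α j)) ((β i - β j) - (α i - α j))
      rw [sub_sub_sub_cancel_right] at this
      linarith
    have a4 : ‖α i - α j‖ ≤ 2 * ‖β i - β j‖ := by
      have := norm_sub_le (β i - β j) ((β i - β j) - (α i - α j))
      rw [sub_sub_cancel] at this
      nlinarith [norm_nonneg (α i - α j)]
    nlinarith
  have hv : ∀ k, ‖v (k+1) - v k‖ ≤ 4 * ε * ‖v k‖ := by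
    intro k
    have := hstep ((π ^ (k+1)) i) ((π ^ k) i)
    simpa only [v, pow_succ' π (k+1), pow_succ' π k, Equiv.Perm.mul_apply] using this
  have hvk : ∀ k, ‖v k‖ ≤ (1 + 4 * ε) ^ k * ‖v 0‖ ∧ ‖v k - v 0‖ ≤ ((1 + 4 * ε) ^ k - 1) * ‖v 0‖ := by
    intro k
    induction k with
    | zero => simp
    | succ k ih =>
      obtain ⟨i1, i2⟩ := ih
      have b1 := hv k
      have b2 : ‖v (k+1)‖ ≤ ‖v k‖ + ‖v (k+1) - v k‖ := by
        have := norm_add_le (v k) (v (k+1) - v k); simpa using this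
      have b3 : ‖v (k+1) - v 0‖ ≤ ‖v (k+1) - v k‖ + ‖v k - v 0‖ := norm_sub_le_norm_sub_add_norm_sub _ _ _
      have b4 : 4 * ε * ‖v k‖ ≤ 4 * ε * ((1 + 4 * ε) ^ k * ‖v 0‖) := by gcongr
      rw [pow_succ]
      constructor <;> nlinarith
  have hsum : ∑ k ∈ Finset.range N, v k = 0 := by
    simp only [v]
    rw [Finset.sum_range_sub (fun k => β ((π ^ k) i))]
    simp [hN]
  have hNpos : 0 < N := Fintype.card_pos
  have hv0 : v 0 = 0 := by
    by_contra hne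
    have hpos : 0 < ‖v 0‖ := norm_pos_iff.2 hne
    have : ‖∑ k ∈ Finset.range N, (v k - v 0)‖ < N * ‖v 0‖ := by
      refine (norm_sum_le _ _).trans_lt ?_
      calc _ < ∑ k ∈ Finset.range N, ‖v 0‖ := by
            refine Finset.sum_lt_sum_of_nonempty ⟨0, by simpa using hNpos⟩ fun k hk => ?_
            refine (hvk k).2.trans_lt ?_
            have : (1 + 4 * ε) ^ k ≤ (1 + 4 * ε) ^ N :=
              pow_le_pow_right₀ (by linarith) (Finset.mem_range.1 hk).le
            nlinarith
        _ = _ := by simp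
    rw [Finset.sum_sub_distrib, hsum] at this
    simp at this
  simpa [v, sub_eq_zero] using hv0

/-- average of the two extremal Lipschitz extensions of a real function on a finite set -/
noncomputable def lipR {ι : Type*} [Fintype ι] [Nonempty ι] (ε : ℝ) (α : ι → ℂ) (g : ι → ℝ)
    (z : ℂ) : ℝ :=
  ((Finset.univ.inf' Finset.univ_nonempty fun i => g i + ε * ‖z - α i‖) +
    (Finset.univ.sup' Finset.univ_nonempty fun i => g i - ε * ‖z - α i‖)) / 2

section lip
variable {ι : Type*} [Fintype ι] [Nonempty ι]

lemma lipR_continuous (ε : ℝ) :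
    Continuous fun p : (ι → ℂ) × (ι → ℝ) × ℂ => lipR ε p.1 p.2.1 p.2.2 := by
  unfold lipR
  refine Continuous.div_const (Continuous.add ?_ ?_) _
  · exact Continuous.finset_inf'_apply _ fun i _ => by fun_prop
  · exact Continuous.finset_sup'_apply _ fun i _ => by fun_prop

lemma lipR_apply (ε : ℝ) (α : ι → ℂ) (g : ι → ℝ)
    (h : ∀ i j, |g i - g j| ≤ ε * ‖α i - α j‖) (i : ι) : lipR ε α g (α i) = g i := by
  have h1 : (Finset.univ.inf' Finset.univ_nonempty fun j => g j + ε * ‖α i - α j‖) = g i := by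
    refine le_antisymm ?_ ?_
    · refine (Finset.inf'_le _ (Finset.mem_univ i)).trans ?_
      simp
    · refine Finset.le_inf' _ _ fun j _ => ?_
      have := (abs_le.1 (h i j)).2
      linarith
  have h2 : (Finset.univ.sup' Finset.univ_nonempty fun j => g j - ε * ‖α i - α j‖) = g i := by
    refine le_antisymm ?_ ?_
    · refine Finset.sup'_le _ _ fun j _ => ?_
      have := (abs_le.1 (h i j)).1
      linarith
    · refine le_trans ?_ (Finset.le_sup' (fun j => g j - ε * ‖α i - α j‖) (Finset.mem_univ i))
      simp
  unfold lipR
  rw [h1, h2]; ring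

lemma lipR_lipschitz (ε : ℝ) (hε : 0 ≤ ε) (α : ι → ℂ) (g : ι → ℝ) (z w : ℂ) :
    |lipR ε α g z - lipR ε α g w| ≤ ε * ‖z - w‖ := by
  have key : ∀ z w : ℂ, lipR ε α g z ≤ lipR ε α g w + ε * ‖z - w‖ := by
    intro z w
    have hn : ∀ i, ‖z - α i‖ ≤ ‖w - α i‖ + ‖z - w‖ := fun i => by
      have := norm_sub_le_norm_sub_add_norm_sub z w (α i); linarith
    have hn' : ∀ i, ‖w - α i‖ ≤ ‖z - α i‖ + ‖z - w‖ := fun i => by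
      have := norm_sub_le_norm_sub_add_norm_sub w z (α i)
      rw [norm_sub_rev w z] at this; linarith
    have h1 : (Finset.univ.inf' Finset.univ_nonempty fun i => g i + ε * ‖z - α i‖) - ε * ‖z - w‖
        ≤ (Finset.univ.inf' Finset.univ_nonempty fun i => g i + ε * ‖w - α i‖) := by
      refine Finset.le_inf' _ _ fun j _ => ?_
      have := Finset.inf'_le (fun i => g i + ε * ‖z - α i‖) (Finset.mem_univ j)
      nlinarith [hn j]
    have h2 : (Finset.univ.sup' Finset.univ_nonempty fun i => g i - ε * ‖z - α i‖)
        ≤ (Finset.univ.sup' Finset.univ_nonempty fun i => g i - ε * ‖w - α i‖) + ε * ‖z - w‖ := by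
      refine Finset.sup'_le _ _ fun j _ => ?_
      have := Finset.le_sup' (fun i => g i - ε * ‖w - α i‖) (Finset.mem_univ j)
      nlinarith [hn' j]
    unfold lipR
    linarith
  rw [abs_le]
  have a := key z w
  have b := key w z
  rw [norm_sub_rev w z] at b
  constructor <;> linarith

lemma lipR_perm (ε : ℝ) (α : ι → ℂ) (g : ι → ℝ) (z : ℂ) (σ : Equiv.Perm ι) :
    lipR ε (α ∘ σ) (g ∘ σ) z = lipR ε α g z := by
  have h1 : (Finset.univ.inf' Finset.univ_nonempty fun i => g (σ i) + ε * ‖z - α (σ i)‖) =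
      Finset.univ.inf' Finset.univ_nonempty fun i => g i + ε * ‖z - α i‖ := by
    refine le_antisymm (Finset.le_inf' _ _ fun j _ => ?_) (Finset.le_inf' _ _ fun j _ => ?_)
    · have := Finset.inf'_le (fun i => g (σ i) + ε * ‖z - α (σ i)‖) (Finset.mem_univ (σ.symm j))
      simp only [Equiv.apply_symm_apply] at this
      exact this
    · exact Finset.inf'_le (fun i => g i + ε * ‖z - α i‖) (Finset.mem_univ (σ j))
  have h2 : (Finset.univ.sup' Finset.univ_nonempty fun i => g (σ i) - ε * ‖z - α (σ i)‖) =
      Finset.univ.sup' Finset.univ_nonempty fun i => g i - ε * ‖z - α i‖ := by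
    refine le_antisymm (Finset.sup'_le _ _ fun j _ => ?_) (Finset.sup'_le _ _ fun j _ => ?_)
    · exact Finset.le_sup' (fun i => g i - ε * ‖z - α i‖) (Finset.mem_univ (σ j))
    · have := Finset.le_sup' (fun i => g (σ i) - ε * ‖z - α (σ i)‖) (Finset.mem_univ (σ.symm j))
      simp only [Equiv.apply_symm_apply] at this
      exact this
  unfold lipR
  simp only [Function.comp_apply]
  rw [h1, h2]

lemma lipR_zero (ε : ℝ) (α : ι → ℂ) (z : ℂ) : lipR ε α (fun _ => 0) z = 0 := by
  have h : (Finset.univ.sup' Finset.univ_nonempty fun i => (0:ℝ) - ε * ‖z - α i‖) =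
      - Finset.univ.inf' Finset.univ_nonempty fun i => (0:ℝ) + ε * ‖z - α i‖ := by
    refine le_antisymm (Finset.sup'_le _ _ fun j _ => ?_) ?_
    · have := Finset.inf'_le (fun i => (0:ℝ) + ε * ‖z - α i‖) (Finset.mem_univ j)
      linarith
    · rw [neg_le]
      refine Finset.le_inf' _ _ fun j _ => ?_
      have := Finset.le_sup' (fun i => (0:ℝ) - ε * ‖z - α i‖) (Finset.mem_univ j)
      linarith
  unfold lipR
  rw [h]; ring

/-- complex version, with displacement `β - α` -/
noncomputable def lipC (ε : ℝ) (α β : ι → ℂ) (z : ℂ) : ℂ :=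
  ⟨lipR ε α (fun i => (β i - α i).re) z, lipR ε α (fun i => (β i - α i).im) z⟩

lemma lipC_continuous (ε : ℝ) :
    Continuous fun p : (ι → ℂ) × (ι → ℂ) × ℂ => lipC ε p.1 p.2.1 p.2.2 := by
  have h1 : Continuous fun p : (ι → ℂ) × (ι → ℂ) × ℂ =>
      lipR ε p.1 (fun i => (p.2.1 i - p.1 i).re) p.2.2 :=
    (lipR_continuous (ι := ι) ε).comp (f := fun p : (ι → ℂ) × (ι → ℂ) × ℂ =>
      (p.1, (fun i => (p.2.1 i - p.1 i).re), p.2.2)) (by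
      refine continuous_fst.prodMk (Continuous.prodMk (continuous_pi fun i => ?_) (by fun_prop))
      exact Complex.continuous_re.comp (by fun_prop))
  have h2 : Continuous fun p : (ι → ℂ) × (ι → ℂ) × ℂ =>
      lipR ε p.1 (fun i => (p.2.1 i - p.1 i).im) p.2.2 :=
    (lipR_continuous (ι := ι) ε).comp (f := fun p : (ι → ℂ) × (ι → ℂ) × ℂ =>
      (p.1, (fun i => (p.2.1 i - p.1 i).im), p.2.2)) (by
      refine continuous_fst.prodMk (Continuous.prodMk (continuous_pi fun i => ?_) (by fun_prop))
      exact Complex.continuous_im.comp (by fun_prop))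
  have : (fun p : (ι → ℂ) × (ι → ℂ) × ℂ => lipC ε p.1 p.2.1 p.2.2) = fun p =>
      ((lipR ε p.1 (fun i => (p.2.1 i - p.1 i).re) p.2.2 : ℝ) : ℂ) +
      ((lipR ε p.1 (fun i => (p.2.1 i - p.1 i).im) p.2.2 : ℝ) : ℂ) * Complex.I := by
    funext p
    apply Complex.ext <;> simp [lipC]
  rw [this]
  exact (Complex.continuous_ofReal.comp h1).add ((Complex.continuous_ofReal.comp h2).mul
    continuous_const)

lemma lipC_apply (ε : ℝ) (α β : ι → ℂ)
    (h : ∀ i j, ‖(β i - β j) - (α i - α j)‖ ≤ ε * ‖α i - α j‖) (i : ι) :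
    lipC ε α β (α i) = β i - α i := by
  have e : ∀ i j, (β i - α i) - (β j - α j) = (β i - β j) - (α i - α j) := fun i j => by ring
  apply Complex.ext
  · exact lipR_apply ε α (fun i => (β i - α i).re) (fun i j => by
      rw [← Complex.sub_re, e]; exact (Complex.abs_re_le_norm _).trans (h i j)) i
  · exact lipR_apply ε α (fun i => (β i - α i).im) (fun i j => by
      rw [← Complex.sub_im, e]; exact (Complex.abs_im_le_norm _).trans (h i j)) i

lemma lipC_lipschitz (ε : ℝ) (hε : 0 ≤ ε) (α β : ι → ℂ) (z w : ℂ) :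
    ‖lipC ε α β z - lipC ε α β w‖ ≤ 2 * ε * ‖z - w‖ := by
  refine (Complex.norm_le_abs_re_add_abs_im _).trans ?_
  have h1 := lipR_lipschitz ε hε α (fun i => (β i - α i).re) z w
  have h2 := lipR_lipschitz ε hε α (fun i => (β i - α i).im) z w
  simp only [Complex.sub_re, Complex.sub_im, lipC] at *
  linarith

lemma lipC_perm (ε : ℝ) (α β : ι → ℂ) (z : ℂ) (σ : Equiv.Perm ι) :
    lipC ε (α ∘ σ) (β ∘ σ) z = lipC ε α β z := by
  apply Complex.ext
  · exact lipR_perm ε α (fun i => (β i - α i).re) z σ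
  · exact lipR_perm ε α (fun i => (β i - α i).im) z σ

lemma lipC_self (ε : ℝ) (α : ι → ℂ) (z : ℂ) : lipC ε α α z = 0 := by
  apply Complex.ext
  · simpa [lipC] using lipR_zero ε α z
  · simpa [lipC] using lipR_zero ε α z

end lip

lemma fiber_homeo {Y : Type*} [TopologicalSpace Y] (G : Y → ℂ → ℂ)
    (hG : Continuous fun p : Y × ℂ => G p.1 p.2)
    (hL : ∀ y z w, ‖G y z - G y w‖ ≤ 1/2 * ‖z - w‖) :
    ∃ inv : Y → ℂ → ℂ, Continuous (fun p : Y × ℂ => inv p.1 p.2) ∧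
      (∀ y z, inv y (z + G y z) = z) ∧ ∀ y w, inv y w + G y (inv y w) = w := by
  have hsurj : ∀ y w, ∃ z, z + G y z = w := by
    intro y w
    have hc : ContractingWith (1/2) (fun z => w - G y z) := by
      refine ⟨by norm_num, LipschitzWith.of_dist_le_mul fun a b => ?_⟩
      rw [dist_eq_norm, dist_eq_norm, sub_sub_sub_cancel_left, norm_sub_rev a b]
      simpa using hL y b a
    refine ⟨hc.fixedPoint, ?_⟩
    have h := hc.fixedPoint_isFixedPt
    have h' : w - G y hc.fixedPoint = hc.fixedPoint := h
    linear_combination -h'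
  have hexp : ∀ y z w, ‖z - w‖ ≤ 2 * ‖(z + G y z) - (w + G y w)‖ := by
    intro y z w
    have h1 := hL y z w
    have h2 := norm_sub_le ((z + G y z) - (w + G y w)) (G y z - G y w)
    have e : ((z + G y z) - (w + G y w)) - (G y z - G y w) = z - w := by ring
    rw [e] at h2
    linarith
  choose inv hinv using hsurj
  refine ⟨inv, ?_, ?_, hinv⟩
  · rw [continuous_iff_continuousAt]
    rintro ⟨y, w⟩
    set z := inv y w with hz
    rw [ContinuousAt, tendsto_iff_norm_sub_tendsto_zero]
    have hlim : Tendsto (fun p : Y × ℂ => 2 * ‖p.2 - (z + G p.1 z)‖) (𝓝 (y, w)) (𝓝 0) := by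
      have hc : Continuous (fun p : Y × ℂ => 2 * ‖p.2 - (z + G p.1 z)‖) := by
        have : Continuous fun p : Y × ℂ => G p.1 z :=
          hG.comp (continuous_fst.prodMk continuous_const)
        fun_prop
      have := hc.tendsto (y, w)
      simpa [hz, hinv y w] using this
    refine squeeze_zero (fun _ => norm_nonneg _) (fun p => ?_) hlim
    have := hexp p.1 (inv p.1 p.2) z
    rwa [hinv] at this
  · intro y z
    have := hexp y (inv y (z + G y z)) z
    rw [hinv, sub_self, norm_zero, mul_zero] at this
    exact sub_eq_zero.1 (norm_le_zero_iff.1 this)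

lemma lipC_unique {M : Type} [Fintype M] {d : M → ℕ} [Nonempty (Idx d)] {Y : Type*}
    (F : M → Y → ℂ → ℂ) (c : M → Y → ℂ) (hc0 : ∀ m t, c m t ≠ 0) (ε : ℝ) (hε : 0 ≤ ε)
    (hε2 : ε ≤ 1/2) [DecidableEq (Idx d)]
    (hεN : (1 + 4 * ε) ^ (Fintype.card (Equiv.Perm (Idx d))) < 2)
    (y y' : Y) (α β α' β' : Idx d → ℂ) (hα : IsLab F c y α) (hα' : IsLab F c y α')
    (hβ : IsLab F c y' β) (hβ' : IsLab F c y' β')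
    (h : ∀ i j, ‖(β i - β j) - (α i - α j)‖ ≤ ε * ‖α i - α j‖)
    (h' : ∀ i j, ‖(β' i - β' j) - (α' i - α' j)‖ ≤ ε * ‖α' i - α' j‖) (z : ℂ) :
    lipC ε α' β' z = lipC ε α β z := by
  obtain ⟨σ, hσ, -⟩ := isLab_perm F c y (fun m => hc0 m y) α α' hα hα'
  obtain ⟨τ, hτ, -⟩ := isLab_perm F c y' (fun m => hc0 m y') β β' hβ hβ'
  have e1 : α' = α ∘ σ := (funext hσ).symm
  have e2 : β' = β ∘ σ := by
    funext i
    have := matched_unique α β (σ.symm.trans τ) ε hε hε2 hεN h (fun i j => by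
      have := h' (σ.symm i) (σ.symm j)
      rw [← hσ, ← hσ, ← hτ, ← hτ] at this
      simpa using this) (σ i)
    simp only [Equiv.trans_apply, Equiv.symm_apply_apply] at this
    rw [← hτ, this]; rfl
  rw [e1, e2, lipC_perm]

set_option maxHeartbeats 1000000 in
theorem core_lift {M : Type} [Fintype M] {d : M → ℕ} [Nonempty (Idx d)] [DecidableEq (Idx d)]
    {T X : Type*} [PseudoMetricSpace T] [PreconnectedSpace T] [PseudoMetricSpace X]
    (F : M → T × X → ℂ → ℂ) (c : M → T × X → ℂ) (hF : ∀ m z, Continuous fun y => F m y z)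
    (hc : ∀ m, Continuous (c m)) (hc0 : ∀ m t, c m t ≠ 0)
    (hlab : ∀ y, ∃ α : Idx d → ℂ, IsLab F c y α)
    (C : T × X → ℝ) (hC : Continuous C)
    (hb : ∀ y (α : Idx d → ℂ), IsLab F c y α → ‖α‖ ≤ C y)
    (h : T → X → X) (hh : Continuous fun p : T × X => h p.1 p.2) (t₀ : T) (h0 : ∀ x, h t₀ x = x)
    (ε δ : ℝ) (hε : 0 < ε) (hε2 : ε ≤ 1/2) (hδ : 0 ≤ δ) (hδ2 : δ ≤ 1/2)
    (hεN : (1 + 4 * ε) ^ (Fintype.card (Equiv.Perm (Idx d))) < 2)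
    (hδε : 8 * δ * (Fintype.card (Idx d × Idx d) + 1) < ε)
    (hclose : ∀ t x (α β : Idx d → ℂ), IsLab F c (t₀, x) α → IsLab F c (t, h t x) β →
      ∀ i j, ∃ k l, ‖(β i - β j) - (α k - α l)‖ ≤ δ * ‖α k - α l‖)
    (hcard : ∀ t x (α β : Idx d → ℂ), IsLab F c (t₀, x) α → IsLab F c (t, h t x) β →
      (Finset.univ.filter fun p : Idx d × Idx d => β p.1 - β p.2 = 0).card
      = (Finset.univ.filter fun p : Idx d × Idx d => α p.1 - α p.2 = 0).card) :
    ∃ G : T × X → ℂ → ℂ, (Continuous fun p : (T × X) × ℂ => G p.1 p.2) ∧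
      (∀ y z w, ‖G y z - G y w‖ ≤ 2 * ε * ‖z - w‖) ∧ (∀ x z, G (t₀, x) z = 0) ∧
      ∀ t x, ∃ α β : Idx d → ℂ, IsLab F c (t₀, x) α ∧ IsLab F c (t, h t x) β ∧
        ∀ i z, ‖(z + G (t, x) z - β i) - (z - α i)‖ ≤ 2 * ε * ‖z - α i‖ := by
  have hex : ∀ y : T × X, ∃ p : (Idx d → ℂ) × (Idx d → ℂ), IsLab F c (t₀, y.2) p.1 ∧
      IsLab F c (y.1, h y.1 y.2) p.2 ∧
      ∀ i j, ‖(p.2 i - p.2 j) - (p.1 i - p.1 j)‖ ≤ ε * ‖p.1 i - p.1 j‖ := by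
    rintro ⟨t, x⟩
    obtain ⟨α, hα⟩ := hlab (t₀, x)
    have hcx : Continuous fun t => (t, h t x) :=
      continuous_id.prodMk (hh.comp (continuous_id.prodMk continuous_const))
    obtain ⟨β, h1, h2⟩ := exists_matched (T := T) (d := d) (fun m t z => F m (t, h t x) z)
      (fun m t => c m (t, h t x)) (fun m z => (hF m z).comp hcx) (fun m => (hc m).comp hcx)
      (fun m t => hc0 m _) (fun t => hlab (t, h t x)) (fun t => C (t, h t x)) (hC.comp hcx)
      (fun t α hα => hb (t, h t x) α hα) ε δ hε (by linarith) hδ hδ2 hδε t₀ α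
      (by intro m z; simpa [h0] using hα m z)
      (fun t β hβ => hclose t x α β hα hβ) (fun t β hβ => hcard t x α β hα hβ) t
    exact ⟨(α, β), hα, h1, h2⟩
  choose p hp1 hp2 hp3 using hex
  refine ⟨fun y z => lipC ε (p y).1 (p y).2 z, ?_, ?_, ?_, ?_⟩
  · let K : Set (((T × X) × ℂ) × ((Idx d → ℂ) × (Idx d → ℂ))) :=
      {q | IsLab F c (t₀, q.1.1.2) q.2.1} ∩ ({q | IsLab F c (q.1.1.1, h q.1.1.1 q.1.1.2) q.2.2} ∩
      {q | ∀ i j, ‖(q.2.2 i - q.2.2 j) - (q.2.1 i - q.2.1 j)‖ ≤ ε * ‖q.2.1 i - q.2.1 j‖})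
    have c1 : Continuous fun q : ((T × X) × ℂ) => (t₀, q.1.2) := by fun_prop
    have c2 : Continuous fun q : ((T × X) × ℂ) => (q.1.1, h q.1.1 q.1.2) :=
      (by fun_prop : Continuous fun q : ((T × X) × ℂ) => q.1.1).prodMk (hh.comp continuous_fst)
    have hK : IsClosed K := by
      refine IsClosed.inter ?_ (IsClosed.inter ?_ ?_)
      · exact (isClosed_isLab (d := d) F c hF hc).preimage
          (f := fun q : (((T × X) × ℂ) × ((Idx d → ℂ) × (Idx d → ℂ))) =>
            (((t₀, q.1.1.2), q.2.1) : (T × X) × (Idx d → ℂ)))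
          ((c1.comp continuous_fst).prodMk (by fun_prop))
      · exact (isClosed_isLab (d := d) F c hF hc).preimage
          (f := fun q : (((T × X) × ℂ) × ((Idx d → ℂ) × (Idx d → ℂ))) =>
            (((q.1.1.1, h q.1.1.1 q.1.1.2), q.2.2) : (T × X) × (Idx d → ℂ)))
          ((c2.comp continuous_fst).prodMk (by fun_prop))
      · simp only [Set.ofPred_forall]
        exact isClosed_iInter fun i => isClosed_iInter fun j =>
          isClosed_le (by fun_prop) (by fun_prop)
    refine continuous_of_proj K hK
      (fun q => max (C (t₀, q.1.2)) (C (q.1.1, h q.1.1 q.1.2)))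
      ((hC.comp c1).max (hC.comp c2)) ?_ (fun q => lipC ε q.2.1 q.2.2 q.1.2) ?_ _ ?_ ?_
    · intro q hq
      have h1 : IsLab F c (t₀, q.1.1.2) q.2.1 := hq.1
      have h2 : IsLab F c (q.1.1.1, h q.1.1.1 q.1.1.2) q.2.2 := hq.2.1
      rw [Prod.norm_def]
      exact max_le_max (hb _ _ h1) (hb _ _ h2)
    · have hc3 : Continuous fun q : (((T × X) × ℂ) × ((Idx d → ℂ) × (Idx d → ℂ))) =>
          (q.2.1, q.2.2, q.1.2) := by fun_prop
      exact (lipC_continuous (ι := Idx d) ε).comp hc3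
    · intro q hq
      have h1 : IsLab F c (t₀, q.1.1.2) q.2.1 := hq.1
      have h2 : IsLab F c (q.1.1.1, h q.1.1.1 q.1.1.2) q.2.2 := hq.2.1
      have h3 : ∀ i j, ‖(q.2.2 i - q.2.2 j) - (q.2.1 i - q.2.1 j)‖
        ≤ ε * ‖q.2.1 i - q.2.1 j‖ := hq.2.2
      exact lipC_unique F c hc0 ε hε.le hε2 hεN _ _ _ _ _ _ (hp1 _) h1 (hp2 _) h2 (hp3 _) h3 _
    · intro q
      exact ⟨p q.1, hp1 q.1, hp2 q.1, hp3 q.1⟩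
  · intro y z w
    exact lipC_lipschitz ε hε.le _ _ z w
  · intro x z
    have h1 := hp1 (t₀, x)
    rw [← lipC_self ε (p (t₀, x)).1 z]
    refine lipC_unique F c hc0 ε hε.le hε2 hεN (t₀, x) (t₀, h t₀ x) _ _ _ _ h1 h1 ?_
      (hp2 (t₀, x)) ?_ (hp3 (t₀, x)) z
    · rw [h0]; exact h1
    · intro i j
      rw [sub_self, norm_zero]; positivity
  · intro t x
    refine ⟨_, _, hp1 (t, x), hp2 (t, x), fun i z => ?_⟩
    have h1 := lipC_apply ε _ _ (hp3 (t, x)) i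
    have h2 := lipC_lipschitz ε hε.le (p (t, x)).1 (p (t, x)).2 z ((p (t, x)).1 i)
    rw [h1] at h2
    refine le_trans (le_of_eq ?_) h2
    congr 1
    ring

lemma diff_coeff_poly {σ : Type} [Fintype σ] [DecidableEq σ] (e : ℕ) :
    ∃ g : MvPolynomial (Fin (Fintype.card σ)) ℂ, ∀ α : σ → ℂ,
      MvPolynomial.eval (fun i : Fin (Fintype.card σ) =>
        ((Finset.univ : Finset σ).val.map α).esymm ((i : ℕ) + 1)) g =
      (∏ p : σ × σ, (Polynomial.X - Polynomial.C (α p.1 - α p.2))).coeff e := by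
  classical
  let D : Polynomial (MvPolynomial σ ℂ) :=
    ∏ p : σ × σ, (Polynomial.X - Polynomial.C (MvPolynomial.X p.1 - MvPolynomial.X p.2))
  have hmap : ∀ {R : Type} [CommRing R] (φ : MvPolynomial σ ℂ →+* R),
      φ (D.coeff e) = (∏ p : σ × σ, (Polynomial.X -
        Polynomial.C (φ (MvPolynomial.X p.1) - φ (MvPolynomial.X p.2)))).coeff e := by
    intro R _ φ
    rw [← Polynomial.coeff_map]
    simp [D, Polynomial.map_prod]
  have hsym : (D.coeff e).IsSymmetric := by
    intro π
    have := hmap (MvPolynomial.rename π : MvPolynomial σ ℂ →ₐ[ℂ] MvPolynomial σ ℂ).toRingHom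
    refine Eq.trans this ?_
    simp only [AlgHom.toRingHom_eq_coe, RingHom.coe_coe, MvPolynomial.rename_X]
    congr 1
    exact Fintype.prod_equiv (π.prodCongr π) _ _ (fun p => by simp)
  obtain ⟨g, hg⟩ := MvPolynomial.esymmAlgHom_surjective ℂ (σ := σ) (n := Fintype.card σ) le_rfl
    ⟨_, hsym⟩
  refine ⟨g, fun α => ?_⟩
  have h1 := congrArg Subtype.val hg
  rw [MvPolynomial.esymmAlgHom_apply] at h1
  have h2 := congrArg (MvPolynomial.eval α) h1
  have h3 := hmap (MvPolynomial.eval α)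
  simp only [MvPolynomial.eval_X] at h3
  refine Eq.trans ?_ (h2.trans h3)
  rw [MvPolynomial.map_aeval]
  have : (MvPolynomial.eval α).comp (algebraMap ℂ (MvPolynomial σ ℂ)) = RingHom.id ℂ := by
    ext <;> simp [MvPolynomial.algebraMap_eq]
  rw [this]
  rw [MvPolynomial.eval]
  congr 2
  funext i
  have := MvPolynomial.aeval_esymm_eq_multiset_esymm σ ℂ (i+1) α
  rw [← this]
  rfl

/-- evaluation of a parametrized polynomial -/
noncomputable def ev {k : ℕ} (t : ℂ) (x : Fin k → ℂ) :
    MvPolynomial (Fin k) (Polynomial ℂ) →+* ℂ :=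
  MvPolynomial.eval₂Hom (Polynomial.evalRingHom t) x

@[simp] lemma ev_X {k : ℕ} (t : ℂ) (x : Fin k → ℂ) (i) : ev t x (MvPolynomial.X i) = x i := by
  simp [ev]

@[simp] lemma ev_C {k : ℕ} (t : ℂ) (x : Fin k → ℂ) (c : Polynomial ℂ) :
    ev t x (MvPolynomial.C c) = c.eval t := by
  simp [ev]

lemma ev_continuous {k : ℕ} (F : MvPolynomial (Fin k) (Polynomial ℂ)) :
    Continuous fun p : ℂ × (Fin k → ℂ) => ev p.1 p.2 F := by
  induction F using MvPolynomial.induction_on with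
  | C a => simp only [ev_C]; fun_prop
  | add p q hp hq => simp only [map_add]; exact hp.add hq
  | mul_X p i hp =>
    simp only [map_mul, ev_X]
    exact hp.mul (by fun_prop)

lemma ev_cons {k : ℕ} (t z : ℂ) (x : Fin k → ℂ) (F : MvPolynomial (Fin (k+1)) (Polynomial ℂ)) :
    ev t (Fin.cons z x : Fin (k+1) → ℂ) F =
      ((MvPolynomial.finSuccEquiv (Polynomial ℂ) k F).map (ev t x)).eval z := by
  induction F using MvPolynomial.induction_on with
  | C a => simp [MvPolynomial.finSuccEquiv_apply]
  | add p q hp hq => simp [map_add, hp, hq]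
  | mul_X p i hp =>
    simp only [map_mul, ev_X, hp, Polynomial.map_mul, Polynomial.eval_mul]
    congr 1
    refine Fin.cases ?_ (fun j => ?_) i
    · simp [MvPolynomial.finSuccEquiv_X_zero]
    · simp [MvPolynomial.finSuccEquiv_X_succ]

lemma esymm_scaled {σ : Type} [Fintype σ] (c : ℂ) (α : σ → ℂ) (q : Polynomial ℂ)
    (hq : ∀ z, q.eval z = c * ∏ i, (z - α i)) (i : ℕ) (hi : i < Fintype.card σ) :
    ((Finset.univ : Finset σ).val.map (fun s => c * α s)).esymm (i + 1) =
      (-1) ^ (i + 1) * c ^ i * q.coeff (Fintype.card σ - 1 - i) := by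
  have h1 : q = Polynomial.C c * (Multiset.map (fun t => Polynomial.X - Polynomial.C t)
      ((Finset.univ : Finset σ).val.map α)).prod := by
    refine Polynomial.funext fun z => ?_
    rw [hq, Multiset.map_map]
    simp [Polynomial.eval_mul, Polynomial.eval_prod]
  have h2 : ((Finset.univ : Finset σ).val.map (fun s => c * α s)).esymm (i + 1) =
      c ^ (i+1) * ((Finset.univ : Finset σ).val.map α).esymm (i + 1) := by
    rw [Finset.esymm_map_val, Finset.esymm_map_val, Finset.mul_sum]
    refine Finset.sum_congr rfl fun s hs => ?_
    rw [Finset.prod_mul_distrib, Finset.prod_const, (Finset.mem_powersetCard.1 hs).2]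
  have h3 := Multiset.prod_X_sub_C_coeff ((Finset.univ : Finset σ).val.map α)
    (k := Fintype.card σ - 1 - i) (by simp; omega)
  have hcard : Multiset.card ((Finset.univ : Finset σ).val.map α) = Fintype.card σ := by simp
  rw [hcard, show Fintype.card σ - (Fintype.card σ - 1 - i) = i + 1 by omega] at h3
  rw [h2, h1, Polynomial.coeff_C_mul, h3]
  have : ((-1:ℂ)^(i+1)) * (-1)^(i+1) = 1 := by rw [← mul_pow]; simp
  linear_combination (- c^(i+1) * ((Finset.univ : Finset σ).val.map α).esymm (i + 1)) * this

/-- discriminant-type coefficients as parametrized polynomials -/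
lemma exists_disc {k : ℕ} {σ : Type} [Fintype σ] [DecidableEq σ] (c : Polynomial ℂ)
    (Q : Polynomial (MvPolynomial (Fin k) (Polynomial ℂ))) (e : ℕ) :
    ∃ g : MvPolynomial (Fin k) (Polynomial ℂ), ∀ t x (α : σ → ℂ),
      (∀ z, (Q.map (ev t x)).eval z = c.eval t * ∏ i, (z - α i)) →
      ev t x g = (∏ p : σ × σ, (Polynomial.X -
        Polynomial.C (c.eval t * α p.1 - c.eval t * α p.2))).coeff e := by
  obtain ⟨g, hg⟩ := diff_coeff_poly (σ := σ) e
  refine ⟨MvPolynomial.aeval (fun i : Fin (Fintype.card σ) =>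
    ((-1) ^ ((i:ℕ) + 1) * (MvPolynomial.C c) ^ (i:ℕ) * Q.coeff (Fintype.card σ - 1 - i) :
      MvPolynomial (Fin k) (Polynomial ℂ))) g, fun t x α h => ?_⟩
  rw [← hg (fun s => c.eval t * α s), MvPolynomial.map_aeval]
  have : (ev t x).comp (algebraMap ℂ (MvPolynomial (Fin k) (Polynomial ℂ))) = RingHom.id ℂ := by
    ext a
    have h5 : algebraMap ℂ (MvPolynomial (Fin k) (Polynomial ℂ)) a =
      MvPolynomial.C (Polynomial.C a) := rfl
    rw [RingHom.comp_apply, h5, ev_C]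
    simp
  rw [this, MvPolynomial.eval]
  congr 2
  funext i
  rw [esymm_scaled _ α _ h i i.2]
  simp

lemma coeff_prod_top {ι A : Type*} [CommRing A] (s : Finset ι) (f : ι → Polynomial A) (n : ι → ℕ)
    (h : ∀ i ∈ s, (f i).natDegree ≤ n i) :
    (∏ i ∈ s, f i).natDegree ≤ ∑ i ∈ s, n i ∧
      (∏ i ∈ s, f i).coeff (∑ i ∈ s, n i) = ∏ i ∈ s, (f i).coeff (n i) := by
  classical
  induction s using Finset.induction_on with
  | empty => simp
  | insert a s ha ih =>
    obtain ⟨h1, h2⟩ := ih fun i hi => h i (Finset.mem_insert_of_mem hi)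
    have h3 := h a (Finset.mem_insert_self _ _)
    rw [Finset.prod_insert ha, Finset.sum_insert ha, Finset.prod_insert ha]
    refine ⟨Polynomial.natDegree_mul_le.trans (add_le_add h3 h1), ?_⟩
    rw [Polynomial.coeff_mul_add_eq_of_natDegree_le h3 h1, h2]

/-- sheared form, as polynomial in one variable -/
noncomputable def shear {k : ℕ} (a : Fin (k+1) → ℂ) :
    MvPolynomial (Fin (k+1)) (Polynomial ℂ) →+*
      Polynomial (MvPolynomial (Fin k) (Polynomial ℂ)) :=
  MvPolynomial.eval₂Hom (Polynomial.C.comp MvPolynomial.C) (fun i =>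
    Polynomial.C ((Fin.cons 0 MvPolynomial.X : Fin (k+1) → MvPolynomial (Fin k) (Polynomial ℂ)) i)
    + Polynomial.C (MvPolynomial.C (Polynomial.C (a i))) * Polynomial.X)

/-- the change of coordinates -/
def shearPt {k : ℕ} (a : Fin (k+1) → ℂ) (z : ℂ) (x : Fin k → ℂ) : Fin (k+1) → ℂ :=
  fun i => (Fin.cons 0 x : Fin (k+1) → ℂ) i + a i * z

lemma ev_shear {k : ℕ} (a : Fin (k+1) → ℂ) (t z : ℂ) (x : Fin k → ℂ)
    (F : MvPolynomial (Fin (k+1)) (Polynomial ℂ)) :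
    ((shear a F).map (ev t x)).eval z = ev t (shearPt a z x) F := by
  induction F using MvPolynomial.induction_on with
  | C c => simp [shear]
  | add p q hp hq => simp [map_add, hp, hq]
  | mul_X p i hp =>
    simp only [map_mul, ev_X, hp, Polynomial.map_mul, Polynomial.eval_mul]
    have hi : ((shear a (MvPolynomial.X i)).map (ev t x)).eval z = shearPt a z x i := by
      rw [shear, MvPolynomial.coe_eval₂Hom, MvPolynomial.eval₂_X, shearPt]
      have : ev t x ((Fin.cons 0 MvPolynomial.X : Fin (k+1) → MvPolynomial (Fin k) (Polynomial ℂ)) i)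
          = (Fin.cons 0 x : Fin (k+1) → ℂ) i := by
        refine Fin.cases ?_ (fun j => ?_) i
        · rw [Fin.cons_zero, Fin.cons_zero, map_zero]
        · rw [Fin.cons_succ, Fin.cons_succ, ev_X]
      rw [Polynomial.map_add, Polynomial.eval_add, Polynomial.map_C, Polynomial.eval_C, this]
      simp
    rw [hi]

lemma shear_top {k : ℕ} (a : Fin (k+1) → ℂ) (d : ℕ)
    (F : MvPolynomial (Fin (k+1)) (Polynomial ℂ)) (hd : F.totalDegree ≤ d) :
    (shear a F).natDegree ≤ d ∧ (shear a F).coeff d =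
      MvPolynomial.C (MvPolynomial.eval (fun i => Polynomial.C (a i))
        (MvPolynomial.homogeneousComponent d F)) := by
  classical
  have hmon : ∀ m r, shear a (MvPolynomial.monomial m r) = Polynomial.C (MvPolynomial.C r) *
     ∏ i, ( Polynomial.C ((Fin.cons 0 MvPolynomial.X : Fin (k+1) → MvPolynomial (Fin k) (Polynomial ℂ)) i)
    + Polynomial.C (MvPolynomial.C (Polynomial.C (a i))) * Polynomial.X) ^ (m i) := by
    intro m r
    rw [shear, MvPolynomial.coe_eval₂Hom, MvPolynomial.eval₂_monomial, Finsupp.prod_fintype _ _ (by simp)]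
    simp
  have hlin : ∀ i : Fin (k+1), (Polynomial.C ((Fin.cons 0 MvPolynomial.X : Fin (k+1) → MvPolynomial (Fin k) (Polynomial ℂ)) i)
    + Polynomial.C (MvPolynomial.C (Polynomial.C (a i))) * Polynomial.X).natDegree ≤ 1 := by
    intro i
    refine Polynomial.natDegree_add_le_of_degree_le (by simp) ?_
    exact (Polynomial.natDegree_C_mul_le _ _).trans Polynomial.natDegree_X_le
  have hm : ∀ m : Fin (k+1) →₀ ℕ, ∀ r, (shear a (MvPolynomial.monomial m r)).natDegree ≤ m.degree ∧
      (shear a (MvPolynomial.monomial m r)).coeff m.degree =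
      MvPolynomial.C (MvPolynomial.eval (fun i => Polynomial.C (a i)) (MvPolynomial.monomial m r)) := by
    intro m r
    rw [hmon]
    have h := coeff_prod_top Finset.univ (fun i : Fin (k+1) => ( Polynomial.C ((Fin.cons 0 MvPolynomial.X : Fin (k+1) → MvPolynomial (Fin k) (Polynomial ℂ)) i)
    + Polynomial.C (MvPolynomial.C (Polynomial.C (a i))) * Polynomial.X) ^ (m i)) (fun i => m i * 1) (fun i _ =>
      Polynomial.natDegree_pow_le_of_le _ (hlin i))
    have hdeg : m.degree = ∑ i, m i * 1 := by
      simp [Finsupp.degree_eq_sum]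
    rw [hdeg]
    refine ⟨(Polynomial.natDegree_C_mul_le _ _).trans h.1, ?_⟩
    rw [Polynomial.coeff_C_mul, h.2, MvPolynomial.eval_monomial, Finsupp.prod_fintype _ _ (by simp)]
    simp only [map_mul, map_prod, map_pow]
    congr 1
    refine Finset.prod_congr rfl fun i _ => ?_
    rw [Polynomial.coeff_pow_of_natDegree_le (hlin i)]
    simp
  have hle : ∀ m ∈ F.support, m.degree ≤ d := fun m hmF =>
    (MvPolynomial.le_totalDegree hmF).trans hd
  constructor
  · conv_lhs => rw [F.as_sum, map_sum]
    refine Polynomial.natDegree_sum_le_of_forall_le _ _ fun m hmF => ?_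
    exact (hm m _).1.trans (hle m hmF)
  · conv_lhs => rw [F.as_sum, map_sum, Polynomial.finsetSum_coeff]
    rw [MvPolynomial.homogeneousComponent_apply, map_sum, map_sum, Finset.sum_filter]
    refine Finset.sum_congr rfl fun m hmF => ?_
    split_ifs with h
    · subst h
      exact (hm m _).2
    · refine Polynomial.coeff_eq_zero_of_natDegree_lt ((hm m _).1.trans_lt ?_)
      exact lt_of_le_of_ne (hle m hmF) h

lemma exists_ev_ne_zero {k : ℕ} (F : MvPolynomial (Fin k) (Polynomial ℂ)) (hF : F ≠ 0) :
    ∃ t x, ev t x F ≠ 0 := by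
  by_contra! h
  apply hF
  ext1 m
  refine Polynomial.funext fun t => ?_
  have h1 : MvPolynomial.map (Polynomial.evalRingHom t) F = 0 := by
    refine MvPolynomial.funext fun x => ?_
    rw [MvPolynomial.eval_map]
    simpa [ev] using h t x
  have := congrArg (MvPolynomial.coeff m) h1
  simpa [MvPolynomial.coeff_map] using this

lemma homogeneousComponent_top_ne_zero {k : ℕ} (F : MvPolynomial (Fin k) (Polynomial ℂ))
    (hF : F ≠ 0) : MvPolynomial.homogeneousComponent F.totalDegree F ≠ 0 := by
  obtain ⟨m, hm, hd⟩ := Finset.exists_mem_eq_sup F.support (MvPolynomial.support_nonempty.2 hF)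
    (fun m => m.degree)
  have hd' : F.totalDegree = m.degree := by
    rw [← hd, MvPolynomial.totalDegree_eq]
    simp only [Finsupp.card_toMultiset]
    rfl
  intro h
  have := congrArg (MvPolynomial.coeff m) h
  rw [MvPolynomial.coeff_homogeneousComponent, if_pos hd'.symm] at this
  exact (MvPolynomial.mem_support_iff.1 hm) (by simpa using this)

lemma exists_shear {k : ℕ} (S : Finset (MvPolynomial (Fin (k+1)) (Polynomial ℂ)))
    (hS : ∀ F ∈ S, F ≠ 0) : ∃ a : Fin (k+1) → ℂ, a 0 ≠ 0 ∧ ∀ F ∈ S,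
      ∃ (d : ℕ) (c : Polynomial ℂ), c ≠ 0 ∧ (shear a F).natDegree ≤ d ∧
        (shear a F).coeff d = MvPolynomial.C c := by
  have hne : MvPolynomial.X 0 * ∏ F ∈ S, MvPolynomial.homogeneousComponent F.totalDegree F ≠ 0 := by
    refine mul_ne_zero (MvPolynomial.X_ne_zero _) (Finset.prod_ne_zero_iff.2 fun F hF => ?_)
    exact homogeneousComponent_top_ne_zero F (hS F hF)
  obtain ⟨t, a, h⟩ := exists_ev_ne_zero _ hne
  rw [map_mul, map_prod, ev_X] at h
  refine ⟨a, left_ne_zero_of_mul h, fun F hF => ?_⟩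
  refine ⟨F.totalDegree, _, ?_, shear_top a _ F le_rfl⟩
  have h2 := Finset.prod_ne_zero_iff.1 (right_ne_zero_of_mul h) F hF
  intro h3
  apply h2
  have h4 := congrArg (Polynomial.evalRingHom t) h3
  rw [MvPolynomial.eval, MvPolynomial.coe_eval₂Hom, MvPolynomial.hom_eval₂] at h4
  rw [ev, MvPolynomial.coe_eval₂Hom]
  simpa [Function.comp_def] using h4

lemma exists_fin_roots (q : Polynomial ℂ) (d : ℕ) (hd : q.natDegree = d) :
    ∃ a : Fin d → ℂ, ∀ z, q.eval z = q.leadingCoeff * ∏ j, (z - a j) := by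
  have hs := IsAlgClosed.splits q
  have hlen : q.roots.toList.length = d := by
    rw [Multiset.length_toList, ← hd, hs.natDegree_eq_card_roots]
  obtain ⟨l, hl⟩ : ∃ l : List ℂ, l = q.roots.toList := ⟨_, rfl⟩
  have hl' : q.roots = (l : Multiset ℂ) := by rw [hl, Multiset.coe_toList]
  rw [← hl] at hlen
  subst hlen
  refine ⟨fun j => l.get j, fun z => ?_⟩
  conv_lhs => rw [hs.eq_prod_roots]
  rw [Polynomial.eval_mul, Polynomial.eval_C]
  congr 1
  rw [hl', Multiset.map_coe, Multiset.prod_coe, Polynomial.eval_list_prod,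
    List.map_map, ← List.prod_ofFn]
  congr 1
  apply List.ext_get
  · simp
  · intro n h1 h2
    simp

lemma root_bound (q : Polynomial ℂ) (d : ℕ) (hd : q.natDegree = d) (hq : q ≠ 0) (a : ℂ)
    (ha : q.eval a = 0) :
    ‖a‖ ≤ 1 + ∑ i ∈ Finset.range d, ‖q.coeff i‖ / ‖q.coeff d‖ := by
  have h := Polynomial.IsRoot.norm_lt_cauchyBound hq (a := a) ha
  rw [Polynomial.cauchyBound, hd, Polynomial.leadingCoeff, hd] at h
  have h2 : (Finset.range d).sup (fun x => ‖q.coeff x‖₊) ≤ ∑ i ∈ Finset.range d, ‖q.coeff i‖₊ := by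
    refine Finset.sup_le fun i hi => ?_
    exact Finset.single_le_sum (f := fun i => ‖q.coeff i‖₊) (fun _ _ => zero_le) hi
  have h3 : ‖a‖₊ ≤ (∑ i ∈ Finset.range d, ‖q.coeff i‖₊) / ‖q.coeff d‖₊ + 1 := by
    refine h.le.trans ?_
    gcongr
  have h4 : ‖a‖ ≤ (∑ i ∈ Finset.range d, ‖q.coeff i‖) / ‖q.coeff d‖ + 1 := by
    have := NNReal.coe_le_coe.2 h3
    simpa using this
  rw [Finset.sum_div] at h4
  linarith

lemma prod_close {ι : Type*} (s : Finset ι) (a b : ι → ℂ) (θ : ℝ) (hθ : 0 ≤ θ)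
    (h : ∀ i ∈ s, ‖b i - a i‖ ≤ θ * ‖a i‖) :
    ‖∏ i ∈ s, b i - ∏ i ∈ s, a i‖ ≤ ((1 + θ) ^ s.card - 1) * ‖∏ i ∈ s, a i‖ := by
  classical
  induction s using Finset.induction_on with
  | empty => simp
  | insert j s hj ih =>
    have ih := ih fun i hi => h i (Finset.mem_insert_of_mem hi)
    have hj' := h j (Finset.mem_insert_self _ _)
    rw [Finset.prod_insert hj, Finset.prod_insert hj, Finset.card_insert_of_notMem hj]
    set A := ∏ i ∈ s, a i
    set B := ∏ i ∈ s, b i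
    have e : b j * B - a j * A = b j * (B - A) + (b j - a j) * A := by ring
    have hb : ‖b j‖ ≤ (1 + θ) * ‖a j‖ := by
      have := norm_add_le (b j - a j) (a j)
      rw [sub_add_cancel] at this
      linarith
    have hpos : 1 ≤ (1 + θ) ^ s.card := one_le_pow₀ (by linarith)
    calc ‖b j * B - a j * A‖ ≤ ‖b j‖ * ‖B - A‖ + ‖b j - a j‖ * ‖A‖ := by
          rw [e, ← norm_mul, ← norm_mul]; exact norm_add_le _ _
      _ ≤ ((1 + θ) * ‖a j‖) * (((1 + θ) ^ s.card - 1) * ‖A‖) + (θ * ‖a j‖) * ‖A‖ := by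
          gcongr
      _ = ((1 + θ) ^ (s.card + 1) - 1) * ‖a j * A‖ := by
          rw [norm_mul]; ring

lemma scale_close (c c0 u v : ℂ) (κ δ : ℝ) (hc0 : c0 ≠ 0) (hc : c ≠ 0) (hκ : 0 < κ) (hκ3 : κ ≤ 1/3)
    (hδ : 5 * κ ≤ δ) (h1 : ‖c0 / c - 1‖ ≤ κ) (h2 : ‖c * v - c0 * u‖ ≤ κ * (‖c * v‖ + ‖c0 * u‖)) :
    ‖v - u‖ ≤ δ * ‖u‖ := by
  obtain ⟨w, hw⟩ : ∃ w, c * v = c0 * w := ⟨c * v / c0, by field_simp⟩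
  have hv : v = (c0 / c) * w := by field_simp; rw [← hw]; ring
  rw [hw, ← mul_sub, norm_mul, norm_mul, norm_mul] at h2
  have hp : 0 < ‖c0‖ := norm_pos_iff.2 hc0
  have h3 : ‖w - u‖ ≤ κ * (‖w‖ + ‖u‖) := by
    have : ‖c0‖ * ‖w - u‖ ≤ ‖c0‖ * (κ * (‖w‖ + ‖u‖)) := by linarith
    exact le_of_mul_le_mul_left this hp
  have h4 : ‖w‖ ≤ ‖u‖ + ‖w - u‖ := by
    have := norm_add_le u (w - u)
    rwa [add_sub_cancel] at this
  have hwn := norm_nonneg w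
  have hun := norm_nonneg u
  have h5 : ‖w‖ ≤ 2 * ‖u‖ := by nlinarith
  have h6 : ‖v - w‖ ≤ κ * ‖w‖ := by
    have : v - w = (c0 / c - 1) * w := by rw [hv]; ring
    rw [this, norm_mul]; gcongr
  have h7 : ‖v - u‖ ≤ ‖v - w‖ + ‖w - u‖ := norm_sub_le_norm_sub_add_norm_sub v w u
  nlinarith

lemma coeff_prod_big {ι : Type*} [Fintype ι] (u : ι → ℂ) (e : ℕ) (he : Fintype.card ι < e) :
    (∏ i, (Polynomial.X - Polynomial.C (u i))).coeff e = 0 := by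
  refine Polynomial.coeff_eq_zero_of_natDegree_lt ?_
  rw [Polynomial.natDegree_prod_of_monic _ _ (fun i _ => Polynomial.monic_X_sub_C _)]
  simpa using he

lemma map_eval_continuous {k : ℕ} (p : Polynomial (MvPolynomial (Fin k) (Polynomial ℂ))) :
    Continuous fun y : (ℂ × (Fin k → ℂ)) × ℂ => (p.map (ev y.1.1 y.1.2)).eval y.2 := by
  simp only [Polynomial.eval_map, Polynomial.eval₂_eq_sum_range]
  refine continuous_finsetSum _ fun i _ => ?_
  exact ((ev_continuous _).comp continuous_fst).mul (by fun_prop)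

/-- local triviality of a family of parametrized functions over `ball t₀ r` -/
def TrivOn {N X : Type*} [TopologicalSpace X] (E : N → ℂ → X → ℂ) (t₀ : ℂ) (ε r : ℝ) : Prop :=
  ∃ h g : Metric.ball t₀ r → X → X,
    (Continuous fun p : Metric.ball t₀ r × X => h p.1 p.2) ∧
    (Continuous fun p : Metric.ball t₀ r × X => g p.1 p.2) ∧
    (∀ t x, g t (h t x) = x) ∧ (∀ t x, h t (g t x) = x) ∧
    (∀ (t : Metric.ball t₀ r) x, (t : ℂ) = t₀ → h t x = x) ∧
    ∀ m (t : Metric.ball t₀ r) x, ‖E m t (h t x) - E m t₀ x‖ ≤ ε * ‖E m t₀ x‖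

lemma TrivOn.shrink {N X : Type*} [TopologicalSpace X] {E : N → ℂ → X → ℂ} {t₀ : ℂ} {ε r : ℝ}
    (H : TrivOn E t₀ ε r) (r' : ℝ) (hr : r' ≤ r) : TrivOn E t₀ ε r' := by
  obtain ⟨h, g, h1, h2, h3, h4, h5, h6⟩ := H
  let i : Metric.ball t₀ r' → Metric.ball t₀ r := Set.inclusion (Metric.ball_subset_ball hr)
  have hi : Continuous i := continuous_inclusion _
  refine ⟨fun t => h (i t), fun t => g (i t), ?_, ?_, fun t => h3 _, fun t => h4 _,
    fun t x ht => h5 (i t) x ht, fun m t x => h6 m (i t) x⟩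
  · exact h1.comp ((hi.comp continuous_fst).prodMk continuous_snd)
  · exact h2.comp ((hi.comp continuous_fst).prodMk continuous_snd)

/-- generic local triviality -/
def GenTriv {N X : Type*} [TopologicalSpace X] (E : N → ℂ → X → ℂ) : Prop :=
  ∃ b : Polynomial ℂ, b ≠ 0 ∧ ∀ t₀, b.eval t₀ ≠ 0 → ∀ ε > 0, ∃ r > 0, TrivOn E t₀ ε r

lemma map_natDegree {k : ℕ} (p : Polynomial (MvPolynomial (Fin k) (Polynomial ℂ))) (d : ℕ)
    (c : Polynomial ℂ) (hdeg : p.natDegree ≤ d) (hco : p.coeff d = MvPolynomial.C c) (t : ℂ)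
    (x : Fin k → ℂ) (ht : c.eval t ≠ 0) :
    (p.map (ev t x)).natDegree = d ∧ (p.map (ev t x)).coeff d = c.eval t := by
  have h2 : (p.map (ev t x)).coeff d = c.eval t := by rw [Polynomial.coeff_map, hco, ev_C]
  refine ⟨le_antisymm (Polynomial.natDegree_map_le.trans hdeg) ?_, h2⟩
  exact Polynomial.le_natDegree_of_ne_zero (by rw [h2]; exact ht)

lemma exists_small (P D : ℕ) (ε : ℝ) (hε : 0 < ε) : ∃ η : ℝ, 0 < η ∧ η ≤ 1/4 ∧
    (1 + 4 * η) ^ P < 2 ∧ (1 + 2 * η) ^ (D + 1) - 1 ≤ ε := by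
  have h1 : Tendsto (fun η : ℝ => (1 + 4 * η) ^ P) (𝓝 0) (𝓝 1) := by
    have : Continuous (fun η : ℝ => (1 + 4 * η) ^ P) := by fun_prop
    simpa using this.tendsto 0
  have h2 : Tendsto (fun η : ℝ => (1 + 2 * η) ^ (D + 1) - 1) (𝓝 0) (𝓝 0) := by
    have : Continuous (fun η : ℝ => (1 + 2 * η) ^ (D + 1) - 1) := by fun_prop
    simpa using this.tendsto 0
  have e1 := h1.eventually (gt_mem_nhds (show (1:ℝ) < 2 by norm_num))
  have e2 := h2.eventually (gt_mem_nhds hε)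
  have e3 : ∀ᶠ η : ℝ in 𝓝 0, η < 1/4 := gt_mem_nhds (by norm_num)
  obtain ⟨η, ⟨⟨h1, h2⟩, h3⟩, h4⟩ := ((((e1.and e2).and e3).filter_mono
    (nhdsWithin_le_nhds (s := Set.Ioi 0))).and self_mem_nhdsWithin).exists
  exact ⟨η, h4, h3.le, h1, h2.le⟩

lemma core_step {k : ℕ}
    (IH : ∀ S : Finset (MvPolynomial (Fin k) (Polynomial ℂ)),
      GenTriv (fun (F : S) t (x : Fin k → ℂ) => ev t x F.1))
    {M : Type} [Fintype M] (d : M → ℕ) (c : M → Polynomial ℂ)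
    (p : M → Polynomial (MvPolynomial (Fin k) (Polynomial ℂ)))
    (hc : ∀ m, c m ≠ 0) (hdeg : ∀ m, (p m).natDegree ≤ d m)
    (hco : ∀ m, (p m).coeff (d m) = MvPolynomial.C (c m)) (hpos : ∃ m, 0 < d m) :
    GenTriv (fun (m : M) t (y : ℂ × (Fin k → ℂ)) => ((p m).map (ev t y.2)).eval y.1) := by
  classical
  obtain ⟨m₀, hm₀⟩ := hpos
  haveI : Nonempty (Idx d) := ⟨⟨m₀, ⟨0, hm₀⟩⟩⟩
  set N := Fintype.card (Idx d × Idx d) with hN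
  have hNpos : 0 < N := Fintype.card_pos
  set cc : Polynomial ℂ := ∏ m, c m with hcc
  choose g hg using exists_disc (k := k) (σ := Idx d) cc (∏ m, p m)
  obtain ⟨b', hb', hIH⟩ := IH ((Finset.range (N+1)).image g)
  have hcc0 : cc ≠ 0 := Finset.prod_ne_zero_iff.2 fun m _ => hc m
  refine ⟨b' * cc, mul_ne_zero hb' hcc0, fun t₀ ht₀ ε hε => ?_⟩
  rw [Polynomial.eval_mul] at ht₀
  have hbt := left_ne_zero_of_mul ht₀
  have hct := right_ne_zero_of_mul ht₀
  have hcm : ∀ m, (c m).eval t₀ ≠ 0 := by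
    intro m
    rw [hcc, Polynomial.eval_prod] at hct
    exact Finset.prod_ne_zero_iff.1 hct m (Finset.mem_univ _)
  obtain ⟨η, hη, hη4, hηP, hηε⟩ := exists_small (Fintype.card (Equiv.Perm (Idx d))) (∑ m, d m) ε hε
  obtain ⟨δ, hδ, hδη⟩ : ∃ δ : ℝ, 0 < δ ∧ 8 * δ * (N + 1) < η := by
    refine ⟨η / (16 * (N + 1)), by positivity, ?_⟩
    have : (0:ℝ) < N + 1 := by positivity
    field_simp
    norm_num
  have hδ2 : δ ≤ 1/2 := by
    have : (0:ℝ) ≤ N := by positivity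
    nlinarith
  obtain ⟨κ, hκ, hκδ⟩ : ∃ κ : ℝ, 0 < κ ∧ 5 * κ = δ := ⟨δ/5, by positivity, by ring⟩
  have hκ3 : κ ≤ 1/3 := by linarith
  obtain ⟨r₁, hr₁, hT⟩ := hIH t₀ hbt (κ ^ N) (by positivity)
  -- shrink the radius
  have hev : ∀ᶠ t in 𝓝 t₀, cc.eval t ≠ 0 ∧ ‖cc.eval t₀ / cc.eval t - 1‖ ≤ κ ∧
      ∀ m, ‖(c m).eval t - (c m).eval t₀‖ ≤ (2 * η) * ‖(c m).eval t₀‖ := by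
    have e1 : ∀ᶠ t in 𝓝 t₀, cc.eval t ≠ 0 := cc.continuous.continuousAt.eventually_ne hct
    have e2 : ∀ᶠ t in 𝓝 t₀, ‖cc.eval t₀ / cc.eval t - 1‖ < κ := by
      have : ContinuousAt (fun t => ‖cc.eval t₀ / cc.eval t - 1‖) t₀ :=
        ((continuousAt_const.div cc.continuous.continuousAt hct).sub continuousAt_const).norm
      refine this.eventually_lt continuousAt_const ?_
      simpa [div_self hct] using hκ
    have e3 : ∀ m, ∀ᶠ t in 𝓝 t₀, ‖(c m).eval t - (c m).eval t₀‖ < (2 * η) * ‖(c m).eval t₀‖ := by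
      intro m
      have : ContinuousAt (fun t => ‖(c m).eval t - (c m).eval t₀‖) t₀ :=
        ((c m).continuous.continuousAt.sub continuousAt_const).norm
      refine this.eventually_lt continuousAt_const ?_
      have := norm_pos_iff.2 (hcm m)
      simp only [sub_self, norm_zero]
      positivity
    filter_upwards [e1, e2, eventually_all.2 e3] with t h1 h2 h3
    exact ⟨h1, h2.le, fun m => (h3 m).le⟩
  obtain ⟨r₂, hr₂, hball⟩ := Metric.eventually_nhds_iff_ball.1 hev
  refine ⟨min r₁ r₂, lt_min hr₁ hr₂, ?_⟩
  set r := min r₁ r₂ with hr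
  have hrpos : 0 < r := lt_min hr₁ hr₂
  obtain ⟨h, g', hh, hg', hgh, hhg, h0, hE⟩ := hT.shrink r (min_le_left _ _)
  have hball' : ∀ t : Metric.ball t₀ r, _ := fun t =>
    hball t.1 (Metric.ball_subset_ball (min_le_right _ _) t.2)
  have hcmt : ∀ m (t : Metric.ball t₀ r), (c m).eval t.1 ≠ 0 := by
    intro m t
    have := (hball' t).1
    rw [hcc, Polynomial.eval_prod] at this
    exact Finset.prod_ne_zero_iff.1 this m (Finset.mem_univ _)
  haveI : PreconnectedSpace (Metric.ball t₀ r) :=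
    Subtype.preconnectedSpace (convex_ball t₀ r).isPreconnected
  let tt : Metric.ball t₀ r := ⟨t₀, Metric.mem_ball_self hrpos⟩
  let F : M → Metric.ball t₀ r × (Fin k → ℂ) → ℂ → ℂ := fun m y z =>
    ((p m).map (ev y.1.1 y.2)).eval z
  let cf : M → Metric.ball t₀ r × (Fin k → ℂ) → ℂ := fun m y => (c m).eval y.1.1
  have hval : Continuous fun y : Metric.ball t₀ r × (Fin k → ℂ) => ((y.1.1, y.2) : ℂ × (Fin k → ℂ)) :=
    (continuous_subtype_val.comp continuous_fst).prodMk continuous_snd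
  have hF : ∀ m z, Continuous fun y => F m y z := by
    intro m z
    exact (map_eval_continuous (p m)).comp (hval.prodMk continuous_const)
  have hcf : ∀ m, Continuous (cf m) := by
    intro m
    exact (c m).continuous.comp (continuous_subtype_val.comp continuous_fst)
  have hcf0 : ∀ m t, cf m t ≠ 0 := fun m y => hcmt m y.1
  have hnd := fun m (y : Metric.ball t₀ r × (Fin k → ℂ)) =>
    map_natDegree (p m) (d m) (c m) (hdeg m) (hco m) y.1.1 y.2 (hcmt m y.1)
  have hlab : ∀ y, ∃ α : Idx d → ℂ, IsLab F cf y α := by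
    intro y
    choose a ha using fun m => exists_fin_roots _ _ (hnd m y).1
    refine ⟨fun i => a i.1 i.2, fun m z => ?_⟩
    have := ha m z
    rw [Polynomial.leadingCoeff, (hnd m y).1, (hnd m y).2] at this
    exact this
  let C : Metric.ball t₀ r × (Fin k → ℂ) → ℝ := fun y => ∑ m, (1 + ∑ i ∈ Finset.range (d m),
    ‖ev y.1.1 y.2 ((p m).coeff i)‖ / ‖(c m).eval y.1.1‖)
  have hC : Continuous C := by
    refine continuous_finsetSum _ fun m _ => continuous_const.add
      (continuous_finsetSum _ fun i _ => ?_)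
    refine Continuous.div ?_ (hcf m).norm fun y => norm_ne_zero_iff.2 (hcf0 m y)
    exact ((ev_continuous _).comp hval).norm
  have hCm : ∀ y m, (1 + ∑ i ∈ Finset.range (d m),
    ‖ev y.1.1 y.2 ((p m).coeff i)‖ / ‖(c m).eval y.1.1‖) ≤ C y := fun y m =>
    Finset.single_le_sum (f := fun m => (1 + ∑ i ∈ Finset.range (d m),
      ‖ev y.1.1 y.2 ((p m).coeff i)‖ / ‖(c m).eval y.1.1‖)) (fun m _ => by positivity)
      (Finset.mem_univ m)
  have hb : ∀ y (α : Idx d → ℂ), IsLab F cf y α → ‖α‖ ≤ C y := by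
    intro y α hα
    refine (pi_norm_le_iff_of_nonempty _).2 fun i => ?_
    refine le_trans ?_ (hCm y i.1)
    have hne : (p i.1).map (ev y.1.1 y.2) ≠ 0 := by
      intro h0
      have := (hnd i.1 y).2
      rw [h0] at this
      exact hcmt i.1 y.1 (by simpa using this.symm)
    have := root_bound _ _ (hnd i.1 y).1 hne (α i) (by
      have := hα i.1 (α i)
      refine this.trans ?_
      rw [Finset.prod_eq_zero (Finset.mem_univ i.2) (by simp), mul_zero])
    rw [(hnd i.1 y).2] at this
    simpa [Polynomial.coeff_map] using this
  have hprod : ∀ y (α : Idx d → ℂ), IsLab F cf y α → ∀ z,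
      ((∏ m, p m).map (ev y.1.1 y.2)).eval z = cc.eval y.1.1 * ∏ i, (z - α i) := by
    intro y α hα z
    rw [Polynomial.map_prod, Polynomial.eval_prod, hcc, Polynomial.eval_prod, Fintype.prod_sigma,
      ← Finset.prod_mul_distrib]
    exact Finset.prod_congr rfl fun m _ => hα m z
  have hcoef : ∀ t x (α β : Idx d → ℂ), IsLab F cf (tt, x) α → IsLab F cf (t, h t x) β → ∀ e,
      ‖(∏ q : Idx d × Idx d, (Polynomial.X - Polynomial.C
        (cc.eval t.1 * β q.1 - cc.eval t.1 * β q.2))).coeff e -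
       (∏ q : Idx d × Idx d, (Polynomial.X - Polynomial.C
        (cc.eval t₀ * α q.1 - cc.eval t₀ * α q.2))).coeff e‖ ≤ κ ^ N *
      ‖(∏ q : Idx d × Idx d, (Polynomial.X - Polynomial.C
        (cc.eval t₀ * α q.1 - cc.eval t₀ * α q.2))).coeff e‖ := by
    intro t x α β hα hβ e
    by_cases he : e < N + 1
    · have h1 := hE ⟨g e, Finset.mem_image_of_mem _ (Finset.mem_range.2 he)⟩ t x
      have h2 := hg e t₀ x α (hprod (tt, x) α hα)
      have h3 := hg e t.1 (h t x) β (hprod (t, h t x) β hβ)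
      simp only at h1
      rw [h2, h3] at h1
      exact h1
    · rw [coeff_prod_big _ e (by omega), coeff_prod_big _ e (by omega)]
      simp
  have hκN : κ ^ N < 1 := pow_lt_one₀ hκ.le (by linarith) hNpos.ne'
  have hclose : ∀ t x (α β : Idx d → ℂ), IsLab F cf (tt, x) α → IsLab F cf (t, h t x) β →
      ∀ i j, ∃ k l, ‖(β i - β j) - (α k - α l)‖ ≤ δ * ‖α k - α l‖ := by
    intro t x α β hα hβ i j
    obtain ⟨q, hq⟩ := root_close (fun q : Idx d × Idx d => cc.eval t₀ * α q.1 - cc.eval t₀ * α q.2)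
      (fun q : Idx d × Idx d => cc.eval t.1 * β q.1 - cc.eval t.1 * β q.2) κ hκ
      (hcoef t x α β hα hβ) (i, j)
    refine ⟨q.1, q.2, ?_⟩
    simp only [← mul_sub] at hq
    exact scale_close (cc.eval t.1) (cc.eval t₀) _ _ κ δ hct (hball' t).1 hκ hκ3 hκδ.le
      (hball' t).2.1 hq
  have hcard : ∀ t x (α β : Idx d → ℂ), IsLab F cf (tt, x) α → IsLab F cf (t, h t x) β →
      (Finset.univ.filter fun p : Idx d × Idx d => β p.1 - β p.2 = 0).card
      = (Finset.univ.filter fun p : Idx d × Idx d => α p.1 - α p.2 = 0).card := by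
    intro t x α β hα hβ
    have h1 := zero_count_eq (fun q : Idx d × Idx d => cc.eval t₀ * α q.1 - cc.eval t₀ * α q.2)
      (fun q : Idx d × Idx d => cc.eval t.1 * β q.1 - cc.eval t.1 * β q.2) (fun e => by
        have h2 := hcoef t x α β hα hβ e
        constructor
        · intro h3
          rw [h3, zero_sub, norm_neg] at h2
          rw [← norm_eq_zero]
          nlinarith [norm_nonneg ((∏ q : Idx d × Idx d, (Polynomial.X - Polynomial.C
            (cc.eval t₀ * α q.1 - cc.eval t₀ * α q.2))).coeff e)]
        · intro h3
          rw [h3, sub_zero, norm_zero, mul_zero] at h2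
          exact norm_le_zero_iff.1 h2)
    simp only [← mul_sub, mul_eq_zero, hct, (hball' t).1, false_or] at h1
    exact h1
  obtain ⟨G, hG, hGL, hG0, hGlab⟩ := core_lift F cf hF hcf hcf0 hlab C hC hb h hh tt
    (fun x => h0 tt x rfl) η δ hη (by linarith) hδ.le hδ2 hηP hδη hclose hcard
  obtain ⟨inv, hinv, hi1, hi2⟩ := fiber_homeo G hG (fun y z w => (hGL y z w).trans (by
    gcongr; linarith))
  have cA : Continuous fun q : Metric.ball t₀ r × (ℂ × (Fin k → ℂ)) => (q.1, q.2.2) := by fun_prop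
  refine ⟨fun t y => (y.1 + G (t, y.2) y.1, h t y.2), fun t y => (inv (t, g' t y.2) y.1, g' t y.2),
    ?_, ?_, ?_, ?_, ?_, ?_⟩
  · refine Continuous.prodMk (Continuous.add (by fun_prop) ?_) (hh.comp cA)
    exact hG.comp (cA.prodMk (by fun_prop : Continuous fun q : Metric.ball t₀ r × (ℂ × (Fin k → ℂ)) => q.2.1))
  · refine Continuous.prodMk ?_ (hg'.comp cA)
    exact hinv.comp ((continuous_fst.prodMk (hg'.comp cA)).prodMk
      (by fun_prop : Continuous fun q : Metric.ball t₀ r × (ℂ × (Fin k → ℂ)) => q.2.1))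
  · rintro t ⟨z, x⟩
    simp only [hgh, hi1]
  · rintro t ⟨z, x⟩
    simp only [hhg, hi2]
  · rintro t ⟨z, x⟩ ht
    have : t = tt := Subtype.ext ht
    subst this
    simp only [hG0, add_zero, h0 tt x rfl]
  · rintro m t ⟨z, x⟩
    obtain ⟨α, β, hα, hβ, hαβ⟩ := hGlab t x
    have e1 := hα m z
    have e2 := hβ m (z + G (t, x) z)
    simp only [F, cf] at e1 e2
    simp only
    change ‖_ - ((p m).map (ev (tt : ℂ) x)).eval z‖ ≤ ε * ‖((p m).map (ev (tt : ℂ) x)).eval z‖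
    rw [e1, e2]
    have h3 := prod_close Finset.univ
      (fun o : Option (Fin (d m)) => o.elim ((c m).eval t₀) fun j => z - α ⟨m, j⟩)
      (fun o : Option (Fin (d m)) => o.elim ((c m).eval t.1) fun j => z + G (t, x) z - β ⟨m, j⟩)
      (2 * η) (by linarith) (by
        rintro (_ | j) _
        · exact (hball' t).2.2 m
        · exact hαβ ⟨m, j⟩ z)
    rw [Fintype.prod_option, Fintype.prod_option] at h3
    simp only [Option.elim, Finset.card_univ, Fintype.card_option, Fintype.card_fin] at h3
    refine h3.trans ?_
    refine mul_le_mul_of_nonneg_right (le_trans ?_ hηε) (norm_nonneg _)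
    have : d m ≤ ∑ m, d m := Finset.single_le_sum (fun _ _ => Nat.zero_le _) (Finset.mem_univ m)
    gcongr
    linarith

lemma GenTriv.transfer {N N' X Y : Type*} [TopologicalSpace X] [TopologicalSpace Y]
    {E : N → ℂ → X → ℂ} (H : GenTriv E) (θ : X ≃ₜ Y) (E' : N' → ℂ → Y → ℂ)
    (hE : ∀ n', (∃ n, ∀ t x, E' n' t (θ x) = E n t x) ∨ ∀ t x, E' n' t x = 0) : GenTriv E' := by
  obtain ⟨b, hb, H⟩ := H
  refine ⟨b, hb, fun t₀ ht₀ ε hε => ?_⟩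
  obtain ⟨r, hr, h, g, h1, h2, h3, h4, h5, h6⟩ := H t₀ ht₀ ε hε
  refine ⟨r, hr, fun t y => θ (h t (θ.symm y)), fun t y => θ (g t (θ.symm y)), ?_, ?_, ?_, ?_, ?_, ?_⟩
  · exact θ.continuous.comp (h1.comp (continuous_fst.prodMk (θ.symm.continuous.comp continuous_snd)))
  · exact θ.continuous.comp (h2.comp (continuous_fst.prodMk (θ.symm.continuous.comp continuous_snd)))
  · intro t x; simp [h3]
  · intro t x; simp [h4]
  · intro t x ht; simp [h5 t _ ht]
  · intro m t y
    rcases hE m with ⟨n, hn⟩ | h0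
    · obtain ⟨x, rfl⟩ := θ.surjective y
      simp only [Homeomorph.symm_apply_apply, hn]
      exact h6 n t x
    · simp [h0]

lemma base_case (S : Finset (MvPolynomial (Fin 0) (Polynomial ℂ))) :
    GenTriv (fun (F : S) t (x : Fin 0 → ℂ) => ev t x F.1) := by
  classical
  have hev : ∀ (F : MvPolynomial (Fin 0) (Polynomial ℂ)) t x, ev t x F = (F.coeff 0).eval t := by
    intro F t x
    conv_lhs => rw [F.eq_C_of_isEmpty]
    rw [ev_C]
  refine ⟨∏ F ∈ S.erase 0, F.coeff 0, ?_, fun t₀ ht₀ ε hε => ?_⟩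
  · refine Finset.prod_ne_zero_iff.2 fun F hF h => (Finset.mem_erase.1 hF).1 ?_
    rw [F.eq_C_of_isEmpty, h, map_zero]
  · have hev2 : ∀ᶠ t in 𝓝 t₀, ∀ F : S, ‖(F.1.coeff 0).eval t - (F.1.coeff 0).eval t₀‖ ≤
        ε * ‖(F.1.coeff 0).eval t₀‖ := by
      refine eventually_all.2 fun F => ?_
      by_cases h0 : F.1 = 0
      · simp [h0]
      · have h1 : (F.1.coeff 0).eval t₀ ≠ 0 := by
          rw [Polynomial.eval_prod] at ht₀
          exact Finset.prod_ne_zero_iff.1 ht₀ F.1 (Finset.mem_erase.2 ⟨h0, F.2⟩)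
        have : ContinuousAt (fun t => ‖(F.1.coeff 0).eval t - (F.1.coeff 0).eval t₀‖) t₀ :=
          ((F.1.coeff 0).continuous.continuousAt.sub continuousAt_const).norm
        refine (this.eventually_lt continuousAt_const ?_).mono fun t ht => le_of_lt ht
        have := norm_pos_iff.2 h1
        simp only [sub_self, norm_zero]
        positivity
    obtain ⟨r, hr, hball⟩ := Metric.eventually_nhds_iff_ball.1 hev2
    refine ⟨r, hr, fun _ x => x, fun _ x => x, continuous_snd, continuous_snd, fun _ _ => rfl,
      fun _ _ => rfl, fun _ _ _ => rfl, fun F t x => ?_⟩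
    simp only [hev]
    exact hball t.1 t.2 F

/-- the linear change of coordinates as a homeomorphism -/
noncomputable def shearHomeo {k : ℕ} (a : Fin (k+1) → ℂ) (ha : a 0 ≠ 0) :
    (ℂ × (Fin k → ℂ)) ≃ₜ (Fin (k+1) → ℂ) where
  toFun y := shearPt a y.1 y.2
  invFun x := (x 0 / a 0, fun i => x i.succ - a i.succ * (x 0 / a 0))
  left_inv := by
    rintro ⟨z, x⟩
    simp [shearPt, ha]
  right_inv := by
    intro x
    funext i
    refine Fin.cases ?_ (fun j => ?_) i
    · simp only [shearPt, Fin.cons_zero]; field_simp; ring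
    · simp [shearPt]
  continuous_toFun := by
    refine continuous_pi fun i => ?_
    refine Fin.cases ?_ (fun j => ?_) i
    · simp only [shearPt, Fin.cons_zero]; fun_prop
    · simp only [shearPt, Fin.cons_succ]; fun_prop
  continuous_invFun := by fun_prop

theorem gen_triv (k : ℕ) : ∀ S : Finset (MvPolynomial (Fin k) (Polynomial ℂ)),
    GenTriv (fun (F : S) t (x : Fin k → ℂ) => ev t x F.1) := by
  classical
  induction k with
  | zero => exact base_case
  | succ k IH =>
    intro S
    set S' := insert (MvPolynomial.X 0) (S.erase 0) with hS'
    have hne : ∀ F ∈ S', F ≠ 0 := by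
      intro F hF
      rcases Finset.mem_insert.1 hF with rfl | hF
      · exact MvPolynomial.X_ne_zero _
      · exact (Finset.mem_erase.1 hF).1
    obtain ⟨a, ha, hS⟩ := exists_shear S' hne
    choose d c hc hdeg hco using fun F : S' => hS F.1 F.2
    have hX : MvPolynomial.X 0 ∈ S' := Finset.mem_insert_self _ _
    have hpos : ∃ m, 0 < d m := by
      refine ⟨⟨_, hX⟩, ?_⟩
      refine lt_of_lt_of_le ?_ (hdeg ⟨_, hX⟩)
      refine lt_of_lt_of_le Nat.one_pos (Polynomial.le_natDegree_of_ne_zero ?_)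
      simp only [shear, MvPolynomial.coe_eval₂Hom, MvPolynomial.eval₂_X]
      simpa using ha
    have := core_step IH d c (fun F : S' => shear a F.1) hc hdeg hco hpos
    refine this.transfer (shearHomeo a ha) _ ?_
    intro F
    by_cases h0 : F.1 = 0
    · right
      intro t x
      simp [h0]
    · left
      refine ⟨⟨F.1, Finset.mem_insert_of_mem (Finset.mem_erase.2 ⟨h0, F.2⟩)⟩, fun t x => ?_⟩
      simp only [ev_shear]
      rfl

/-- For every `n ≥ 1` and every polynomial map `f : ℂⁿ → ℂ` (the evaluation of a
multivariate polynomial), there exists a finite subset `B ⊆ ℂ` admissible for `f`,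
i.e. `f` is a locally trivial fibration over `ℂ \ B`. -/
theorem exists_admissible_set (n : ℕ) (hn : 1 ≤ n) (P : MvPolynomial (Fin n) ℂ) :
    ∃ B : Set ℂ, Admissible (fun x => MvPolynomial.eval x P) B := by
  classical
  let Q : MvPolynomial (Fin n) (Polynomial ℂ) :=
    MvPolynomial.map Polynomial.C P - MvPolynomial.C Polynomial.X
  have hQ : ∀ t x, ev t x Q = MvPolynomial.eval x P - t := by
    intro t x
    simp only [Q, map_sub, ev_C, Polynomial.eval_X]
    congr 1
    rw [ev, MvPolynomial.coe_eval₂Hom, MvPolynomial.eval₂_map]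
    have : (Polynomial.evalRingHom t).comp Polynomial.C = RingHom.id ℂ := by ext <;> simp
    rw [this]
    rfl
  obtain ⟨b, hb, H⟩ := gen_triv n {Q}
  have hBfin : {t : ℂ | b.eval t = 0}.Finite := by
    refine (b.roots.toFinset.finite_toSet).subset fun t ht => ?_
    simpa [hb] using ht
  refine ⟨{t | b.eval t = 0}, hBfin, fun y hy => ?_⟩
  obtain ⟨r₁, hr₁, hT⟩ := H y hy (1/2) (by norm_num)
  have hopen : IsOpen {t : ℂ | b.eval t = 0}ᶜ := hBfin.isClosed.isOpen_compl
  obtain ⟨r₂, hr₂, hball⟩ := Metric.isOpen_iff.1 hopen y hy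
  set r := min r₁ r₂ with hr
  have hrpos : 0 < r := lt_min hr₁ hr₂
  obtain ⟨h, g, h1, h2, h3, h4, h5, h6⟩ := hT.shrink r (min_le_left _ _)
  have hiff : ∀ (t : Metric.ball y r) x, MvPolynomial.eval (h t x) P = t ↔ MvPolynomial.eval x P = y := by
    intro t x
    have := h6 ⟨Q, Finset.mem_singleton_self _⟩ t x
    simp only [hQ] at this
    constructor
    · intro he
      rw [he, sub_self, zero_sub, norm_neg] at this
      have h7 : ‖MvPolynomial.eval x P - y‖ = 0 := by
        linarith [norm_nonneg (MvPolynomial.eval x P - y)]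
      exact sub_eq_zero.1 (norm_eq_zero.1 h7)
    · intro he
      rw [he, sub_self, sub_zero, norm_zero, mul_zero] at this
      exact sub_eq_zero.1 (norm_le_zero_iff.1 this)
  have hcont : Continuous fun x : Fin n → ℂ => MvPolynomial.eval x P := MvPolynomial.continuous_eval P
  refine ⟨Metric.ball y r, Metric.isOpen_ball, Metric.mem_ball_self hrpos,
    (Metric.ball_subset_ball (min_le_right _ _)).trans hball, ?_⟩
  let φ : ((fun x : Fin n → ℂ => MvPolynomial.eval x P) ⁻¹' (Metric.ball y r)) ≃ₜ
      (Metric.ball y r × ((fun x : Fin n → ℂ => MvPolynomial.eval x P) ⁻¹' {y})) :=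
    { toFun := fun x => (⟨MvPolynomial.eval x.1 P, x.2⟩, ⟨g ⟨MvPolynomial.eval x.1 P, x.2⟩ x.1, by
        have := hiff ⟨MvPolynomial.eval x.1 P, x.2⟩ (g ⟨MvPolynomial.eval x.1 P, x.2⟩ x.1)
        rw [h4] at this
        exact this.1 rfl⟩)
      invFun := fun p => ⟨h p.1 p.2.1, by
        have := (hiff p.1 p.2.1).2 p.2.2
        change MvPolynomial.eval (h p.1 p.2.1) P ∈ Metric.ball y r
        rw [this]
        exact p.1.2⟩
      left_inv := fun x => Subtype.ext (h4 _ _)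
      right_inv := by
        rintro ⟨t, x, hx⟩
        have h8 := (hiff t x).2 hx
        have h9 : ∀ hm, (⟨MvPolynomial.eval (h t x) P, hm⟩ : Metric.ball y r) = t :=
          fun hm => Subtype.ext h8
        refine Prod.ext (h9 _) (Subtype.ext ?_)
        simp only [h9, h3]
      continuous_toFun := by
        have c1 : Continuous fun x : ((fun x : Fin n → ℂ => MvPolynomial.eval x P) ⁻¹' (Metric.ball y r)) =>
            (⟨MvPolynomial.eval x.1 P, x.2⟩ : Metric.ball y r) :=
          (hcont.comp continuous_subtype_val).subtype_mk _
        exact c1.prodMk ((h2.comp (c1.prodMk continuous_subtype_val)).subtype_mk _)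
      continuous_invFun := by
        exact (h1.comp (continuous_fst.prodMk (continuous_subtype_val.comp continuous_snd))).subtype_mk _ }
  exact ⟨φ, fun x => rfl⟩
end

section
/- Let n ≥ 1 and let f : ℂⁿ → ℂ be the evaluation map of a multivariate polynomial with complex coefficients. Then there exists a smallest admissible finite set: a finite subset B_f ⊆ ℂ that is admissible for f and satisfies B_f ⊆ B for every finite subset B ⊆ ℂ that is admissible for f. -/
open Polynomial
theorem fsmooth (κ : Type*) [Field κ] [Algebra ℂ κ] [Algebra ℂ[X] κ] (hi : Function.Injective (algebraMap ℂ[X] κ)) : Algebra.FormallySmooth ℂ[X] κ := by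
  have : FaithfulSMul ℂ[X] κ := (faithfulSMul_iff_algebraMap_injective _ _).2 hi
  let := FractionRing.liftAlgebra ℂ[X] κ
  have : IsScalarTower ℂ[X] (FractionRing ℂ[X]) κ := FractionRing.isScalarTower_liftAlgebra _ _
  have : Algebra.FormallySmooth ℂ[X] (FractionRing ℂ[X]) := Algebra.FormallySmooth.of_isLocalization (nonZeroDivisors ℂ[X])
  obtain ⟨s, hs⟩ := exists_isTranscendenceBasis (FractionRing ℂ[X]) κ
  have : Algebra.IsAlgebraic (IntermediateField.adjoin (FractionRing ℂ[X]) (Set.range ((↑) : s → κ))) κ := hs.isAlgebraic_field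
  have : CharZero (FractionRing ℂ[X]) := charZero_of_injective_algebraMap (R := ℂ) (RingHom.injective _)
  have : Algebra.FormallySmooth (FractionRing ℂ[X]) κ := Algebra.FormallySmooth.of_algebraicIndependent_of_isSeparable hs.1
  exact Algebra.FormallySmooth.comp ℂ[X] (FractionRing ℂ[X]) κ

theorem lift_hom {κ : Type*} [Field κ] [Algebra ℂ κ] (t : κ) (ht : ∀ q : ℂ[X], q ≠ 0 → aeval t q ≠ 0)
    {B : Type*} [CommRing B] [Algebra ℂ B] (π : B →ₐ[ℂ] κ) (hπ : Function.Surjective π)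
    (hn : IsNilpotent (RingHom.ker (π : B →+* κ))) (b : B) (hb : π b = t) :
    ∃ σ : κ →ₐ[ℂ] B, (∀ a, π (σ a) = a) ∧ σ t = b := by
  let i1 : Algebra ℂ[X] κ := (aeval t : ℂ[X] →ₐ[ℂ] κ).toRingHom.toAlgebra
  let i2 : Algebra ℂ[X] B := (aeval b : ℂ[X] →ₐ[ℂ] B).toRingHom.toAlgebra
  have h1 : ∀ p : ℂ[X], algebraMap ℂ[X] κ p = aeval t p := fun p => rfl
  have h2 : ∀ p : ℂ[X], algebraMap ℂ[X] B p = aeval b p := fun p => rfl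
  have : Algebra.FormallySmooth ℂ[X] κ := fsmooth κ (by
    rw [injective_iff_map_eq_zero]
    intro p hp
    by_contra h
    exact ht p h hp)
  let π' : B →ₐ[ℂ[X]] κ := { (π : B →+* κ) with
    commutes' := fun p => by
      change π (algebraMap ℂ[X] B p) = _
      rw [h1, h2, ← hb, Polynomial.aeval_algHom_apply] }
  let σ := Algebra.FormallySmooth.liftOfSurjective (AlgHom.id ℂ[X] κ) π' hπ hn
  have hσ : ∀ a, π (σ a) = a := fun a => Algebra.FormallySmooth.liftOfSurjective_apply (AlgHom.id ℂ[X] κ) π' hπ hn a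
  have hc : ∀ p : ℂ[X], σ (aeval t p) = aeval b p := fun p => σ.commutes p
  refine ⟨{ (σ : κ →+* B) with commutes' := fun c => ?_ }, hσ, ?_⟩
  · simpa using hc (C c)
  · simpa using hc X

theorem exists_deriv {κ : Type*} [Field κ] [Algebra ℂ κ] (t : κ) (ht : ∀ q : ℂ[X], q ≠ 0 → aeval t q ≠ 0) :
    ∃ D : Derivation ℂ κ κ, D t = 1 := by
  obtain ⟨σ, h1, h2⟩ := lift_hom t ht (B := TrivSqZeroExt κ κ) (TrivSqZeroExt.fstHom ℂ κ κ)
    (fun a => ⟨TrivSqZeroExt.inl a, rfl⟩) ⟨2, by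
      rw [pow_two, Ideal.zero_eq_bot, eq_bot_iff, Ideal.mul_le]
      intro x hx y hy
      have hx : x.fst = 0 := hx
      have hy : y.fst = 0 := hy
      rw [Ideal.mem_bot]
      ext <;> simp [hx, hy]⟩ (TrivSqZeroExt.inl t + TrivSqZeroExt.inr 1) (by simp)
  have h1 : ∀ a, (σ a).fst = a := h1
  refine ⟨Derivation.mk' ((TrivSqZeroExt.sndHom κ κ).restrictScalars ℂ ∘ₗ σ.toLinearMap) ?_, ?_⟩
  · intro a b
    simp [h1, mul_comm]
  · simp [h2]

theorem exists_deriv_W {κ : Type*} [Field κ] [Algebra ℂ κ] {W : Type*} [CommRing W] [Algebra ℂ W]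
    (π : W →ₐ[ℂ] κ) (hπ : Function.Surjective π) (s : W) (hker : ∀ w, π w = 0 ↔ s ∣ w)
    (N : ℕ) (hN : s ^ N = 0) (hN' : ∀ j, j < N → s ^ j ≠ 0) (F : W)
    (hF : ∀ q : ℂ[X], q ≠ 0 → aeval (π F) q ≠ 0) :
    ∃ D : Derivation ℂ W W, D s = 0 ∧ D F = 1 := by
  have hunit : ∀ w : W, π w ≠ 0 → IsUnit w := by
    intro w hw
    obtain ⟨w', hw'⟩ := hπ (π w)⁻¹
    have : s ∣ w * w' - 1 := by
      rw [← hker]; simp [hw', hw]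
    obtain ⟨z, hz⟩ := this
    have hnil : IsNilpotent (s * z) := ⟨N, by rw [mul_pow, hN, zero_mul]⟩
    have : IsUnit (w * w') := by
      have h : w * w' = 1 + s * z := by rw [← hz]; ring
      rw [h]
      exact hnil.isUnit_one_add
    exact isUnit_of_mul_isUnit_left this
  have hnilk : IsNilpotent (RingHom.ker (π : W →+* κ)) := by
    refine ⟨N, ?_⟩
    have : RingHom.ker (π : W →+* κ) = Ideal.span {s} := by
      ext w
      rw [Ideal.mem_span_singleton, ← hker]; rfl
    rw [this, Ideal.span_singleton_pow, hN]
    simp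
  obtain ⟨σ, h1, h2⟩ := lift_hom (π F) hF π hπ hnilk F rfl
  obtain ⟨d, hd⟩ := exists_deriv (π F) hF
  let d' : Derivation ℂ κ[X] κ[X] := PolynomialModule.equivPolynomialSelf.compDer d.mapCoeffs
  have hd'X : d' X = 0 := by
    change PolynomialModule.equivPolynomialSelf (d.mapCoeffs X) = 0
    simp
  have hd'C : ∀ a, d' (C a) = C (d a) := by
    intro a
    change PolynomialModule.equivPolynomialSelf (d.mapCoeffs (C a)) = _
    simp
  let Ψ : κ[X] →ₐ[ℂ] W := { eval₂RingHom (σ : κ →+* W) s with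
    commutes' := fun c => by
      change eval₂ (σ : κ →+* W) s (algebraMap ℂ κ[X] c) = _
      rw [Polynomial.algebraMap_apply, eval₂_C]
      simp }
  have hΨX : Ψ X = s := eval₂_X _ _
  have hΨC : ∀ a, Ψ (C a) = σ a := fun a => eval₂_C _ _
  have hsurj : Function.Surjective Ψ := by
    intro w
    have : ∀ j, ∃ p, s ^ j ∣ w - Ψ p := by
      intro j
      induction j with
      | zero => exact ⟨0, by simp⟩
      | succ j ih =>
        obtain ⟨p, z, hz⟩ := ih
        have : s ∣ z - σ (π z) := by rw [← hker]; simp [h1]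
        obtain ⟨y, hy⟩ := this
        refine ⟨p + X ^ j * C (π z), y, ?_⟩
        rw [map_add, map_mul, map_pow, hΨX, hΨC, ← sub_sub, hz, pow_succ, mul_assoc, ← hy]
        ring
    obtain ⟨p, hp⟩ := this N
    rw [hN, zero_dvd_iff] at hp
    exact ⟨p, (sub_eq_zero.1 hp).symm⟩
  have hπΨ : ∀ p, π (Ψ p) = p.coeff 0 := by
    intro p
    conv_lhs => rw [← Polynomial.divX_mul_X_add p]
    rw [map_add, map_mul, hΨX, hΨC, map_add, h1, (hker _).2 (dvd_mul_left _ _), zero_add]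
  have hk : ∀ p, Ψ p = 0 → Ψ (d' p) = 0 := by
    intro p hp
    by_cases hp0 : p = 0
    · simp [hp0]
    obtain ⟨p', hp', hnd⟩ := Polynomial.exists_eq_pow_rootMultiplicity_mul_and_not_dvd p hp0 0
    rw [C_0, sub_zero] at hp' hnd
    set j := rootMultiplicity 0 p
    have hu : IsUnit (Ψ p') := by
      apply hunit
      rw [hπΨ]
      rwa [X_dvd_iff] at hnd
    have hj : N ≤ j := by
      by_contra hlt
      push Not at hlt
      apply hN' j hlt
      rw [hp', map_mul, map_pow, hΨX] at hp
      exact (hu.mul_left_eq_zero).1 hp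
    have hsj : s ^ j = 0 := by rw [← Nat.sub_add_cancel hj, pow_add, hN, mul_zero]
    rw [hp', Derivation.leibniz, Derivation.leibniz_pow, hd'X]
    simp [hΨX, hsj]
  refine ⟨Derivation.liftOfSurjective hsurj hk, ?_, ?_⟩
  · conv_lhs => rw [← hΨX]
    rw [Derivation.liftOfSurjective_apply, hd'X, map_zero]
  · conv_lhs => rw [← h2, ← hΨC]
    rw [Derivation.liftOfSurjective_apply, hd'C, hd, hΨC, map_one]

theorem clear_denoms {V K : Type*} [CommRing V] [Field K] [Algebra V K]
    [Algebra ℂ V] [Algebra ℂ K] [IsScalarTower ℂ V K]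
    {n : ℕ} (x : Fin n → K) (s : V) (a : ℕ) (u : Fin n → V)
    (hu : ∀ i, algebraMap V K (u i) = algebraMap V K s ^ a * x i) (P : MvPolynomial (Fin n) ℂ) :
    ∃ e0, ∀ e, e0 ≤ e → ∃ (Q : V) (Q' : Fin n → V),
      algebraMap V K Q = algebraMap V K s ^ e * MvPolynomial.aeval x P ∧
      (∀ i, algebraMap V K (Q' i) = algebraMap V K s ^ e * MvPolynomial.aeval x (MvPolynomial.pderiv i P)) ∧
      ∀ (N : ℕ) (D : Derivation ℂ V (V ⧸ Ideal.span {s ^ N})), D s = 0 →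
        s ^ a • D Q = ∑ i, Q' i • D (u i) := by
  induction P using MvPolynomial.induction_on with
  | C c =>
    refine ⟨0, fun e _ => ⟨s ^ e * algebraMap ℂ V c, 0, ?_, ?_, ?_⟩⟩
    · simp [← IsScalarTower.algebraMap_apply]
    · simp
    · intro N D hD
      simp [Derivation.leibniz_pow, hD]
  | add p q hp hq =>
    obtain ⟨e1, h1⟩ := hp
    obtain ⟨e2, h2⟩ := hq
    refine ⟨max e1 e2, fun e he => ?_⟩
    obtain ⟨Q1, Q1', h1a, h1b, h1c⟩ := h1 e (le_trans (le_max_left _ _) he)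
    obtain ⟨Q2, Q2', h2a, h2b, h2c⟩ := h2 e (le_trans (le_max_right _ _) he)
    refine ⟨Q1 + Q2, Q1' + Q2', ?_, ?_, ?_⟩
    · rw [map_add, h1a, h2a, map_add, mul_add]
    · intro i
      rw [Pi.add_apply, map_add, h1b, h2b, map_add, map_add, mul_add]
    · intro N D hD
      rw [map_add, smul_add, h1c N D hD, h2c N D hD, ← Finset.sum_add_distrib]
      simp [add_smul]
  | mul_X p j hp =>
    obtain ⟨e1, h1⟩ := hp
    refine ⟨e1 + a, fun e he => ?_⟩
    obtain ⟨Q, Q', ha, hb, hc⟩ := h1 (e - a) (by omega)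
    have hea : algebraMap V K s ^ e = algebraMap V K s ^ (e - a) * algebraMap V K s ^ a := by
      rw [← pow_add]; congr 1; omega
    refine ⟨Q * u j, fun i => Q' i * u j + if i = j then s ^ a * Q else 0, ?_, ?_, ?_⟩
    · rw [map_mul, ha, hu, hea, map_mul, MvPolynomial.aeval_X]; ring
    · intro i
      rw [map_add, map_mul, hb, hu, hea, Derivation.leibniz, MvPolynomial.pderiv_X]
      by_cases hij : i = j
      · subst hij
        simp [ha]; ring
      · simp [hij, Pi.single_apply, Ne.symm hij]; ring
    · intro N D hD
      have : ∀ i, (Q' i * u j + if i = j then s ^ a * Q else 0) • D (u i) =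
          u j • (Q' i • D (u i)) + if i = j then (s ^ a * Q) • D (u j) else 0 := by
        intro i
        by_cases hij : i = j
        · subst hij
          simp [add_smul, smul_smul, mul_comm]
        · simp [hij, smul_smul, mul_comm]
      rw [Finset.sum_congr rfl (fun i _ => this i), Finset.sum_add_distrib, ← Finset.smul_sum, ← hc N D hD]
      simp [smul_smul, mul_comm]
      rw [add_comm]

theorem dvr_contra {V K : Type*} [CommRing V] [IsDomain V] [IsDiscreteValuationRing V] [Field K] [Algebra V K]
    [IsFractionRing V K]
    [Algebra ℂ V] [Algebra ℂ K] [IsScalarTower ℂ V K]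
    {n : ℕ} (x : Fin n → K) (P : MvPolynomial (Fin n) ℂ) (F : V)
    (hFx : algebraMap V K F = MvPolynomial.aeval x P)
    (hF : ∀ q : ℂ[X], q ≠ 0 → IsUnit (aeval F q))
    (hg : ∀ i, ∃ g ∈ IsLocalRing.maximalIdeal V,
      algebraMap V K g = x i * MvPolynomial.aeval x (MvPolynomial.pderiv i P)) : False := by
  obtain ⟨s, hs⟩ := IsDiscreteValuationRing.exists_irreducible V
  have hinj : Function.Injective (algebraMap V K) := IsFractionRing.injective V K
  have hsm : ∀ g ∈ IsLocalRing.maximalIdeal V, s ∣ g := by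
    intro g hgm
    rw [hs.maximalIdeal_eq] at hgm
    exact Ideal.mem_span_singleton.1 hgm
  have hden : ∀ i, ∃ b : ℕ, ∃ w : V, algebraMap V K w = algebraMap V K s ^ b * x i := by
    intro i
    obtain ⟨p, q, hq, hpq⟩ := IsFractionRing.div_surjective (A := V) (x i)
    have hq0 : q ≠ 0 := nonZeroDivisors.ne_zero hq
    obtain ⟨b, v, hv⟩ := IsDiscreteValuationRing.eq_unit_mul_pow_irreducible hq0 hs
    refine ⟨b, ↑v⁻¹ * p, ?_⟩
    have hq0' : algebraMap V K q ≠ 0 := by simpa using hq0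
    have h2 : s ^ b * p = q * (↑v⁻¹ * p) := by
      rw [hv]
      calc s ^ b * p = (↑v * ↑v⁻¹) * (s ^ b * p) := by simp
        _ = _ := by ring
    have h3 := congrArg (algebraMap V K) h2
    rw [map_mul, map_mul, map_pow] at h3
    rw [← hpq, mul_div_assoc', h3, mul_div_cancel_left₀ _ hq0']
  choose b w hbw using hden
  let a := ∑ i, b i
  have hu : ∀ i, ∃ u : V, algebraMap V K u = algebraMap V K s ^ a * x i := by
    intro i
    refine ⟨s ^ (a - b i) * w i, ?_⟩
    have : b i ≤ a := Finset.single_le_sum (f := b) (fun _ _ => Nat.zero_le _) (Finset.mem_univ i)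
    rw [map_mul, hbw, map_pow, ← mul_assoc, ← pow_add, Nat.sub_add_cancel this]
  choose u hu using hu
  obtain ⟨e, he⟩ := clear_denoms x s a u hu P
  obtain ⟨Q, Q', hQ, hQ', hD⟩ := he e le_rfl
  have hQF : Q = s ^ e * F := by
    apply hinj
    rw [hQ, map_mul, map_pow, hFx]
  let N := a + e + 1
  have hle : Ideal.span {s ^ N} ≤ Ideal.span {s} := by
    rw [Ideal.span_singleton_le_span_singleton]
    exact dvd_pow_self s (Nat.succ_ne_zero _)
  have hmax : (Ideal.span {s}).IsMaximal := by
    rw [← hs.maximalIdeal_eq]; infer_instance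
  let _ : Field (V ⧸ Ideal.span {s}) := Ideal.Quotient.field _
  obtain ⟨D, hDs, hDF⟩ := exists_deriv_W (κ := V ⧸ Ideal.span {s}) (W := V ⧸ Ideal.span {s ^ N})
    (Ideal.Quotient.factorₐ ℂ hle) (Ideal.Quotient.factor_surjective hle) (Ideal.Quotient.mk _ s)
    (by
      intro w
      obtain ⟨v, rfl⟩ := Ideal.Quotient.mk_surjective w
      change Ideal.Quotient.mk _ v = 0 ↔ _
      rw [Ideal.Quotient.eq_zero_iff_mem, Ideal.mem_span_singleton]
      constructor
      · rintro ⟨z, rfl⟩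
        rw [map_mul]; exact dvd_mul_right _ _
      · rintro ⟨z, hz⟩
        obtain ⟨z, rfl⟩ := Ideal.Quotient.mk_surjective z
        rw [← map_mul, Ideal.Quotient.eq, Ideal.mem_span_singleton] at hz
        have := (dvd_pow_self s (Nat.succ_ne_zero (a + e))).trans hz
        rwa [dvd_sub_left (dvd_mul_right _ _)] at this) N
    (by rw [← map_pow, Ideal.Quotient.eq_zero_iff_mem]; exact Ideal.mem_span_singleton_self _)
    (by
      intro j hj h
      rw [← map_pow, Ideal.Quotient.eq_zero_iff_mem, Ideal.mem_span_singleton,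
        pow_dvd_pow_iff hs.ne_zero hs.not_isUnit] at h
      omega) (Ideal.Quotient.mk _ F) (by
      intro q hq
      change aeval (algebraMap V (V ⧸ Ideal.span {s}) F) q ≠ 0
      rw [aeval_algebraMap_apply]
      exact ((hF q hq).map _).ne_zero)
  let D1 : Derivation ℂ V (V ⧸ Ideal.span {s ^ N}) := D.compAlgebraMap V
  have hD1s : D1 s = 0 := hDs
  have hD1F : D1 F = 1 := hDF
  have hz : ∀ i, Q' i • D1 (u i) = 0 := by
    intro i
    by_cases hui : u i = 0
    · rw [hui, map_zero, smul_zero]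
    obtain ⟨c, v, hv⟩ := IsDiscreteValuationRing.eq_unit_mul_pow_irreducible hui hs
    obtain ⟨g, hgm, hgx⟩ := hg i
    obtain ⟨g', rfl⟩ := hsm g hgm
    have h1 : Q' i * u i = s ^ N * g' := by
      apply hinj
      rw [map_mul, hQ', hu, map_mul, map_pow]
      rw [map_mul] at hgx
      calc _ = algebraMap V K s ^ (a + e) * (x i * MvPolynomial.aeval x (MvPolynomial.pderiv i P)) := by
            rw [pow_add]; ring
        _ = _ := by rw [← hgx]; simp only [N, pow_succ]; ring
    have h2 : Q' i * s ^ c = s ^ N * (g' * ↑v⁻¹) := by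
      rw [← mul_assoc, ← h1, hv]
      calc Q' i * s ^ c = Q' i * s ^ c * (↑v * ↑v⁻¹) := by simp
        _ = _ := by ring
    rw [hv, Derivation.leibniz, Derivation.leibniz_pow, hD1s, smul_zero, smul_zero, smul_zero, zero_add,
      smul_smul, h2, ← smul_smul]
    rw [Algebra.smul_def]
    have : algebraMap V (V ⧸ Ideal.span {s ^ N}) (s ^ N) = 0 :=
      Ideal.Quotient.eq_zero_iff_mem.2 (Ideal.mem_span_singleton_self _)
    rw [this, zero_mul]
  have hfin := hD N D1 hD1s
  rw [Finset.sum_eq_zero (fun i _ => hz i), hQF, Derivation.leibniz, Derivation.leibniz_pow, hD1s, hD1F,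
    smul_zero, smul_zero, smul_zero, add_zero, smul_smul, Algebra.smul_def, mul_one, ← pow_add] at hfin
  have : s ^ N ∣ s ^ (a + e) := Ideal.mem_span_singleton.1 (Ideal.Quotient.eq_zero_iff_mem.1 hfin)
  rw [pow_dvd_pow_iff hs.ne_zero hs.not_isUnit] at this
  omega

theorem krull_dvr {C : Type*} [CommRing C] [IsDomain C] [IsNoetherianRing C] [IsIntegrallyClosed C]
    (g : C) (hg0 : g ≠ 0) (hgu : ¬ IsUnit g) :
    ∃ q : Ideal C, ∃ _ : q.IsPrime, g ∈ q ∧ IsDiscreteValuationRing (Localization.AtPrime q) := by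
  have hne : Ideal.span {g} ≠ ⊤ := by
    rwa [Ne, Ideal.span_singleton_eq_top]
  obtain ⟨q, hq⟩ := Ideal.nonempty_minimalPrimes hne
  have hqp : q.IsPrime := hq.1.1
  have hgq : g ∈ q := hq.1.2 (Ideal.mem_span_singleton_self g)
  have hh : q.height ≤ 1 := Ideal.height_le_one_of_isPrincipal_of_mem_minimalPrimes (Ideal.span {g}) q hq
  refine ⟨q, hqp, hgq, ?_⟩
  have hd := IsLocalization.AtPrime.ringKrullDim_eq_height q (Localization.AtPrime q)
  have : IsNoetherianRing (Localization.AtPrime q) :=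
    IsLocalization.isNoetherianRing q.primeCompl _ inferInstance
  have : IsIntegrallyClosed (Localization.AtPrime q) :=
    isIntegrallyClosed_of_isLocalization (R := C) _ q.primeCompl q.primeCompl_le_nonZeroDivisors
  have hdd : Ring.KrullDimLE 1 (Localization.AtPrime q) := by
    rw [Ring.krullDimLE_iff, hd]
    exact_mod_cast hh
  have hqb : q ≠ ⊥ := by
    rintro rfl
    exact hg0 (by simpa using hgq)
  have hnf : ¬ IsField (Localization.AtPrime q) := by
    exact IsLocalization.AtPrime.not_isField C hqb _
  have : Ring.DimensionLEOne (Localization.AtPrime q) := by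
    constructor
    intro p hp0 hp
    have := (Ring.krullDimLE_one_iff_of_isPrime_bot (R := Localization.AtPrime q)).1 hdd p hp0 hp
    exact this
  have : IsDedekindDomain (Localization.AtPrime q) := {}
  exact ((IsDiscreteValuationRing.TFAE _ hnf).out 0 2).2 this

theorem noeth_ic {k K : Type*} [Field k] [Field K] [CharZero K] [Algebra k K]
    (R' : Subalgebra k K) (hfg : R'.FG) [IsFractionRing R' K] :
    IsNoetherianRing (integralClosure R' K) := by
  have : Algebra.FiniteType k R' := R'.fg_iff_finiteType.1 hfg
  obtain ⟨s, g, hinj, hfin⟩ := exists_finite_inj_algHom_of_fg k R'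
  algebraize [g.toRingHom]
  set Z := MvPolynomial (Fin s) k
  let : Algebra Z K := ((algebraMap R' K).comp g.toRingHom).toAlgebra
  have : IsScalarTower Z R' K := IsScalarTower.of_algebraMap_eq (fun x => rfl)
  have hinjK : Function.Injective (algebraMap Z K) :=
    (FaithfulSMul.algebraMap_injective R' K).comp hinj
  have : FaithfulSMul Z K := (faithfulSMul_iff_algebraMap_injective Z K).2 hinjK
  have : FaithfulSMul Z R' := (faithfulSMul_iff_algebraMap_injective Z R').2 hinj
  let := FractionRing.liftAlgebra Z K
  let K0 := FractionRing Z
  have : IsScalarTower Z K0 K := FractionRing.isScalarTower_liftAlgebra Z K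
  have : Module.Finite Z R' := hfin
  have : FiniteDimensional K0 K := by
    have : Algebra.IsIntegral Z R' := inferInstance
    have : IsLocalization (Algebra.algebraMapSubmonoid R' (nonZeroDivisors Z)) K := by
      infer_instance
    exact Module.Finite.of_isLocalization Z R' (nonZeroDivisors Z)
  have : CharZero K0 := by
    have := (algebraMap K0 K).injective
    exact (algebraMap K0 K).charZero_iff this |>.2 inferInstance
  have : IsIntegralClosure (integralClosure R' K) Z K := by
    refine ⟨Subtype.val_injective, fun {x} => ⟨fun hx => ⟨⟨x, ?_⟩, rfl⟩, ?_⟩⟩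
    · exact hx.tower_top
    · rintro ⟨y, rfl⟩
      exact isIntegral_trans (R := Z) (A := R') _ y.2
  exact IsIntegralClosure.isNoetherianRing Z K0 K (integralClosure R' K)

theorem exists_dvr {k K ι : Type*} [Field k] [Field K] [CharZero K] [Algebra k K] [Finite ι]
    (g : ι → K) (hne : ∃ l, g l ≠ 0)
    (hfrac : ∀ z : K, ∃ a ∈ Algebra.adjoin k (Set.range g), ∃ b ∈ Algebra.adjoin k (Set.range g),
      z = a / b)
    (hJ : Ideal.span (Set.range fun l =>
      (⟨g l, Algebra.subset_adjoin ⟨l, rfl⟩⟩ : Algebra.adjoin k (Set.range g))) ≠ ⊤) :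
    ∃ V : Subalgebra k K, IsDiscreteValuationRing V ∧ IsFractionRing V K ∧
      ∀ l, ∃ v : V, ¬ IsUnit v ∧ (v : K) = g l := by
  obtain ⟨V0, hV1, hV2⟩ := Ideal.image_subset_nonunits_valuationSubring
    (A := (Algebra.adjoin k (Set.range g)).toSubring) _ hJ
  have hgV : ∀ l, V0.valuation (g l) < 1 := by
    intro l
    have : g l ∈ V0.nonunits := hV2 ⟨_, Ideal.subset_span ⟨l, rfl⟩, rfl⟩
    exact this
  have hkV : ∀ c : k, algebraMap k K c ∈ V0 := fun c => hV1 (Subalgebra.algebraMap_mem _ c)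
  have : Nonempty ι := ⟨hne.choose⟩
  obtain ⟨l0, hl0⟩ := Finite.exists_max (fun l => V0.valuation (g l))
  have hg0 : g l0 ≠ 0 := by
    intro h0
    obtain ⟨l, hl⟩ := hne
    have := hl0 l
    rw [h0, map_zero, le_zero_iff, map_eq_zero] at this
    exact hl this
  let R' : Subalgebra k K := Algebra.adjoin k ({g l0} ∪ Set.range (fun l => g l / g l0))
  have h0R : g l0 ∈ R' := Algebra.subset_adjoin (Or.inl rfl)
  have hlR : ∀ l, g l / g l0 ∈ R' := fun l => Algebra.subset_adjoin (Or.inr ⟨l, rfl⟩)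
  have hgR : ∀ l, g l ∈ R' := fun l => by
    have := R'.mul_mem (hlR l) h0R
    rwa [div_mul_cancel₀ _ hg0] at this
  have hfg : R'.FG := by
    refine Subalgebra.fg_def.2 ⟨_, ?_, rfl⟩
    exact (Set.finite_singleton _).union (Set.finite_range _)
  have hle : Algebra.adjoin k (Set.range g) ≤ R' := by
    apply Algebra.adjoin_le
    rintro _ ⟨l, rfl⟩
    exact hgR l
  have : IsFractionRing R' K := by
    refine IsFractionRing.of_field R' K fun z ↦ ?_
    obtain ⟨a, ha, b, hb, h⟩ := hfrac z
    exact ⟨⟨a, hle ha⟩, ⟨b, hle hb⟩, h⟩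
  have hR'V : ∀ z ∈ R', z ∈ V0 := by
    intro z hz
    induction hz using Algebra.adjoin_induction with
    | mem x hx =>
      rcases hx with hx | ⟨l, rfl⟩
      · rw [Set.mem_singleton_iff.1 hx]
        exact (V0.valuation_le_one_iff _).1 (hgV l0).le
      · rw [← V0.valuation_le_one_iff, map_div₀]
        exact div_le_one_of_le₀ (hl0 l) zero_le
    | algebraMap r => exact hkV r
    | add x y _ _ hx hy => exact add_mem hx hy
    | mul x y _ _ hx hy => exact mul_mem hx hy
  let C := integralClosure R' K
  have : IsNoetherianRing C := noeth_ic R' hfg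
  have : IsIntegrallyClosed C := integralClosure.isIntegrallyClosedOfFiniteExtension K
  have hCV : ∀ z ∈ C, z ∈ V0 := by
    intro z hz
    let φ : R' →+* V0 := R'.toSubring.subtype.codRestrict V0.toSubring (fun z => hR'V z z.2)
    let : Algebra R' V0 := φ.toAlgebra
    have : IsScalarTower R' V0 K := IsScalarTower.of_algebraMap_eq (fun x => rfl)
    have hz' : IsIntegral V0 z := IsIntegral.tower_top (R := R') hz
    obtain ⟨y, hy⟩ := (IsIntegrallyClosed.isIntegral_iff (R := V0) (K := K)).1 hz'
    rw [← hy]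
    exact y.2
  have hRC : ∀ z ∈ R', z ∈ C := fun z hz => C.algebraMap_mem (⟨z, hz⟩ : R')
  let g0 : C := ⟨g l0, hRC _ h0R⟩
  have hg0u : ¬ IsUnit g0 := by
    intro hu
    obtain ⟨b, hb⟩ := hu.exists_right_inv
    have hb' : g l0 * (b : K) = 1 := congrArg Subtype.val hb
    have h1 := (V0.valuation_le_one_iff _).2 (hCV b b.2)
    have h2 := congrArg V0.valuation hb'
    rw [map_mul, map_one] at h2
    have : V0.valuation (g l0) * V0.valuation (b : K) < 1 :=
      mul_lt_one_of_lt_of_le (hgV l0) h1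
    exact this.ne h2
  obtain ⟨q, hq, hgq, hdvr⟩ := krull_dvr g0 (fun h => hg0 (congrArg Subtype.val h)) hg0u
  let V1 : Subalgebra C K := Localization.subalgebra.ofField K q.primeCompl
    q.primeCompl_le_nonZeroDivisors
  have : IsLocalization q.primeCompl V1 := inferInstance
  let e : Localization.AtPrime q ≃ₐ[C] V1 := IsLocalization.algEquiv q.primeCompl _ _
  have hV1 : IsDiscreteValuationRing V1 :=
    IsDiscreteValuationRing.RingEquivClass.isDiscreteValuationRing e
  let V : Subalgebra k K :=
    { V1.toSubring with algebraMap_mem' := fun c =>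
        V1.algebraMap_mem (⟨algebraMap k K c, hRC _ (R'.algebraMap_mem c)⟩ : C) }
  have hVf : IsFractionRing V1 K := inferInstance
  refine ⟨V, hV1, hVf, fun l => ?_⟩
  let v1 : V1 := algebraMap C V1 (⟨g l / g l0, hRC _ (hlR l)⟩ * g0)
  refine ⟨v1, ?_, div_mul_cancel₀ _ hg0⟩
  intro hu
  have hu1 : IsUnit v1 := hu
  rw [IsLocalization.AtPrime.isUnit_to_map_iff V1 q] at hu1
  exact hu1 (q.mul_mem_left _ hgq)
noncomputable def gen {n : ℕ} (P : MvPolynomial (Fin n) ℂ) (l : Fin n × Option (Fin n)) :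
    MvPolynomial (Fin n) ℂ :=
  l.2.elim 1 MvPolynomial.X * MvPolynomial.pderiv l.1 P

theorem exists_pderiv_ne_zero {n : ℕ} (P : MvPolynomial (Fin n) ℂ)
    (hP : ∀ q : ℂ[X], q ≠ 0 → aeval P q ≠ 0) : ∃ i, MvPolynomial.pderiv i P ≠ 0 := by
  by_contra! h
  have hc : P = MvPolynomial.C (P.coeff 0) := by
    ext m
    rw [MvPolynomial.coeff_C]
    split_ifs with hm
    · rw [hm]
    · have : ∃ i, m i ≠ 0 := by
        by_contra! h'
        exact hm (by ext i; simp [h'])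
      obtain ⟨i, hi⟩ := this
      have h1 := congrArg (MvPolynomial.coeff (m - Finsupp.single i 1)) (h i)
      rw [MvPolynomial.coeff_pderiv] at h1
      have h2 : m - Finsupp.single i 1 + Finsupp.single i 1 = m := by
        ext j
        by_cases hj : i = j
        · subst hj
          simp
          omega
        · simp [Finsupp.single_apply, hj]
      rw [h2] at h1
      simp only [MvPolynomial.coeff_zero, mul_eq_zero] at h1
      rcases h1 with h1 | h1
      · exact h1
      · exfalso
        norm_cast at h1
  apply hP (X - C (P.coeff 0)) (X_sub_C_ne_zero _)
  rw [map_sub, aeval_X, aeval_C, sub_eq_zero]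
  exact hc

theorem clear_k {n : ℕ} (P : MvPolynomial (Fin n) ℂ)
    (r : FractionRing (MvPolynomial (Fin n) ℂ))
    (hr : r ∈ Algebra.adjoin (IntermediateField.adjoin ℂ
      {algebraMap _ (FractionRing (MvPolynomial (Fin n) ℂ)) P})
      (Set.range fun l => algebraMap _ (FractionRing (MvPolynomial (Fin n) ℂ)) (gen P l))) :
    ∃ q : ℂ[X], q ≠ 0 ∧ ∃ p ∈ Algebra.adjoin ℂ (insert P (Set.range (gen P))),
      algebraMap _ (FractionRing (MvPolynomial (Fin n) ℂ)) (aeval P q) * r =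
      algebraMap _ (FractionRing (MvPolynomial (Fin n) ℂ)) p := by
  have hq : ∀ q : ℂ[X], aeval P q ∈ Algebra.adjoin ℂ (insert P (Set.range (gen P))) := by
    intro q
    exact Algebra.adjoin_mono (Set.singleton_subset_iff.2 (Set.mem_insert P (Set.range (gen P)))) (aeval_mem_adjoin_singleton ℂ P)
  induction hr using Algebra.adjoin_induction with
  | mem x hx =>
    obtain ⟨l, rfl⟩ := hx
    exact ⟨1, one_ne_zero, gen P l, Algebra.subset_adjoin (Or.inr ⟨l, rfl⟩), by simp⟩
  | algebraMap c =>
    obtain ⟨a, b, hab⟩ := (IntermediateField.mem_adjoin_simple_iff ℂ (c : FractionRing (MvPolynomial (Fin n) ℂ))).1 c.2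
    have e1 : algebraMap _ (FractionRing (MvPolynomial (Fin n) ℂ)) (aeval P b) =
      aeval (algebraMap _ (FractionRing (MvPolynomial (Fin n) ℂ)) P) b := by
      rw [Polynomial.aeval_algebraMap_apply]
    have e2 : algebraMap _ (FractionRing (MvPolynomial (Fin n) ℂ)) (aeval P a) =
      aeval (algebraMap _ (FractionRing (MvPolynomial (Fin n) ℂ)) P) a := by
      rw [Polynomial.aeval_algebraMap_apply]
    by_cases hb : aeval (algebraMap _ (FractionRing (MvPolynomial (Fin n) ℂ)) P) b = 0
    · refine ⟨1, one_ne_zero, 0, zero_mem _, ?_⟩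
      rw [hb, div_zero] at hab
      have : c = 0 := Subtype.ext hab
      simp [this]
    · refine ⟨b, ?_, aeval P a, hq a, ?_⟩
      · rintro rfl
        simp at hb
      · change _ * (c : FractionRing (MvPolynomial (Fin n) ℂ)) = _
        rw [hab, e1, e2, mul_div_cancel₀ _ hb]
  | add x y _ _ hx hy =>
    obtain ⟨q1, h1, p1, hp1, e1⟩ := hx
    obtain ⟨q2, h2, p2, hp2, e2⟩ := hy
    refine ⟨q1 * q2, mul_ne_zero h1 h2, aeval P q2 * p1 + aeval P q1 * p2,
      add_mem (mul_mem (hq _) hp1) (mul_mem (hq _) hp2), ?_⟩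
    simp only [map_mul, map_add, ← e1, ← e2]
    ring
  | mul x y _ _ hx hy =>
    obtain ⟨q1, h1, p1, hp1, e1⟩ := hx
    obtain ⟨q2, h2, p2, hp2, e2⟩ := hy
    refine ⟨q1 * q2, mul_ne_zero h1 h2, p1 * p2, mul_mem hp1 hp2, ?_⟩
    simp only [map_mul, ← e1, ← e2]
    ring

theorem malgrange_alg {n : ℕ} (P : MvPolynomial (Fin n) ℂ) :
    ∃ q : ℂ[X], q ≠ 0 ∧ ∃ c : Fin n × Option (Fin n) → MvPolynomial (Fin n) ℂ,
      (∀ l, c l ∈ Algebra.adjoin ℂ (insert P (Set.range (gen P)))) ∧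
      aeval P q = ∑ l, gen P l * c l := by
  by_cases hP : ∀ q : ℂ[X], q ≠ 0 → aeval P q ≠ 0
  swap
  · push Not at hP
    obtain ⟨q, hq, h⟩ := hP
    exact ⟨q, hq, fun _ => 0, fun _ => zero_mem _, by simpa using h⟩
  obtain ⟨i0, hi0⟩ := exists_pderiv_ne_zero P hP
  let K := FractionRing (MvPolynomial (Fin n) ℂ)
  let k := IntermediateField.adjoin ℂ {algebraMap _ K P}
  let g : Fin n × Option (Fin n) → K := fun l => algebraMap _ K (gen P l)
  have hq : ∀ q : ℂ[X], aeval P q ∈ Algebra.adjoin ℂ (insert P (Set.range (gen P))) := by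
    intro q
    exact Algebra.adjoin_mono (Set.singleton_subset_iff.2 (Set.mem_insert P (Set.range (gen P)))) (aeval_mem_adjoin_singleton ℂ P)
  have hinj : Function.Injective (algebraMap (MvPolynomial (Fin n) ℂ) K) :=
    IsFractionRing.injective _ _
  by_cases hJ : Ideal.span (Set.range fun l =>
      (⟨g l, Algebra.subset_adjoin ⟨l, rfl⟩⟩ : Algebra.adjoin k (Set.range g))) = ⊤
  · have h1 := (Ideal.eq_top_iff_one _).1 hJ
    obtain ⟨c, hc⟩ := Ideal.mem_span_range_iff_exists_fun.1 h1
    have hc' : ∑ l, (c l : K) * g l = 1 := by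
      have := congrArg (Subalgebra.val _) hc
      simpa using this
    choose q hq0 p hp he using fun l => clear_k P (c l : K) (c l).2
    refine ⟨∏ l, q l, Finset.prod_ne_zero_iff.2 fun l _ => hq0 l,
      fun l => aeval P (∏ m ∈ Finset.univ.erase l, q m) * p l,
      fun l => mul_mem (hq _) (hp l), ?_⟩
    apply hinj
    rw [← mul_one (algebraMap (MvPolynomial (Fin n) ℂ) K (aeval P (∏ l, q l))), ← hc',
      Finset.mul_sum, map_sum]
    refine Finset.sum_congr rfl fun l _ => ?_
    rw [← Finset.mul_prod_erase _ _ (Finset.mem_univ l)]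
    have hel : algebraMap _ K (aeval P (q l)) * (c l : K) = algebraMap _ K (p l) := he l
    simp only [map_mul, g]
    rw [← hel]
    ring
  · exfalso
    have hne : ∃ l, g l ≠ 0 := by
      refine ⟨(i0, none), ?_⟩
      rw [Ne, map_eq_zero_iff _ hinj]
      simpa [gen] using hi0
    have hX : ∀ j, algebraMap (MvPolynomial (Fin n) ℂ) K (MvPolynomial.X j) ∈ IntermediateField.adjoin k (Set.range g) := by
      intro j
      have h1 : g (i0, some j) ∈ IntermediateField.adjoin k (Set.range g) :=
        IntermediateField.subset_adjoin _ _ ⟨_, rfl⟩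
      have h2 : g (i0, none) ∈ IntermediateField.adjoin k (Set.range g) :=
        IntermediateField.subset_adjoin _ _ ⟨_, rfl⟩
      have h3 := div_mem h1 h2
      convert! h3 using 1
      have : algebraMap (MvPolynomial (Fin n) ℂ) K (MvPolynomial.pderiv i0 P) ≠ 0 := by
        rwa [Ne, map_eq_zero_iff _ hinj]
      simp only [g, gen, Option.elim, map_mul, map_one]
      rw [one_mul]
      exact (mul_div_cancel_right₀ _ this).symm
    have hpoly : ∀ p : MvPolynomial (Fin n) ℂ,
        algebraMap _ K p ∈ IntermediateField.adjoin k (Set.range g) := by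
      intro p
      induction p using MvPolynomial.induction_on with
      | C a =>
        exact (IntermediateField.adjoin k (Set.range g)).algebraMap_mem (algebraMap ℂ k a)
      | add p q hp hq => rw [map_add]; exact add_mem hp hq
      | mul_X p i hp => rw [map_mul]; exact mul_mem hp (hX i)
    have hfrac : ∀ z : K, ∃ a ∈ Algebra.adjoin k (Set.range g), ∃ b ∈ Algebra.adjoin k (Set.range g),
      z = a / b := by
      intro z
      rw [← IntermediateField.mem_adjoin_iff_div]
      obtain ⟨a, b, _, rfl⟩ := IsFractionRing.div_surjective (MvPolynomial (Fin n) ℂ) z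
      exact div_mem (hpoly a) (hpoly b)
    obtain ⟨V, hV, hVK, hv⟩ := exists_dvr g hne hfrac hJ
    have hFk : algebraMap _ K P ∈ k := IntermediateField.mem_adjoin_simple_self ℂ _
    have : IsScalarTower ℂ V K := inferInstance
    have hF : ∀ q : ℂ[X], aeval (algebraMap k V ⟨_, hFk⟩) q =
        algebraMap k V (aeval ⟨_, hFk⟩ q) := by
      intro q
      rw [Polynomial.aeval_algebraMap_apply]
    have hxa : ∀ p : MvPolynomial (Fin n) ℂ,
        MvPolynomial.aeval (fun i => algebraMap (MvPolynomial (Fin n) ℂ) K (MvPolynomial.X i)) p = algebraMap _ K p := by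
      intro p
      have h1 := MvPolynomial.aeval_algebraMap_apply (R := ℂ) K (MvPolynomial.X : Fin n → MvPolynomial (Fin n) ℂ) p
      rw [MvPolynomial.aeval_X_left_apply] at h1
      exact h1
    refine dvr_contra (V := V) (K := K) (fun i => algebraMap (MvPolynomial (Fin n) ℂ) K (MvPolynomial.X i)) P
      (algebraMap k V ⟨_, hFk⟩) ?_ ?_ ?_
    · rw [hxa]
      rfl
    · intro q hq0
      rw [hF]
      apply IsUnit.map
      rw [isUnit_iff_ne_zero]
      intro h0
      have h1 := congrArg (algebraMap k K) h0
      rw [← Polynomial.aeval_algebraMap_apply, map_zero] at h1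
      have h2 : aeval (algebraMap _ K P) q = 0 := h1
      rw [Polynomial.aeval_algebraMap_apply, map_eq_zero_iff _ hinj] at h2
      exact hP q hq0 h2
    · intro i
      obtain ⟨v, hv1, hv2⟩ := hv (i, some i)
      refine ⟨v, (IsLocalRing.mem_maximalIdeal _).2 hv1, ?_⟩
      rw [hxa, ← map_mul]
      exact hv2

def IsSol {X : Type*} [NormedAddCommGroup X] [NormedSpace ℝ X] (H : X → X) (γ : ℝ → X) : Prop :=
  ∀ t ∈ Set.Icc (0 : ℝ) 1, HasDerivWithinAt γ (H (γ t)) (Set.Icc 0 1) t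

theorem sol_unique {X : Type*} [NormedAddCommGroup X] [NormedSpace ℝ X] [FiniteDimensional ℝ X]
    {H : X → X} (hH : ContDiff ℝ 1 H) {γ δ : ℝ → X} (hγ : IsSol H γ) (hδ : IsSol H δ)
    (h0 : γ 0 = δ 0) : γ 1 = δ 1 := by
  have : ProperSpace X := FiniteDimensional.proper ℝ X
  have cγ : ContinuousOn γ (Set.Icc 0 1) := fun t ht => (hγ t ht).continuousWithinAt
  have cδ : ContinuousOn δ (Set.Icc 0 1) := fun t ht => (hδ t ht).continuousWithinAt
  have hc : IsCompact (γ '' Set.Icc 0 1 ∪ δ '' Set.Icc 0 1) :=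
    (isCompact_Icc.image_of_continuousOn cγ).union (isCompact_Icc.image_of_continuousOn cδ)
  obtain ⟨R, hR⟩ := hc.isBounded.subset_closedBall (0 : X)
  obtain ⟨K, hK⟩ := (hH.contDiffOn (s := Metric.closedBall (0 : X) R)).exists_lipschitzOnWith
    one_ne_zero (convex_closedBall _ _) (isCompact_closedBall _ _)
  have hder : ∀ {γ : ℝ → X}, IsSol H γ → ∀ t ∈ Set.Ico (0 : ℝ) 1,
      HasDerivWithinAt γ (H (γ t)) (Set.Ici t) t := fun h t ht =>
    (h t (Set.Ico_subset_Icc_self ht)).mono_of_mem_nhdsWithin (Icc_mem_nhdsGE_of_mem ht)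
  exact ODE_solution_unique_of_mem_Icc_right (v := fun _ => H) (s := fun _ => Metric.closedBall 0 R)
    (K := K) (fun t _ => hK) cγ (hder hγ)
    (fun t ht => hR (Or.inl ⟨t, Set.Ico_subset_Icc_self ht, rfl⟩)) cδ (hder hδ)
    (fun t ht => hR (Or.inr ⟨t, Set.Ico_subset_Icc_self ht, rfl⟩)) h0
    (Set.right_mem_Icc.2 zero_le_one)

theorem flow_lemma {X : Type*} [NormedAddCommGroup X] [NormedSpace ℝ X] [FiniteDimensional ℝ X]
    {H : X → X} (hH : ContDiff ℝ 1 H) (hb : ∀ p, ‖H p‖ ≤ (1 + ‖p‖) / 4) :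
    ∃ γ : X → ℝ → X, (∀ p, γ p 0 = p) ∧ (∀ p, IsSol H (γ p)) ∧ Continuous (fun p => γ p 1) := by
  have : ProperSpace X := FiniteDimensional.proper ℝ X
  have : CompleteSpace X := FiniteDimensional.complete ℝ X
  have key : ∀ p0 : X, ∃ α : X × ℝ → X, (∀ x ∈ Metric.closedBall p0 1, α ⟨x, 0⟩ = x ∧
      IsSol H (fun t => α ⟨x, t⟩)) ∧
      ContinuousOn α (Metric.closedBall p0 1 ×ˢ Set.Icc 0 1) := by
    intro p0
    obtain ⟨K, hK⟩ := (hH.contDiffOn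
      (s := Metric.closedBall p0 ((‖p0‖₊ + 3 : NNReal) : ℝ))).exists_lipschitzOnWith
      one_ne_zero (convex_closedBall _ _) (isCompact_closedBall _ _)
    have hpl : IsPicardLindelof (fun _ => H) (tmin := 0) (tmax := 1)
        ⟨(0 : ℝ), Set.left_mem_Icc.2 zero_le_one⟩ p0 (‖p0‖₊ + 3) 1
        ((1 + (‖p0‖₊ + (‖p0‖₊ + 3))) / 4) K := by
      refine ⟨fun t _ => hK, fun x _ => continuousOn_const, fun t _ x hx => ?_, ?_⟩
      · refine (hb x).trans ?_
        push_cast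
        gcongr
        have h1 : ‖x - p0‖ ≤ ‖p0‖ + 3 := by
          simpa [dist_eq_norm] using hx
        have h2 : ‖x‖ ≤ ‖p0‖ + ‖x - p0‖ := by
          simpa using norm_add_le p0 (x - p0)
        linarith
      · push_cast
        norm_num
        linarith [norm_nonneg p0]
    obtain ⟨α, h1, h2⟩ := hpl.exists_forall_mem_closedBall_eq_hasDerivWithinAt_continuousOn
    exact ⟨α, h1, h2⟩
  choose α h1 h2 using key
  refine ⟨fun p t => α p (p, t), fun p => (h1 p p (by simp)).1, fun p => (h1 p p (by simp)).2, ?_⟩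
  rw [continuous_iff_continuousAt]
  intro p0
  have hev : (fun p => α p (p, 1)) =ᶠ[nhds p0] fun p => α p0 (p, 1) := by
    filter_upwards [Metric.closedBall_mem_nhds p0 one_pos] with p hp
    have a1 := h1 p p (by simp)
    have a2 := h1 p0 p hp
    exact sol_unique hH a1.2 a2.2 (by simp only [a1.1, a2.1])
  rw [continuousAt_congr hev]
  have h3 : ContinuousOn (fun p => α p0 (p, 1)) (Metric.closedBall p0 1) := by
    refine (h2 p0).comp (by fun_prop) ?_
    intro p hp
    exact ⟨hp, Set.right_mem_Icc.2 zero_le_one⟩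
  exact h3.continuousAt (Metric.closedBall_mem_nhds p0 one_pos)

theorem triv {n : ℕ} (f : (Fin n → ℂ) → ℂ) (hf : Continuous f) (y : ℂ) (r : ℝ) (hr : 0 < r)
    (G : (Fin n → ℂ) → (Fin n → ℂ)) (hG : ContDiff ℝ 1 G)
    (hGb : ∀ x, 2 * r * ‖G x‖ ≤ (1 + ‖x‖) / 4) (χ : ℂ → ℂ) (hχ1 : ∀ z, ‖χ z‖ ≤ 1)
    (hχ2 : ∀ z, dist z y < 2 * r → χ z = 1)
    (hd : ∀ (γ : ℝ → Fin n → ℂ) (w : ℂ) (t : ℝ),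
      HasDerivWithinAt γ (w • G (γ t)) (Set.Icc 0 1) t →
      HasDerivWithinAt (fun t => f (γ t)) (w * χ (f (γ t))) (Set.Icc 0 1) t) :
    ∃ φ : (f ⁻¹' Metric.ball y r) ≃ₜ (Metric.ball y r × (f ⁻¹' {y})),
      ∀ x : f ⁻¹' Metric.ball y r, ((φ x).1 : ℂ) = f x.1 := by
  let b : ContDiffBump (0 : ℂ) := ⟨r, 2 * r, hr, by linarith⟩
  let ζ : ℂ → ℂ := fun w => (b w : ℝ) • w
  have hζc : ContDiff ℝ 1 ζ := b.contDiff.smul contDiff_id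
  have hζ1 : ∀ w, ‖w‖ < r → ζ w = w := by
    intro w hw
    have : b w = 1 := b.one_of_mem_closedBall (by simpa using hw.le)
    simp [ζ, this]
  have hζ2 : ∀ w, ‖ζ w‖ ≤ 2 * r := by
    intro w
    by_cases hw : ‖w‖ < 2 * r
    · simp only [ζ, norm_smul, Real.norm_eq_abs, abs_of_nonneg b.nonneg]
      calc b w * ‖w‖ ≤ 1 * ‖w‖ := by gcongr; exact b.le_one
        _ ≤ 2 * r := by linarith
    · have : b w = 0 := b.zero_of_le_dist (by simpa using hw)
      simp [ζ, this, hr.le]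
  let H : (Fin n → ℂ) × ℂ → (Fin n → ℂ) × ℂ := fun p => (ζ p.2 • G p.1, 0)
  have hH : ContDiff ℝ 1 H := by
    refine ContDiff.prodMk ?_ contDiff_const
    exact (hζc.comp contDiff_snd).smul (hG.comp contDiff_fst)
  have hHb : ∀ p, ‖H p‖ ≤ (1 + ‖p‖) / 4 := by
    intro p
    have h1 : ‖H p‖ = ‖ζ p.2 • G p.1‖ := by simp [H, Prod.norm_def]
    rw [h1, norm_smul]
    calc ‖ζ p.2‖ * ‖G p.1‖ ≤ 2 * r * ‖G p.1‖ := by gcongr; exact hζ2 _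
      _ ≤ (1 + ‖p.1‖) / 4 := hGb _
      _ ≤ (1 + ‖p‖) / 4 := by gcongr; exact norm_fst_le p
  obtain ⟨γ, hγ0, hγ, hγc⟩ := flow_lemma hH hHb
  have h2 : ∀ p, ∀ t ∈ Set.Icc (0 : ℝ) 1, (γ p t).2 = p.2 := by
    intro p t ht
    have hder : ∀ t ∈ Set.Icc (0 : ℝ) 1,
        HasDerivWithinAt (fun t => (γ p t).2) 0 (Set.Icc 0 1) t := fun t ht => by
      have := (ContinuousLinearMap.snd ℝ (Fin n → ℂ) ℂ).hasFDerivAt.comp_hasDerivWithinAt t (hγ p t ht)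
      exact this
    have := norm_image_sub_le_of_norm_deriv_le_segment' (C := 0) hder (by simp) t ht
    rw [zero_mul, norm_le_zero_iff, sub_eq_zero, hγ0] at this
    exact this
  have h1 : ∀ p : (Fin n → ℂ) × ℂ, ‖p.2‖ < r → ∀ t ∈ Set.Icc (0 : ℝ) 1,
      HasDerivWithinAt (fun t => (γ p t).1) (p.2 • G (γ p t).1) (Set.Icc 0 1) t := by
    intro p hp t ht
    have := (ContinuousLinearMap.fst ℝ (Fin n → ℂ) ℂ).hasFDerivAt.comp_hasDerivWithinAt t (hγ p t ht)
    have e : p.2 • G (γ p t).1 = (ContinuousLinearMap.fst ℝ (Fin n → ℂ) ℂ) (H (γ p t)) := by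
      simp [H, h2 p t ht, hζ1 _ hp]
    rw [e]
    exact this
  let Θ : (Fin n → ℂ) → ℂ → (Fin n → ℂ) := fun x w => (γ (x, w) 1).1
  have hΘc : Continuous fun p : (Fin n → ℂ) × ℂ => Θ p.1 p.2 := continuous_fst.comp hγc
  have hΘf : ∀ x w, ‖w‖ < r → dist (f x) y < r → f (Θ x w) = f x + w := by
    intro x w hw hx
    have hder : ∀ t ∈ Set.Icc (0 : ℝ) 1, HasDerivWithinAt (fun t => f (γ (x, w) t).1)
        (w * χ (f (γ (x, w) t).1)) (Set.Icc 0 1) t := fun t ht => hd _ w t (h1 (x, w) hw t ht)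
    have hbd : ∀ t ∈ Set.Icc (0 : ℝ) 1, dist (f (γ (x, w) t).1) y < 2 * r := by
      intro t ht
      have h3 := norm_image_sub_le_of_norm_deriv_le_segment' (C := ‖w‖) hder (fun t _ => by
        rw [norm_mul]
        calc ‖w‖ * ‖χ (f (γ (x, w) t).1)‖ ≤ ‖w‖ * 1 := by gcongr; exact hχ1 _
          _ = ‖w‖ := mul_one _) t ht
      rw [hγ0] at h3
      have h4 : ‖w‖ * (t - 0) ≤ ‖w‖ := by
        have := mul_le_mul_of_nonneg_left ht.2 (norm_nonneg w)
        linarith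
      have h5 := dist_triangle (f (γ (x, w) t).1) (f x) y
      rw [dist_eq_norm (f (γ (x, w) t).1) (f x)] at h5
      change ‖f (γ (x, w) t).1 - f x‖ ≤ _ at h3
      linarith
    have hder2 : ∀ t ∈ Set.Icc (0 : ℝ) 1, HasDerivWithinAt (fun t : ℝ => f (γ (x, w) t).1 - t * w)
        0 (Set.Icc 0 1) t := fun t ht => by
      have h3 := hder t ht
      rw [hχ2 _ (hbd t ht), mul_one] at h3
      have h4 : HasDerivWithinAt (fun t : ℝ => (t : ℂ) * w) (1 * w) (Set.Icc 0 1) t :=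
        (Complex.ofRealCLM.hasDerivWithinAt (s := Set.Icc 0 1) (x := t)).mul_const w
      have h5 := h3.sub h4
      rw [one_mul, sub_self] at h5
      exact h5
    have := norm_image_sub_le_of_norm_deriv_le_segment_01' (C := 0) hder2 (by simp)
    rw [norm_le_zero_iff, sub_eq_zero, hγ0] at this
    simp only [Complex.ofReal_one, one_mul, Complex.ofReal_zero, zero_mul, sub_zero] at this
    exact sub_eq_iff_eq_add.1 this
  have hΘr : ∀ x w, ‖w‖ < r → Θ (Θ x w) (-w) = x := by
    intro x w hw
    have hrev : IsSol H (fun t => ((γ (x, w) (1 - t)).1, -w)) := by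
      intro t ht
      have ht' : 1 - t ∈ Set.Icc (0 : ℝ) 1 := ⟨by linarith [ht.2], by linarith [ht.1]⟩
      have h3 := h1 (x, w) hw (1 - t) ht'
      have h4 : HasDerivWithinAt (fun t : ℝ => 1 - t) (-1) (Set.Icc 0 1) t := by
        simpa using (hasDerivWithinAt_id t (Set.Icc 0 1)).const_sub 1
      have h5 := HasDerivWithinAt.scomp t h3 h4 (fun s hs => ⟨by linarith [hs.2], by linarith [hs.1]⟩)
      have h6 := h5.prodMk (hasDerivWithinAt_const t (Set.Icc (0 : ℝ) 1) (-w))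
      convert! h6 using 1
      simp [H, hζ1 (-w) (by simpa using hw)]
    have h7 := sol_unique hH hrev (hγ (Θ x w, -w)) (by simp [hγ0, Θ])
    have h8 := congrArg Prod.fst h7
    simp only [sub_self, hγ0] at h8
    exact h8.symm
  have hy : ∀ p : f ⁻¹' {y}, f p.1 = y := fun p => p.2
  have hx : ∀ x : f ⁻¹' Metric.ball y r, dist (f x.1) y < r := fun x => x.2
  have hx' : ∀ x : f ⁻¹' Metric.ball y r, ‖y - f x.1‖ < r := fun x => by
    rw [← dist_eq_norm, dist_comm]; exact x.2
  have hz : ∀ z : Metric.ball y r, ‖(z : ℂ) - y‖ < r := fun z => by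
    rw [← dist_eq_norm]; exact z.2
  let φ : (f ⁻¹' Metric.ball y r) ≃ₜ (Metric.ball y r × (f ⁻¹' {y})) :=
    { toFun := fun x => (⟨f x.1, x.2⟩, ⟨Θ x.1 (y - f x.1), by
        change f _ = y
        rw [hΘf _ _ (hx' x) (hx x)]; ring⟩)
      invFun := fun p => ⟨Θ p.2.1 (p.1.1 - y), by
        change f _ ∈ Metric.ball y r
        rw [hΘf _ _ (hz p.1) (by rw [hy p.2, dist_self]; exact hr), hy p.2]
        simpa using p.1.2⟩
      left_inv := fun x => by
        apply Subtype.ext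
        change Θ (Θ x.1 (y - f x.1)) (f x.1 - y) = x.1
        rw [← neg_sub y, hΘr _ _ (hx' x)]
      right_inv := fun p => by
        have e : f (Θ p.2.1 (p.1.1 - y)) = p.1.1 := by
          rw [hΘf _ _ (hz p.1) (by rw [hy p.2, dist_self]; exact hr), hy p.2]
          ring
        apply Prod.ext
        · exact Subtype.ext e
        · apply Subtype.ext
          change Θ (Θ p.2.1 (p.1.1 - y)) (y - f (Θ p.2.1 (p.1.1 - y))) = p.2.1
          rw [e, ← neg_sub p.1.1 y, hΘr _ _ (hz p.1)]
      continuous_toFun := by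
        refine Continuous.prodMk (Continuous.subtype_mk (by fun_prop) _)
          (Continuous.subtype_mk ?_ _)
        exact hΘc.comp (f := fun x : f ⁻¹' Metric.ball y r => (x.1, y - f x.1)) (by fun_prop)
      continuous_invFun := by
        refine Continuous.subtype_mk ?_ _
        exact hΘc.comp (f := fun p : Metric.ball y r × (f ⁻¹' {y}) => (p.2.1, p.1.1 - y))
          (by fun_prop) }
  exact ⟨φ, fun x => rfl⟩

theorem bound_adjoin {n : ℕ} (P : MvPolynomial (Fin n) ℂ) (M : ℝ) (c : MvPolynomial (Fin n) ℂ)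
    (hc : c ∈ Algebra.adjoin ℂ (insert P (Set.range (gen P)))) :
    ∃ C : ℝ, 0 ≤ C ∧ ∀ x : Fin n → ℂ, ‖MvPolynomial.eval x P‖ ≤ M →
      (∀ l, ‖MvPolynomial.eval x (gen P l)‖ ≤ 1) → ‖MvPolynomial.eval x c‖ ≤ C := by
  induction hc using Algebra.adjoin_induction with
  | mem c hc =>
    rcases hc with rfl | ⟨l, rfl⟩
    · exact ⟨max M 0, le_max_right _ _, fun x h _ => h.trans (le_max_left _ _)⟩
    · exact ⟨1, zero_le_one, fun x _ h => h l⟩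
  | algebraMap a => exact ⟨‖a‖, norm_nonneg _, fun x _ _ => by simp [MvPolynomial.algebraMap_eq]⟩
  | add a b _ _ ha hb =>
    obtain ⟨A, hA, hA'⟩ := ha
    obtain ⟨B, hB, hB'⟩ := hb
    refine ⟨A + B, add_nonneg hA hB, fun x h1 h2 => ?_⟩
    rw [map_add]
    exact (norm_add_le _ _).trans (add_le_add (hA' x h1 h2) (hB' x h1 h2))
  | mul a b _ _ ha hb =>
    obtain ⟨A, hA, hA'⟩ := ha
    obtain ⟨B, hB, hB'⟩ := hb
    refine ⟨A * B, mul_nonneg hA hB, fun x h1 h2 => ?_⟩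
    rw [map_mul, norm_mul]
    exact mul_le_mul (hA' x h1 h2) (hB' x h1 h2) (norm_nonneg _) hA

theorem malgrange_bound {n : ℕ} (P : MvPolynomial (Fin n) ℂ) :
    ∃ B : Set ℂ, B.Finite ∧ ∀ y ∉ B, ∃ r > 0, ∃ η > 0, ∀ x : Fin n → ℂ,
      dist (MvPolynomial.eval x P) y < r →
      ∃ i, η ≤ ‖MvPolynomial.eval x (MvPolynomial.pderiv i P)‖ * (1 + ‖x‖) := by
  obtain ⟨q, hq, c, hc, h⟩ := malgrange_alg P
  refine ⟨{y | q.eval y = 0}, ?_, fun y hy => ?_⟩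
  · exact Polynomial.finite_setOf_isRoot hq
  have hy0 : 0 < ‖q.eval y‖ := norm_pos_iff.2 hy
  have hcont : ContinuousAt (fun z => ‖q.eval z‖) y := by fun_prop
  obtain ⟨r, hr, hr'⟩ := Metric.eventually_nhds_iff.1
    (hcont.eventually (lt_mem_nhds (half_lt_self hy0)))
  choose D hD0 hD using fun l => bound_adjoin P (‖y‖ + 1) (c l) (hc l)
  set S := ∑ l, D l with hS
  have hS0 : 0 ≤ S := Finset.sum_nonneg fun l _ => hD0 l
  refine ⟨min r 1, lt_min hr one_pos, min 1 (‖q.eval y‖ / 2 / (S + 1)),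
    lt_min one_pos (by positivity), fun x hx => ?_⟩
  by_contra! hcon
  set η := min 1 (‖q.eval y‖ / 2 / (S + 1)) with hη
  have hη0 : 0 ≤ η := le_min zero_le_one (by positivity)
  have hg : ∀ l, ‖MvPolynomial.eval x (gen P l)‖ ≤ η := by
    intro l
    have h1 := hcon l.1
    refine le_trans ?_ h1.le
    rw [gen, map_mul, norm_mul, mul_comm]
    gcongr
    rcases l with ⟨i, _ | j⟩
    · simp
    · simp only [Option.elim, MvPolynomial.eval_X]
      linarith [norm_le_pi_norm x j]
  have hM : ‖MvPolynomial.eval x P‖ ≤ ‖y‖ + 1 := by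
    have h1 := norm_sub_norm_le (MvPolynomial.eval x P) y
    rw [← dist_eq_norm] at h1
    have h2 := lt_of_lt_of_le hx (min_le_right _ _)
    linarith
  have hlow := hr' (lt_of_lt_of_le hx (min_le_left _ _))
  have heq : q.eval (MvPolynomial.eval x P) = ∑ l, MvPolynomial.eval x (gen P l) *
      MvPolynomial.eval x (c l) := by
    have h1 := congrArg (MvPolynomial.eval x) h
    simp only [map_sum, map_mul] at h1
    rw [← h1]
    have h2 := Polynomial.hom_eval₂ q (algebraMap ℂ (MvPolynomial (Fin n) ℂ)) (MvPolynomial.eval x) P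
    rw [aeval_def, h2]
    have : (MvPolynomial.eval x).comp (algebraMap ℂ (MvPolynomial (Fin n) ℂ)) = RingHom.id ℂ := by
      ext a <;> simp [MvPolynomial.algebraMap_eq]
    rw [this]
    rfl
  have hup : ‖q.eval (MvPolynomial.eval x P)‖ ≤ η * S := by
    rw [heq, hS, Finset.mul_sum]
    refine (norm_sum_le _ _).trans (Finset.sum_le_sum fun l _ => ?_)
    rw [norm_mul]
    exact mul_le_mul (hg l) (hD l x hM fun m => (hg m).trans (min_le_left _ _)) (norm_nonneg _) hη0
  have h3 : η * S ≤ ‖q.eval y‖ / 2 := by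
    calc η * S ≤ (‖q.eval y‖ / 2 / (S + 1)) * (S + 1) := by
          gcongr
          · exact min_le_right _ _
          · linarith
      _ = ‖q.eval y‖ / 2 := by field_simp
  linarith

theorem hasDerivWithinAt_eval {n : ℕ} (P : MvPolynomial (Fin n) ℂ) (γ : ℝ → Fin n → ℂ)
    (v : Fin n → ℂ) (s : Set ℝ) (t : ℝ) (h : HasDerivWithinAt γ v s t) :
    HasDerivWithinAt (fun t => MvPolynomial.eval (γ t) P)
      (∑ i, MvPolynomial.eval (γ t) (MvPolynomial.pderiv i P) * v i) s t := by
  have hi := hasDerivWithinAt_pi.1 h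
  induction P using MvPolynomial.induction_on with
  | C a => simpa using hasDerivWithinAt_const t s a
  | add p q hp hq =>
    have := hp.add hq
    simp only [map_add, add_mul, Finset.sum_add_distrib]
    exact this
  | mul_X p i hp =>
    have := hp.mul (hi i)
    simp only [map_mul, MvPolynomial.eval_X, Derivation.leibniz, MvPolynomial.pderiv_X, map_add,
      smul_eq_mul]
    convert! this using 1
    simp only [add_mul, Finset.sum_add_distrib]
    rw [add_comm]
    congr 1
    · rw [Finset.sum_mul]
      exact Finset.sum_congr rfl fun j _ => by ring
    · rw [Finset.sum_eq_single i]
      · simp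
      · intro j _ hj
        simp [Pi.single_apply, hj.symm, hj]
      · simp

theorem contDiff_eval {n : ℕ} (P : MvPolynomial (Fin n) ℂ) :
    ContDiff ℝ 1 (fun x : Fin n → ℂ => MvPolynomial.eval x P) := by
  induction P using MvPolynomial.induction_on with
  | C a => simpa using contDiff_const
  | add p q hp hq => simpa using hp.add hq
  | mul_X p i hp => simpa using hp.mul (contDiff_apply ℝ ℂ i)

theorem triv_poly {n : ℕ} (P : MvPolynomial (Fin n) ℂ) (y : ℂ) (r η : ℝ) (hr : 0 < r) (hη : 0 < η)
    (hrη : 8 * r ≤ η)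
    (hM : ∀ x : Fin n → ℂ, dist (MvPolynomial.eval x P) y < 4 * r →
      ∃ i, η ≤ ‖MvPolynomial.eval x (MvPolynomial.pderiv i P)‖ * (1 + ‖x‖)) :
    ∃ φ : ((fun x => MvPolynomial.eval x P) ⁻¹' Metric.ball y r) ≃ₜ
      (Metric.ball y r × ((fun x => MvPolynomial.eval x P) ⁻¹' {y})),
      ∀ x : (fun x => MvPolynomial.eval x P) ⁻¹' Metric.ball y r,
        ((φ x).1 : ℂ) = MvPolynomial.eval x.1 P := by
  set f : (Fin n → ℂ) → ℂ := fun x => MvPolynomial.eval x P with hf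
  let d : Fin n → (Fin n → ℂ) → ℂ := fun i x => MvPolynomial.eval x (MvPolynomial.pderiv i P)
  let S : (Fin n → ℂ) → ℝ := fun x => ∑ j, ‖d j x‖ ^ 2
  have hfc : ContDiff ℝ 1 f := contDiff_eval P
  have hdc : ∀ i, ContDiff ℝ 1 (d i) := fun i => contDiff_eval _
  have hSc : ContDiff ℝ 1 S := ContDiff.sum fun i _ => (hdc i).norm_sq ℝ
  have hS0 : ∀ x, 0 ≤ S x := fun x => Finset.sum_nonneg fun j _ => by positivity
  have hdS : ∀ x i, ‖d i x‖ ^ 2 ≤ S x := fun x i =>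
    Finset.single_le_sum (f := fun j => ‖d j x‖ ^ 2) (fun j _ => by positivity) (Finset.mem_univ i)
  have hSpos : ∀ x, dist (f x) y < 4 * r → 0 < S x := by
    intro x hx
    obtain ⟨i, hi⟩ := hM x hx
    have h1 : 0 < ‖d i x‖ := by
      by_contra! h0
      have h2 : ‖d i x‖ = 0 := le_antisymm h0 (norm_nonneg _)
      change η ≤ ‖d i x‖ * _ at hi
      rw [h2, zero_mul] at hi
      linarith
    exact lt_of_lt_of_le (by positivity) (hdS x i)
  let b : ContDiffBump y := ⟨2 * r, 3 * r, by linarith, by linarith⟩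
  let G : (Fin n → ℂ) → (Fin n → ℂ) := fun x i =>
    (b (f x) / S x : ℝ) • (starRingEnd ℂ) (d i x)
  have hb0 : ∀ x, ¬ dist (f x) y < 3 * r → b (f x) = 0 := fun x hx =>
    b.zero_of_le_dist (not_lt.1 hx)
  have hGc : ContDiff ℝ 1 G := by
    rw [contDiff_pi]
    intro i
    rw [contDiff_iff_contDiffAt]
    intro x
    by_cases hx : dist (f x) y < 4 * r
    · refine ContDiffAt.smul (ContDiffAt.div ?_ hSc.contDiffAt (hSpos x hx).ne') ?_
      · exact (b.contDiff.comp hfc).contDiffAt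
      · exact (Complex.conjCLE.contDiff.comp (hdc i)).contDiffAt
    · have hev : (fun x => G x i) =ᶠ[nhds x] fun _ => 0 := by
        have hco : Continuous fun x => dist (f x) y := hfc.continuous.dist continuous_const
        have : 3 * r < dist (f x) y := by linarith
        filter_upwards [hco.continuousAt.eventually (lt_mem_nhds this)] with z hz
        simp [G, hb0 z (not_lt.2 (le_of_lt hz))]
      exact contDiffAt_const.congr_of_eventuallyEq hev
  have hGb : ∀ x, 2 * r * ‖G x‖ ≤ (1 + ‖x‖) / 4 := by
    intro x
    have h1 : ‖G x‖ ≤ (1 + ‖x‖) / η := by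
      rw [pi_norm_le_iff_of_nonneg (by positivity)]
      intro j
      by_cases hx : dist (f x) y < 3 * r
      · have hx4 : dist (f x) y < 4 * r := by linarith
        obtain ⟨i, hi⟩ := hM x hx4
        change η ≤ ‖d i x‖ * _ at hi
        have hSp := hSpos x hx4
        have hb1 : b (f x) ≤ 1 := b.le_one
        have hbn : 0 ≤ b (f x) := b.nonneg
        have hn : ‖G x j‖ = b (f x) / S x * ‖d j x‖ := by
          simp only [G, norm_smul, RCLike.norm_conj, Real.norm_eq_abs]
          rw [abs_of_nonneg (by positivity)]
        rw [hn, div_mul_eq_mul_div, div_le_div_iff₀ hSp hη]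
        have h2 : ‖d j x‖ * ‖d i x‖ ≤ S x := by
          nlinarith [hdS x i, hdS x j, sq_nonneg (‖d j x‖ - ‖d i x‖)]
        calc b (f x) * ‖d j x‖ * η ≤ 1 * ‖d j x‖ * (‖d i x‖ * (1 + ‖x‖)) := by gcongr
          _ = (‖d j x‖ * ‖d i x‖) * (1 + ‖x‖) := by ring
          _ ≤ S x * (1 + ‖x‖) := by gcongr
          _ = (1 + ‖x‖) * S x := mul_comm _ _
      · simp only [G, hb0 x hx, zero_div, zero_smul, norm_zero]
        positivity
    calc 2 * r * ‖G x‖ ≤ 2 * r * ((1 + ‖x‖) / η) := by gcongr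
      _ = 8 * r * (1 + ‖x‖) / (4 * η) := by field_simp; ring
      _ ≤ η * (1 + ‖x‖) / (4 * η) := by gcongr
      _ = (1 + ‖x‖) / 4 := by field_simp
  refine triv f hfc.continuous y r hr G hGc hGb (fun z => (b z : ℂ)) ?_ ?_ ?_
  · intro z
    rw [Complex.norm_real, Real.norm_eq_abs, abs_of_nonneg b.nonneg]
    exact b.le_one
  · intro z hz
    have : b z = 1 := b.one_of_mem_closedBall (Metric.mem_closedBall.2 hz.le)
    simp [this]
  · intro γ w t h
    have h1 := hasDerivWithinAt_eval P γ _ _ t h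
    convert! h1 using 1
    change _ = ∑ i, d i (γ t) * (w • G (γ t)) i
    by_cases hx : dist (f (γ t)) y < 3 * r
    · have hSp := hSpos (γ t) (by linarith)
      have h2 : ∀ i, d i (γ t) * (w • G (γ t)) i =
          w * (b (f (γ t)) / S (γ t) : ℝ) * ((‖d i (γ t)‖ ^ 2 : ℝ) : ℂ) := by
        intro i
        have h3 := Complex.mul_conj' (d i (γ t))
        simp only [Pi.smul_apply, smul_eq_mul, G, Complex.real_smul]
        push_cast
        rw [← h3]
        ring
      rw [Finset.sum_congr rfl fun i _ => h2 i, ← Finset.mul_sum, ← Complex.ofReal_sum, mul_assoc,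
        ← Complex.ofReal_mul]
      congr 2
      change b (f (γ t)) = b (f (γ t)) / S (γ t) * S (γ t)
      field_simp
    · simp [G, hb0 _ hx]

theorem exists_bifurcation_set (n : ℕ) (hn : 1 ≤ n) (P : MvPolynomial (Fin n) ℂ) :
    ∃ Bf : Set ℂ, Admissible (fun x => MvPolynomial.eval x P) Bf ∧
      ∀ B : Set ℂ, Admissible (fun x => MvPolynomial.eval x P) B → Bf ⊆ B := by
  have hex : ∃ B : Set ℂ, Admissible (fun x => MvPolynomial.eval x P) B := by
    obtain ⟨B, hB, h⟩ := malgrange_bound P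
    refine ⟨B, hB, fun y hy => ?_⟩
    obtain ⟨r, hr, η, hη, hM⟩ := h y hy
    obtain ⟨s, hs, hsB⟩ := Metric.isOpen_iff.1 hB.isClosed.isOpen_compl y hy
    have hρ : 0 < min (min (r / 4) (η / 8)) s := by positivity
    have h1 : min (min (r / 4) (η / 8)) s ≤ r / 4 := (min_le_left _ _).trans (min_le_left _ _)
    have h2 : min (min (r / 4) (η / 8)) s ≤ η / 8 := (min_le_left _ _).trans (min_le_right _ _)
    obtain ⟨φ, hφ⟩ := triv_poly P y (min (min (r / 4) (η / 8)) s) η hρ hη (by linarith)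
      (fun x hx => hM x (by linarith))
    exact ⟨Metric.ball y (min (min (r / 4) (η / 8)) s), Metric.isOpen_ball,
      Metric.mem_ball_self hρ, (Metric.ball_subset_ball (min_le_right _ _)).trans hsB, φ, hφ⟩
  refine ⟨⋂₀ {B | Admissible (fun x => MvPolynomial.eval x P) B}, ⟨?_, fun y hy => ?_⟩,
    fun B hB => Set.sInter_subset_of_mem hB⟩
  · obtain ⟨B, hB⟩ := hex
    exact hB.1.subset (Set.sInter_subset_of_mem hB)
  · rw [Set.mem_sInter] at hy
    push Not at hy
    obtain ⟨B, hB, hyB⟩ := hy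
    obtain ⟨V, hV, hyV, hVB, hφ⟩ := hB.2 y hyB
    exact ⟨V, hV, hyV, hVB.trans (Set.compl_subset_compl.2 (Set.sInter_subset_of_mem hB)), hφ⟩
end
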